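/- For any nonnegative integers j and k, the function ψ̄ satisfies ‖D_y^j ∂_α^k ψ̄‖ ≤ C_{jk} ε² ‖ρ‖_{H^{J+k}}, where J := max{j−2, 0} and the constants C_{jk} are independent of ε, for all sufficiently small ε. -/

import Mathlib

open Filter Topology MeasureTheory Real
open scoped RealInnerProductSpace

set_option linter.unusedVariables false
noncomputable section

/-- Euclidean three-space `ℝ³`. -/
abbrev E3 := EuclideanSpace ℝ (Fin 3)

/-- Partial derivative of a scalar function on `ℝ³` in the `i`-th coordinate direction. -/
def pd (i : Fin 3) (f : E3 → ℝ) (x : E3) : ℝ :=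
  fderiv ℝ f x (EuclideanSpace.single i 1)

/-- The curl of a vector field on `ℝ³`. -/
def curl3 (v : E3 → E3) (x : E3) : E3 :=
  (EuclideanSpace.equiv (Fin 3) ℝ).symm
    ![pd 1 (fun z => v z 2) x - pd 2 (fun z => v z 1) x,
      pd 2 (fun z => v z 0) x - pd 0 (fun z => v z 2) x,
      pd 0 (fun z => v z 1) x - pd 1 (fun z => v z 0) x]

/-- The divergence of a vector field on `ℝ³`. -/
def div3 (v : E3 → E3) (x : E3) : ℝ := ∑ i, pd i (fun z => v z i) x

/-- The gradient of a scalar function on `ℝ³`. -/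
def grad3 (f : E3 → ℝ) (x : E3) : E3 :=
  (EuclideanSpace.equiv (Fin 3) ℝ).symm ![pd 0 f x, pd 1 f x, pd 2 f x]

/-- The (Euclidean) Laplacian of a scalar function on `ℝ³`. -/
def lap3 (f : E3 → ℝ) (x : E3) : ℝ := ∑ i, pd i (pd i f) x

/-- A closed analytic curve in `ℝ³`, parametrized by arc length with period `ℓ`,
with nowhere vanishing curvature `κ`, torsion `τ`, and Frenet normal and binormal
`e₁`, `e₂`. -/
structure FramedCurve where
  ℓ : ℝ
  hℓ : 0 < ℓ
  γ : ℝ → E3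
  e₁ : ℝ → E3
  e₂ : ℝ → E3
  κ : ℝ → ℝ
  τ : ℝ → ℝ
  analytic_γ : ∀ t : ℝ, AnalyticAt ℝ γ t
  smooth_e₁ : ContDiff ℝ (⊤ : ℕ∞) e₁
  smooth_e₂ : ContDiff ℝ (⊤ : ℕ∞) e₂
  smooth_κ : ContDiff ℝ (⊤ : ℕ∞) κ
  smooth_τ : ContDiff ℝ (⊤ : ℕ∞) τ
  periodic_γ : Function.Periodic γ ℓ
  periodic_e₁ : Function.Periodic e₁ ℓ
  periodic_e₂ : Function.Periodic e₂ ℓ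
  periodic_κ : Function.Periodic κ ℓ
  periodic_τ : Function.Periodic τ ℓ
  injOn : Set.InjOn γ (Set.Ico 0 ℓ)
  unit_speed : ∀ t, ‖deriv γ t‖ = 1
  κ_pos : ∀ t, 0 < κ t
  frenet₁ : ∀ t, deriv (deriv γ) t = κ t • e₁ t
  frenet₂ : ∀ t, deriv e₁ t = τ t • e₂ t - κ t • deriv γ t
  frenet₃ : ∀ t, deriv e₂ t = -(τ t) • e₁ t
  unit_e₁ : ∀ t, ‖e₁ t‖ = 1
  unit_e₂ : ∀ t, ‖e₂ t‖ = 1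
  orth₁₂ : ∀ t, ⟪e₁ t, e₂ t⟫ = 0
  orth₀₁ : ∀ t, ⟪deriv γ t, e₁ t⟫ = 0
  orth₀₂ : ∀ t, ⟪deriv γ t, e₂ t⟫ = 0

/-- The point of the tube with coordinates `(α, y)`:
`γ(α) + ε y₁ e₁(α) + ε y₂ e₂(α)`. -/
def tubeCoord (Γ : FramedCurve) (ε : ℝ) (α : ℝ) (y : ℝ × ℝ) : E3 :=
  Γ.γ α + (ε * y.1) • Γ.e₁ α + (ε * y.2) • Γ.e₂ α

/-- The open tube `𝒯_ε(γ) = {x : dist (x, γ) < ε}` of core `γ` and thickness `ε`. -/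
def TubeSet (Γ : FramedCurve) (ε : ℝ) : Set E3 :=
  Metric.thickening ε (Set.range Γ.γ)

/-- A vector field is tangent to the boundary torus `∂𝒯_ε`: at every boundary point it
lies in the tangent plane of the torus, spanned by the `α`- and `θ`-coordinate vectors. -/
def TangentToBoundary (Γ : FramedCurve) (ε : ℝ) (v : E3 → E3) : Prop :=
  ∀ α θ : ℝ, v (tubeCoord Γ ε α (cos θ, sin θ)) ∈
    Submodule.span ℝ
      ({deriv (fun t => tubeCoord Γ ε t (cos θ, sin θ)) α,
        deriv (fun t => tubeCoord Γ ε α (cos t, sin t)) θ} : Set E3)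

/-- The reference field `h₀ = B⁻²(∂_α + τ ∂_θ)` of the tube, written in ambient terms;
here `B = 1 - εκy₁` and `∂_α`, `∂_θ` are coordinate vector fields of `(α, y)`. -/
def h0At (Γ : FramedCurve) (ε : ℝ) (α : ℝ) (y : ℝ × ℝ) : E3 :=
  ((1 - ε * Γ.κ α * y.1) ^ 2)⁻¹ •
    (deriv (fun t => tubeCoord Γ ε t y) α +
      (ε * Γ.τ α) • (y.1 • Γ.e₂ α - y.2 • Γ.e₁ α))

/-- `h` is the harmonic field of the tube `𝒯_ε`: a divergence-free, irrotational field
tangent to the boundary, normalized by `h = h₀ + ∇ψ` for a scalar function `ψ`. -/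
def IsTubeHarmonic (Γ : FramedCurve) (ε : ℝ) (h : E3 → E3) : Prop :=
  (∃ Ω : Set E3, IsOpen Ω ∧ closure (TubeSet Γ ε) ⊆ Ω ∧ ContDiffOn ℝ (⊤ : ℕ∞) h Ω ∧
    ∀ x ∈ Ω, div3 h x = 0 ∧ curl3 h x = 0) ∧
  TangentToBoundary Γ ε h ∧
  ∃ ψ : E3 → ℝ, ∀ (α : ℝ) (y : ℝ × ℝ), y.1 ^ 2 + y.2 ^ 2 ≤ 1 →
    h (tubeCoord Γ ε α y) = h0At Γ ε α y + grad3 ψ (tubeCoord Γ ε α y)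

/-- `v` is the local Beltrami field of the tube `𝒯_ε`: it solves `curl v = ε³ v` in a
neighborhood of the closed tube, is tangent to the boundary, and its harmonic part
(`L²` projection onto the harmonic fields) is the harmonic field `h`. -/
def IsLocalBeltrami (Γ : FramedCurve) (ε : ℝ) (v : E3 → E3) : Prop :=
  (∃ Ω : Set E3, IsOpen Ω ∧ closure (TubeSet Γ ε) ⊆ Ω ∧ ContDiffOn ℝ (⊤ : ℕ∞) v Ω ∧
    ∀ x ∈ Ω, curl3 v x = (ε ^ 3) • v x) ∧
  TangentToBoundary Γ ε v ∧
  ∃ h : E3 → E3, IsTubeHarmonic Γ ε h ∧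
    ∫ x in TubeSet Γ ε, ⟪h x, v x - h x⟫ = 0

/-- The components `(u_α, u₁, u₂)` of a vector field `u` in the coordinates `(α, y)`,
i.e. `u = u_α ∂_α + u₁ ∂_{y₁} + u₂ ∂_{y₂}`, as functions of `(α, y₁, y₂)`. -/
def ComponentsOn (Γ : FramedCurve) (ε : ℝ) (u : E3 → E3)
    (cα c₁ c₂ : ℝ × ℝ × ℝ → ℝ) : Prop :=
  ∀ (α : ℝ) (y : ℝ × ℝ), y.1 ^ 2 + y.2 ^ 2 ≤ 1 →
    u (tubeCoord Γ ε α y) =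
      cα (α, y.1, y.2) • deriv (fun t => tubeCoord Γ ε t y) α +
      (ε * c₁ (α, y.1, y.2)) • Γ.e₁ α + (ε * c₂ (α, y.1, y.2)) • Γ.e₂ α

/-- Coordinates `(α, y₁, y₂)` on `𝕊¹_ℓ × 𝔻²`. -/
abbrev P3 := ℝ × ℝ × ℝ

/-- Partial derivative in the slow variable `α`. -/
def pA (f : P3 → ℝ) (p : P3) : ℝ := fderiv ℝ f p (1, 0, 0)
/-- Partial derivative in the fast variable `y₁`. -/
def p1 (f : P3 → ℝ) (p : P3) : ℝ := fderiv ℝ f p (0, 1, 0)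
/-- Partial derivative in the fast variable `y₂`. -/
def p2 (f : P3 → ℝ) (p : P3) : ℝ := fderiv ℝ f p (0, 0, 1)

/-- The fundamental domain `(0, ℓ] × 𝔻²` of `𝕊¹_ℓ × 𝔻²`. -/
def domP (ℓ : ℝ) : Set P3 := (Set.Ioc 0 ℓ) ×ˢ {y : ℝ × ℝ | y.1 ^ 2 + y.2 ^ 2 ≤ 1}

/-- The closed solid torus `𝕊¹_ℓ × 𝔻²` in the coordinates `(α, y)` (all `α`). -/
def domC : Set P3 := {p : P3 | p.2.1 ^ 2 + p.2.2 ^ 2 ≤ 1}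

/-- Squared `L²` norm on `𝕊¹_ℓ × 𝔻²`. -/
def L2sq (ℓ : ℝ) (f : P3 → ℝ) : ℝ := ∫ p in domP ℓ, (f p) ^ 2

/-- Squared Sobolev `H^k` norm on `𝕊¹_ℓ × 𝔻²`. -/
def SobSq (ℓ : ℝ) (k : ℕ) (f : P3 → ℝ) : ℝ :=
  ∑ j ∈ Finset.range (k + 1), ∫ p in domP ℓ, ‖iteratedFDeriv ℝ j f p‖ ^ 2

/-- `ℓ`-periodicity in the angular variable `α`. -/
def PerA (ℓ : ℝ) (f : P3 → ℝ) : Prop := ∀ p : P3, f (p.1 + ℓ, p.2.1, p.2.2) = f p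

/-- Pullback of a scalar function on the tube to the coordinates `(α, y₁, y₂)`. -/
def pullT (Γ : FramedCurve) (ε : ℝ) (f : E3 → ℝ) : P3 → ℝ :=
  fun p => f (tubeCoord Γ ε p.1 (p.2.1, p.2.2))

/-- `Ψ` solves the Neumann problem `ΔΨ = Ρ` in `𝒯_ε`, `∂_ν Ψ = 0` on `∂𝒯_ε`,
with zero mean `∫ ψ dα dy = 0` in the coordinates `(α, y)`.  (Since the coordinates
are Euclidean, the Laplace–Beltrami operator of the tube metric corresponds to the
Euclidean Laplacian on the tube, and the outward normal at the boundary point of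
coordinates `(α, θ)` is `cos θ e₁(α) + sin θ e₂(α)`.) -/
def NeumannSol (Γ : FramedCurve) (ε : ℝ) (Ψ Ρ : E3 → ℝ) : Prop :=
  (∃ Ω : Set E3, IsOpen Ω ∧ closure (TubeSet Γ ε) ⊆ Ω ∧ ContDiffOn ℝ (⊤ : ℕ∞) Ψ Ω ∧
    ContDiffOn ℝ (⊤ : ℕ∞) Ρ Ω) ∧
  (∀ x ∈ TubeSet Γ ε, lap3 Ψ x = Ρ x) ∧
  (∀ α θ : ℝ, fderiv ℝ Ψ (tubeCoord Γ ε α (cos θ, sin θ))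
      ((cos θ) • Γ.e₁ α + (sin θ) • Γ.e₂ α) = 0) ∧
  (∫ p in domP Γ.ℓ, pullT Γ ε Ψ p = 0)

/-- The coordinate vectors of `(α, y₁, y₂)`. -/
def e3vec : Fin 3 → P3 := ![(1, 0, 0), (0, 1, 0), (0, 0, 1)]

/-- Partial derivative in the `i`-th coordinate. -/
def pdi (i : Fin 3) (f : P3 → ℝ) (p : P3) : ℝ := fderiv ℝ f p (e3vec i)

/-- Iterated partial derivatives along a list of coordinate directions. -/
def pdIter (l : List (Fin 3)) (f : P3 → ℝ) : P3 → ℝ := l.foldr pdi f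

/-- The squared `L²` norm `‖D_y^j ∂_α^k f‖²` of the mixed derivatives, fast
derivatives summed over all the `2^j` choices of `y`-directions. -/
def mixedNormSq (ℓ : ℝ) (j k : ℕ) (f : P3 → ℝ) : ℝ :=
  ∑ s : Fin j → Fin 2,
    L2sq ℓ (pdIter ((List.ofFn s).map Fin.succ)
      (pdIter (List.replicate k (0 : Fin 3)) f))

/-- Subtraction of the disk average:
`ψ̄(α,y) = ψ(α,y) − (1/π) ∫_{𝔻²} ψ(α,y′) dy′`. -/
def barDisk (f : P3 → ℝ) : P3 → ℝ :=
  fun p => f p - (1 / π) * ∫ y in {y : ℝ × ℝ | y.1 ^ 2 + y.2 ^ 2 ≤ 1}, f (p.1, y.1, y.2)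

section
open scoped ContDiff

/-- The angular derivative `∂_θ = y₁∂₂ − y₂∂₁`. -/
def pT (f : P3 → ℝ) (p : P3) : ℝ := p.2.1 * pdi 2 f p - p.2.2 * pdi 1 f p

@[fun_prop]
theorem smooth_pdi (i : Fin 3) {f : P3 → ℝ} (hf : ContDiff ℝ ∞ f) : ContDiff ℝ ∞ (pdi i f) := by
  have h1 : ContDiff ℝ ∞ (fderiv ℝ f) := hf.fderiv_right (by simp)
  exact h1.clm_apply contDiff_const

theorem sm_diff {f : P3 → ℝ} (hf : ContDiff ℝ ∞ f) : Differentiable ℝ f :=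
  hf.differentiable (by simp)

@[fun_prop]
theorem smooth_pT {f : P3 → ℝ} (hf : ContDiff ℝ ∞ f) : ContDiff ℝ ∞ (pT f) := by
  unfold pT
  have h1 := smooth_pdi 1 hf
  have h2 := smooth_pdi 2 hf
  fun_prop

theorem pdi_add (i : Fin 3) {f g : P3 → ℝ} (hf : ContDiff ℝ ∞ f) (hg : ContDiff ℝ ∞ g) :
    pdi i (fun p => f p + g p) = fun p => pdi i f p + pdi i g p := by
  funext p
  unfold pdi
  rw [fderiv_fun_add (sm_diff hf p) (sm_diff hg p)]; rfl

theorem pdi_sub (i : Fin 3) {f g : P3 → ℝ} (hf : ContDiff ℝ ∞ f) (hg : ContDiff ℝ ∞ g) :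
    pdi i (fun p => f p - g p) = fun p => pdi i f p - pdi i g p := by
  funext p
  unfold pdi
  rw [fderiv_fun_sub (sm_diff hf p) (sm_diff hg p)]; rfl

theorem pdi_neg (i : Fin 3) {f : P3 → ℝ} :
    pdi i (fun p => - f p) = fun p => - pdi i f p := by
  funext p
  unfold pdi
  rw [fderiv_fun_neg]; rfl

theorem pdi_mul (i : Fin 3) {f g : P3 → ℝ} (hf : ContDiff ℝ ∞ f) (hg : ContDiff ℝ ∞ g) :
    pdi i (fun p => f p * g p) = fun p => pdi i f p * g p + f p * pdi i g p := by
  funext p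
  unfold pdi
  rw [fderiv_fun_mul (sm_diff hf p) (sm_diff hg p)]
  simp; ring

theorem pdi_const (i : Fin 3) (c : ℝ) : pdi i (fun _ => c) = fun _ => 0 := by
  funext p; unfold pdi; simp

theorem pdi_const_mul (i : Fin 3) (c : ℝ) {g : P3 → ℝ} (hg : ContDiff ℝ ∞ g) :
    pdi i (fun p => c * g p) = fun p => c * pdi i g p := by
  rw [pdi_mul i contDiff_const hg, pdi_const]; simp

theorem pdi_comm (i j : Fin 3) {f : P3 → ℝ} (hf : ContDiff ℝ ∞ f) :
    pdi i (pdi j f) = pdi j (pdi i f) := by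
  funext p
  have h1 : ContDiff ℝ ∞ (fderiv ℝ f) := hf.fderiv_right (by simp)
  have hd : DifferentiableAt ℝ (fderiv ℝ f) p := (h1.differentiable (by simp)) p
  have key : ∀ a b : P3, fderiv ℝ (fun q => fderiv ℝ f q a) p b = fderiv ℝ (fderiv ℝ f) p b a := by
    intro a b
    rw [fderiv_clm_apply hd (differentiableAt_const a)]
    simp
  unfold pdi
  rw [key, key]
  have hs : IsSymmSndFDerivAt ℝ f p := by
    apply (hf.contDiffAt).isSymmSndFDerivAt
    simp only [minSmoothness_of_isRCLikeNormedField]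
    exact WithTop.coe_le_coe.mpr (le_top : (2 : ℕ∞) ≤ ⊤)
  exact hs _ _

theorem hasFDeriv_y1 (p : P3) : HasFDerivAt (fun q : P3 => q.2.1)
    ((ContinuousLinearMap.fst ℝ ℝ ℝ).comp (ContinuousLinearMap.snd ℝ ℝ (ℝ × ℝ))) p :=
  ((ContinuousLinearMap.fst ℝ ℝ ℝ).comp (ContinuousLinearMap.snd ℝ ℝ (ℝ × ℝ))).hasFDerivAt

theorem hasFDeriv_y2 (p : P3) : HasFDerivAt (fun q : P3 => q.2.2)
    ((ContinuousLinearMap.snd ℝ ℝ ℝ).comp (ContinuousLinearMap.snd ℝ ℝ (ℝ × ℝ))) p :=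
  ((ContinuousLinearMap.snd ℝ ℝ ℝ).comp (ContinuousLinearMap.snd ℝ ℝ (ℝ × ℝ))).hasFDerivAt

theorem pdi0_y1 : pdi 0 (fun p : P3 => p.2.1) = fun _ => 0 := by
  funext p; unfold pdi; rw [(hasFDeriv_y1 p).fderiv]; simp [e3vec]
theorem pdi1_y1 : pdi 1 (fun p : P3 => p.2.1) = fun _ => 1 := by
  funext p; unfold pdi; rw [(hasFDeriv_y1 p).fderiv]; simp [e3vec]
theorem pdi2_y1 : pdi 2 (fun p : P3 => p.2.1) = fun _ => 0 := by
  funext p; unfold pdi; rw [(hasFDeriv_y1 p).fderiv]; simp [e3vec]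
theorem pdi0_y2 : pdi 0 (fun p : P3 => p.2.2) = fun _ => 0 := by
  funext p; unfold pdi; rw [(hasFDeriv_y2 p).fderiv]; simp [e3vec]
theorem pdi1_y2 : pdi 1 (fun p : P3 => p.2.2) = fun _ => 0 := by
  funext p; unfold pdi; rw [(hasFDeriv_y2 p).fderiv]; simp [e3vec]
theorem pdi2_y2 : pdi 2 (fun p : P3 => p.2.2) = fun _ => 1 := by
  funext p; unfold pdi; rw [(hasFDeriv_y2 p).fderiv]; simp [e3vec]

theorem sm_y1 : ContDiff ℝ ∞ (fun p : P3 => p.2.1) := by fun_prop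
theorem sm_y2 : ContDiff ℝ ∞ (fun p : P3 => p.2.2) := by fun_prop

theorem pT_add {f g : P3 → ℝ} (hf : ContDiff ℝ ∞ f) (hg : ContDiff ℝ ∞ g) :
    pT (fun p => f p + g p) = fun p => pT f p + pT g p := by
  funext p; unfold pT; rw [pdi_add 1 hf hg, pdi_add 2 hf hg]; ring

theorem pT_mul {f g : P3 → ℝ} (hf : ContDiff ℝ ∞ f) (hg : ContDiff ℝ ∞ g) :
    pT (fun p => f p * g p) = fun p => pT f p * g p + f p * pT g p := by
  funext p; unfold pT; rw [pdi_mul 1 hf hg, pdi_mul 2 hf hg]; ring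

theorem pT_const_mul (c : ℝ) {g : P3 → ℝ} (hg : ContDiff ℝ ∞ g) :
    pT (fun p => c * g p) = fun p => c * pT g p := by
  funext p; unfold pT; rw [pdi_const_mul 1 c hg, pdi_const_mul 2 c hg]; ring

theorem pdi_pT (i : Fin 3) {f : P3 → ℝ} (hf : ContDiff ℝ ∞ f) :
    pdi i (pT f) = fun p => (pdi i (fun q : P3 => q.2.1) p * pdi 2 f p + p.2.1 * pdi i (pdi 2 f) p)
      - (pdi i (fun q : P3 => q.2.2) p * pdi 1 f p + p.2.2 * pdi i (pdi 1 f) p) := by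
  have h1 := smooth_pdi 1 hf
  have h2 := smooth_pdi 2 hf
  have : pT f = fun p => (fun q : P3 => q.2.1 * pdi 2 f q) p - (fun q : P3 => q.2.2 * pdi 1 f q) p := rfl
  rw [this, pdi_sub i (sm_y1.mul h2) (sm_y2.mul h1), pdi_mul i sm_y1 h2, pdi_mul i sm_y2 h1]

theorem pdi0_pT {f : P3 → ℝ} (hf : ContDiff ℝ ∞ f) : pdi 0 (pT f) = pT (pdi 0 f) := by
  rw [pdi_pT 0 hf, pdi0_y1, pdi0_y2]
  funext p; unfold pT; rw [pdi_comm 0 2 hf, pdi_comm 0 1 hf]; ring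

theorem pdi1_pT {f : P3 → ℝ} (hf : ContDiff ℝ ∞ f) :
    pdi 1 (pT f) = fun p => pT (pdi 1 f) p + pdi 2 f p := by
  rw [pdi_pT 1 hf, pdi1_y1, pdi1_y2]
  funext p; unfold pT; rw [pdi_comm 1 2 hf]; ring

theorem pdi2_pT {f : P3 → ℝ} (hf : ContDiff ℝ ∞ f) :
    pdi 2 (pT f) = fun p => pT (pdi 2 f) p - pdi 1 f p := by
  rw [pdi_pT 2 hf, pdi2_y1, pdi2_y2]
  funext p; unfold pT; rw [pdi_comm 2 1 hf]; ring

/-! periodicity -/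
theorem PerA.pdi {ℓ : ℝ} {f : P3 → ℝ} (hf : PerA ℓ f) (i : Fin 3) : PerA ℓ (pdi i f) := by
  have h : (fun q : P3 => f (q + (ℓ, 0, 0))) = f := by
    funext q
    have := hf q
    rw [← this]; congr 1; simp [Prod.ext_iff]
  intro p
  unfold _root_.pdi
  have e : ((p.1 + ℓ, p.2.1, p.2.2) : P3) = p + (ℓ, 0, 0) := by simp [Prod.ext_iff]
  rw [e, ← fderiv_comp_add_right (𝕜 := ℝ) (f := f) ((ℓ, 0, 0) : P3), h]

theorem PerA.mul {ℓ : ℝ} {f g : P3 → ℝ} (hf : PerA ℓ f) (hg : PerA ℓ g) :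
    PerA ℓ (fun p => f p * g p) := fun p => by simp only [hf p, hg p]
theorem PerA.add {ℓ : ℝ} {f g : P3 → ℝ} (hf : PerA ℓ f) (hg : PerA ℓ g) :
    PerA ℓ (fun p => f p + g p) := fun p => by simp only [hf p, hg p]
theorem PerA.sub {ℓ : ℝ} {f g : P3 → ℝ} (hf : PerA ℓ f) (hg : PerA ℓ g) :
    PerA ℓ (fun p => f p - g p) := fun p => by simp only [hf p, hg p]
theorem PerA.pT {ℓ : ℝ} {f : P3 → ℝ} (hf : PerA ℓ f) : PerA ℓ (pT f) := fun p => by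
  simp only [_root_.pT, hf.pdi 1 p, hf.pdi 2 p]

/-! equality on the closed solid torus -/
def domO : Set P3 := {p : P3 | p.2.1 ^ 2 + p.2.2 ^ 2 < 1}

theorem isOpen_domO : IsOpen domO := isOpen_lt (by fun_prop) (by fun_prop)

theorem domC_subset_closure : domC ⊆ closure domO := by
  intro p hp
  have hp' : p.2.1 ^ 2 + p.2.2 ^ 2 ≤ 1 := hp
  have ht : Tendsto (fun t : ℝ => ((p.1, t * p.2.1, t * p.2.2) : P3)) (𝓝[<] 1) (𝓝 p) := by
    have hc : Continuous (fun t : ℝ => ((p.1, t * p.2.1, t * p.2.2) : P3)) := by fun_prop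
    have := (hc.tendsto 1).mono_left (nhdsWithin_le_nhds (s := Set.Iio 1))
    simpa using this
  apply mem_closure_of_tendsto ht
  have : Set.Ioo (0:ℝ) 1 ∈ 𝓝[<] (1:ℝ) := Ioo_mem_nhdsLT (by norm_num)
  filter_upwards [this] with t ht
  show (t * p.2.1) ^ 2 + (t * p.2.2) ^ 2 < 1
  have h1 : t ^ 2 < 1 := by nlinarith [ht.1, ht.2]
  have h0 : 0 ≤ p.2.1 ^ 2 + p.2.2 ^ 2 := by positivity
  nlinarith [sq_nonneg t]

theorem eqOn_domC_of_domO {f g : P3 → ℝ} (hf : Continuous f) (hg : Continuous g)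
    (h : ∀ p ∈ domO, f p = g p) : ∀ p ∈ domC, f p = g p := by
  intro p hp
  have hcl : IsClosed {q : P3 | f q = g q} := isClosed_eq hf hg
  exact (hcl.closure_subset_iff.mpr (fun q hq => h q hq)) (domC_subset_closure hp)

theorem pdi_congr_domC (i : Fin 3) {f g : P3 → ℝ} (hf : ContDiff ℝ ∞ f) (hg : ContDiff ℝ ∞ g)
    (h : ∀ p ∈ domC, f p = g p) : ∀ p ∈ domC, pdi i f p = pdi i g p := by
  apply eqOn_domC_of_domO (smooth_pdi i hf).continuous (smooth_pdi i hg).continuous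
  intro p hp
  have : f =ᶠ[𝓝 p] g := by
    filter_upwards [isOpen_domO.mem_nhds hp] with q hq
    exact h q (show q.2.1 ^ 2 + q.2.2 ^ 2 ≤ 1 from le_of_lt hq)
  unfold pdi
  rw [this.fderiv_eq]

theorem pT_congr_domC {f g : P3 → ℝ} (hf : ContDiff ℝ ∞ f) (hg : ContDiff ℝ ∞ g)
    (h : ∀ p ∈ domC, f p = g p) : ∀ p ∈ domC, pT f p = pT g p := by
  intro p hp
  unfold pT
  rw [pdi_congr_domC 1 hf hg h p hp, pdi_congr_domC 2 hf hg h p hp]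

end

section
open scoped ContDiff

/-- The closed unit disk. -/
def dsk : Set (ℝ × ℝ) := {y : ℝ × ℝ | y.1 ^ 2 + y.2 ^ 2 ≤ 1}

theorem isCompact_dsk : IsCompact dsk := by
  apply (isCompact_Icc (a := ((-1, -1) : ℝ × ℝ)) (b := (1, 1))).of_isClosed_subset
  · exact isClosed_le (by fun_prop) (by fun_prop)
  · rintro ⟨a, b⟩ h
    have h' : a ^ 2 + b ^ 2 ≤ 1 := h
    refine ⟨⟨?_, ?_⟩, ⟨?_, ?_⟩⟩ <;> simp <;> nlinarith [sq_nonneg a, sq_nonneg b]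

theorem measurableSet_dsk : MeasurableSet dsk := isCompact_dsk.isClosed.measurableSet

theorem dsk_polar {f : ℝ × ℝ → ℝ} (hf : Continuous f) :
    ∫ y in dsk, f y = ∫ r in (0:ℝ)..1, ∫ θ in (-π)..π, r * f (r * cos θ, r * sin θ) := by
  rw [← integral_indicator measurableSet_dsk, ← integral_comp_polarCoord_symm]
  have h1 : ∀ p ∈ polarCoord.target, p.1 • (dsk.indicator f) (polarCoord.symm p)
      = (Set.Ioc (0:ℝ) 1 ×ˢ Set.Ioo (-π) π).indicator
          (fun p : ℝ × ℝ => p.1 * f (p.1 * cos p.2, p.1 * sin p.2)) p := by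
    rintro ⟨r, θ⟩ ⟨hr, hθ⟩
    have hr' : 0 < r := hr
    have hθ' : θ ∈ Set.Ioo (-π) π := hθ
    have e : (r * cos θ) ^ 2 + (r * sin θ) ^ 2 = r ^ 2 := by
      have := sin_sq_add_cos_sq θ
      linear_combination r ^ 2 * this
    by_cases h : r ≤ 1
    · have m1 : (r * cos θ, r * sin θ) ∈ dsk := by
        show (r * cos θ) ^ 2 + (r * sin θ) ^ 2 ≤ 1
        rw [e]; nlinarith
      have m2 : (r, θ) ∈ (Set.Ioc (0:ℝ) 1 ×ˢ Set.Ioo (-π) π) := ⟨⟨hr', h⟩, hθ'⟩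
      rw [Set.indicator_of_mem m2]
      simp only [polarCoord_symm_apply, smul_eq_mul]
      rw [Set.indicator_of_mem m1]
    · have m1 : (r * cos θ, r * sin θ) ∉ dsk := by
        intro hh
        have hh' : (r * cos θ) ^ 2 + (r * sin θ) ^ 2 ≤ 1 := hh
        rw [e] at hh'; push Not at h; nlinarith
      have m2 : (r, θ) ∉ (Set.Ioc (0:ℝ) 1 ×ˢ Set.Ioo (-π) π) := fun hh => h hh.1.2
      rw [Set.indicator_of_notMem m2]
      simp only [polarCoord_symm_apply, smul_eq_mul]
      rw [Set.indicator_of_notMem m1]; simp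
  rw [setIntegral_congr_fun polarCoord.open_target.measurableSet h1]
  rw [setIntegral_indicator (measurableSet_Ioc.prod measurableSet_Ioo)]
  have h2 : polarCoord.target ∩ Set.Ioc (0:ℝ) 1 ×ˢ Set.Ioo (-π) π
      = Set.Ioc (0:ℝ) 1 ×ˢ Set.Ioo (-π) π := by
    apply Set.inter_eq_right.mpr
    rintro ⟨r, θ⟩ ⟨h, h'⟩
    exact ⟨h.1, h'⟩
  rw [h2]
  have hc : Continuous (fun p : ℝ × ℝ => p.1 * f (p.1 * cos p.2, p.1 * sin p.2)) := by fun_prop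
  have hi : IntegrableOn (fun p : ℝ × ℝ => p.1 * f (p.1 * cos p.2, p.1 * sin p.2))
      (Set.Ioc (0:ℝ) 1 ×ˢ Set.Ioo (-π) π) :=
    (hc.continuousOn.integrableOn_compact (isCompact_Icc.prod isCompact_Icc)).mono_set
      (Set.prod_mono Set.Ioc_subset_Icc_self Set.Ioo_subset_Icc_self)
  rw [Measure.volume_eq_prod, setIntegral_prod _ (by rw [← Measure.volume_eq_prod]; exact hi)]
  rw [intervalIntegral.integral_of_le (by norm_num)]
  apply setIntegral_congr_fun measurableSet_Ioc
  intro r hr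
  simp only
  rw [intervalIntegral.integral_of_le (by linarith [pi_pos]), integral_Ioc_eq_integral_Ioo]

theorem dsk_area : ∫ y in dsk, (1:ℝ) = π := by
  rw [dsk_polar continuous_const]
  have : ∀ r : ℝ, ∫ θ in (-π)..π, r * (1:ℝ) = (2 * π) * r := by
    intro r; rw [intervalIntegral.integral_const, smul_eq_mul]; ring
  simp_rw [this]
  rw [intervalIntegral.integral_const_mul, integral_id]
  ring

/-- Divergence theorem on the disk, for fields tangent to the boundary. -/
theorem dsk_div {F G F1 F2 G1 G2 : ℝ × ℝ → ℝ}
    (hF : ∀ y, HasFDerivAt F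
      ((F1 y) • ContinuousLinearMap.fst ℝ ℝ ℝ + (F2 y) • ContinuousLinearMap.snd ℝ ℝ ℝ) y)
    (hG : ∀ y, HasFDerivAt G
      ((G1 y) • ContinuousLinearMap.fst ℝ ℝ ℝ + (G2 y) • ContinuousLinearMap.snd ℝ ℝ ℝ) y)
    (cF1 : Continuous F1) (cF2 : Continuous F2) (cG1 : Continuous G1) (cG2 : Continuous G2)
    (hb : ∀ y : ℝ × ℝ, y.1 ^ 2 + y.2 ^ 2 = 1 → y.1 * F y + y.2 * G y = 0) :
    ∫ y in dsk, (F1 y + G2 y) = 0 := by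
  have cF : Continuous F := continuous_iff_continuousAt.mpr fun y => (hF y).continuousAt
  have cG : Continuous G := continuous_iff_continuousAt.mpr fun y => (hG y).continuousAt
  rw [dsk_polar (f := fun y => F1 y + G2 y) (by fun_prop)]
  let A : ℝ → ℝ → ℝ := fun r θ => r * (F (r * cos θ, r * sin θ) * cos θ + G (r * cos θ, r * sin θ) * sin θ)
  let A' : ℝ → ℝ → ℝ := fun r θ => (F (r * cos θ, r * sin θ) * cos θ + G (r * cos θ, r * sin θ) * sin θ)
    + r * ((F1 (r * cos θ, r * sin θ) * cos θ + F2 (r * cos θ, r * sin θ) * sin θ) * cos θ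
      + (G1 (r * cos θ, r * sin θ) * cos θ + G2 (r * cos θ, r * sin θ) * sin θ) * sin θ)
  let K : ℝ → ℝ → ℝ := fun r θ => - F (r * cos θ, r * sin θ) * sin θ + G (r * cos θ, r * sin θ) * cos θ
  let K' : ℝ → ℝ → ℝ := fun r θ =>
    (-(F1 (r * cos θ, r * sin θ) * (-(r * sin θ)) + F2 (r * cos θ, r * sin θ) * (r * cos θ)) * sin θ
      - F (r * cos θ, r * sin θ) * cos θ)
    + ((G1 (r * cos θ, r * sin θ) * (-(r * sin θ)) + G2 (r * cos θ, r * sin θ) * (r * cos θ)) * cos θ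
      - G (r * cos θ, r * sin θ) * sin θ)
  have hr : ∀ r θ : ℝ, HasDerivAt (fun r : ℝ => (r * cos θ, r * sin θ)) (cos θ, sin θ) r := by
    intro r θ
    have h1 := (hasDerivAt_id r).mul_const (cos θ)
    have h2 := (hasDerivAt_id r).mul_const (sin θ)
    simpa using h1.prodMk h2
  have ht : ∀ r θ : ℝ, HasDerivAt (fun θ : ℝ => (r * cos θ, r * sin θ)) (-(r * sin θ), r * cos θ) θ := by
    intro r θ
    have h1 := (hasDerivAt_cos θ).const_mul r
    have h2 := (hasDerivAt_sin θ).const_mul r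
    simpa using h1.prodMk h2
  have dA : ∀ r θ, HasDerivAt (fun r => A r θ) (A' r θ) r := by
    intro r θ
    have h1 := (hF (r * cos θ, r * sin θ)).comp_hasDerivAt r (hr r θ)
    have h2 := (hG (r * cos θ, r * sin θ)).comp_hasDerivAt r (hr r θ)
    have h3 := (hasDerivAt_id r).mul ((h1.mul_const (cos θ)).add (h2.mul_const (sin θ)))
    have h4 : HasDerivAt (fun r => A r θ) _ r := h3
    refine h4.congr_deriv ?_
    simp [A']
  have dK : ∀ r θ, HasDerivAt (fun θ => K r θ) (K' r θ) θ := by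
    intro r θ
    have h1 := (hF (r * cos θ, r * sin θ)).comp_hasDerivAt θ (ht r θ)
    have h2 := (hG (r * cos θ, r * sin θ)).comp_hasDerivAt θ (ht r θ)
    have h3 := (h1.neg.mul (hasDerivAt_sin θ)).add (h2.mul (hasDerivAt_cos θ))
    have h4 : HasDerivAt (fun θ => K r θ) _ θ := h3
    refine h4.congr_deriv ?_
    simp [K']
    ring
  have cA' : Continuous (Function.uncurry A') := by
    simp only [A', Function.uncurry_def]; fun_prop
  have cK' : Continuous (Function.uncurry K') := by
    simp only [K', Function.uncurry_def]; fun_prop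
  have key : ∀ r θ : ℝ, r * (F1 (r * cos θ, r * sin θ) + G2 (r * cos θ, r * sin θ)) = A' r θ + K' r θ := by
    intro r θ
    simp only [A', K']
    have := sin_sq_add_cos_sq θ
    linear_combination (-(r * (F1 (r * cos θ, r * sin θ) + G2 (r * cos θ, r * sin θ)))) * this
  simp_rw [key]
  have e1 : ∀ r : ℝ, ∫ θ in (-π)..π, (A' r θ + K' r θ) = (∫ θ in (-π)..π, A' r θ) := by
    intro r
    have i1 : IntervalIntegrable (A' r) volume (-π) π :=
      (by fun_prop : Continuous (A' r)).intervalIntegrable _ _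
    have i2 : IntervalIntegrable (K' r) volume (-π) π :=
      (by fun_prop : Continuous (K' r)).intervalIntegrable _ _
    rw [intervalIntegral.integral_add i1 i2,
      intervalIntegral.integral_eq_sub_of_hasDerivAt (fun θ _ => dK r θ) i2]
    simp [K]
  simp_rw [e1]
  rw [intervalIntegral_intervalIntegral_swap]
  · have e2 : ∀ θ : ℝ, ∫ r in (0:ℝ)..1, A' r θ = 0 := by
      intro θ
      have i1 : IntervalIntegrable (fun r => A' r θ) volume 0 1 :=
        (by fun_prop : Continuous (fun r => A' r θ)).intervalIntegrable _ _
      rw [intervalIntegral.integral_eq_sub_of_hasDerivAt (fun r _ => dA r θ) i1]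
      have := hb (cos θ, sin θ) (by simpa using cos_sq_add_sin_sq θ)
      simp only [A]
      simp
      simp at this
      linarith
    simp_rw [e2]; simp
  · apply (cA'.continuousOn.integrableOn_compact
      (isCompact_Icc.prod isCompact_Icc : IsCompact (Set.Icc (0:ℝ) 1 ×ˢ Set.Icc (-π) π))).mono_set
    rw [Set.uIoc_of_le (by norm_num), Set.uIoc_of_le (by linarith [pi_pos])]
    exact Set.prod_mono Set.Ioc_subset_Icc_self Set.Ioc_subset_Icc_self

end

section
open scoped ContDiff

theorem sq_integral_le_aux {X : Type*} [MeasurableSpace X] (μ : Measure X) [IsFiniteMeasure μ]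
    {f : X → ℝ} (hf : Integrable f μ) (hf2 : Integrable (fun x => f x ^ 2) μ) :
    (∫ x, f x ∂μ) ^ 2 ≤ μ.real Set.univ * ∫ x, f x ^ 2 ∂μ := by
  set V := μ.real Set.univ with hV
  set a := ∫ x, f x ∂μ with ha
  have hV0 : 0 ≤ V := measureReal_nonneg
  have h0 : 0 ≤ ∫ x, (V * f x - a) ^ 2 ∂μ := integral_nonneg fun x => sq_nonneg _
  have e : ∫ x, (V * f x - a) ^ 2 ∂μ = V ^ 2 * (∫ x, f x ^ 2 ∂μ) - 2 * V * a * a + a ^ 2 * V := by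
    have : ∀ x, (V * f x - a) ^ 2 = (V ^ 2 * f x ^ 2 - 2 * V * a * f x) + a ^ 2 := by intro x; ring
    have i1 : Integrable (fun x => V ^ 2 * f x ^ 2 - 2 * V * a * f x) μ :=
      (hf2.const_mul _).sub (hf.const_mul _)
    simp_rw [this]
    rw [integral_add i1 (integrable_const _),
      integral_sub (hf2.const_mul _) (hf.const_mul _), integral_const_mul, integral_const_mul,
      integral_const, ← ha, smul_eq_mul, ← hV]
    ring
  rw [e] at h0
  rcases hV0.eq_or_lt with h | h
  · have : μ = 0 := by
      have h' : μ.real Set.univ = 0 := by rw [← hV]; exact h.symm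
      rw [measureReal_eq_zero_iff] at h'
      exact Measure.measure_univ_eq_zero.mp h'
    have ha0 : a = 0 := by rw [ha, this]; simp
    rw [ha0, ← h]; simp
  · have : 0 ≤ V * (V * (∫ x, f x ^ 2 ∂μ) - a ^ 2) := by nlinarith
    have := nonneg_of_mul_nonneg_right this h
    linarith

theorem dsk_homothety {H : ℝ × ℝ → ℝ} (cH : Continuous H) (H0 : ∀ y, 0 ≤ H y) {z : ℝ × ℝ} (hz : z ∈ dsk)
    {t : ℝ} (ht : 1 / 2 ≤ t) (ht1 : t ≤ 1) :
    ∫ y in dsk, H (z + t • (y - z)) ≤ 4 * ∫ y in dsk, H y := by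
  have hiD : IntegrableOn H dsk := cH.continuousOn.integrableOn_compact isCompact_dsk
  have hI : Integrable (dsk.indicator H) := hiD.integrable_indicator measurableSet_dsk
  have e1 : ∫ y, (dsk.indicator H) ((1 - t) • z + t • y) = (t ^ 2)⁻¹ * ∫ y in dsk, H y := by
    have := Measure.integral_comp_smul (μ := (volume : Measure (ℝ × ℝ)))
      (fun y => (dsk.indicator H) ((1 - t) • z + y)) t
    rw [this, integral_add_left_eq_self (μ := (volume : Measure (ℝ × ℝ))) (dsk.indicator H) ((1 - t) • z),
      integral_indicator measurableSet_dsk]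
    simp
  have hI2 : Integrable (fun y => (dsk.indicator H) ((1 - t) • z + t • y)) := by
    have h := hI.comp_add_left ((1 - t) • z)
    exact h.comp_smul (R := t) (by linarith)
  have e2 : ∫ y in dsk, H (z + t • (y - z)) ≤ ∫ y, (dsk.indicator H) ((1 - t) • z + t • y) := by
    rw [← integral_indicator measurableSet_dsk]
    apply integral_mono
    · apply IntegrableOn.integrable_indicator _ measurableSet_dsk
      exact (by fun_prop : Continuous fun y => H (z + t • (y - z))).continuousOn.integrableOn_compact isCompact_dsk
    · exact hI2
    · intro y
      have e : (1 - t) • z + t • y = z + t • (y - z) := by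
        ext <;> simp <;> ring
      simp only [e]
      by_cases hy : y ∈ dsk
      · have hm : z + t • (y - z) ∈ dsk := by
          obtain ⟨a, b⟩ := y
          obtain ⟨c, d⟩ := z
          have h1 : a ^ 2 + b ^ 2 ≤ 1 := hy
          have h2 : c ^ 2 + d ^ 2 ≤ 1 := hz
          show (c + t * (a - c)) ^ 2 + (d + t * (b - d)) ^ 2 ≤ 1
          have h3 : 0 ≤ t * (1 - t) * ((a - c) ^ 2 + (b - d) ^ 2) := by
            have : 0 ≤ 1 - t := by linarith
            positivity
          nlinarith
        rw [Set.indicator_of_mem hy, Set.indicator_of_mem hm]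
      · rw [Set.indicator_of_notMem hy]
        exact Set.indicator_nonneg (fun y _ => H0 y) _
  rw [e1] at e2
  refine e2.trans ?_
  have h0 : 0 ≤ ∫ y in dsk, H y := setIntegral_nonneg measurableSet_dsk fun y _ => H0 y
  apply mul_le_mul_of_nonneg_right _ h0
  rw [inv_le_comm₀ (by positivity) (by norm_num)]
  nlinarith

instance : IsFiniteMeasure ((volume : Measure (ℝ × ℝ)).restrict dsk) :=
  ⟨by simpa using isCompact_dsk.measure_lt_top⟩

theorem dsk_real : (volume : Measure (ℝ × ℝ)).real dsk = π := by
  have := dsk_area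
  simpa using this

theorem dsk_real' : ((volume : Measure (ℝ × ℝ)).restrict dsk).real Set.univ = π := by
  rw [← dsk_real]; simp [Measure.real]

/-- Poincaré inequality on the disk. -/
theorem dsk_poincare {g g1 g2 : ℝ × ℝ → ℝ}
    (hg : ∀ y, HasFDerivAt g
      ((g1 y) • ContinuousLinearMap.fst ℝ ℝ ℝ + (g2 y) • ContinuousLinearMap.snd ℝ ℝ ℝ) y)
    (c1 : Continuous g1) (c2 : Continuous g2) :
    ∫ y in dsk, (g y - (1 / π) * ∫ z in dsk, g z) ^ 2 ≤ 16 * ∫ y in dsk, (g1 y ^ 2 + g2 y ^ 2) := by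
  have cg : Continuous g := continuous_iff_continuousAt.mpr fun y => (hg y).continuousAt
  set H : ℝ × ℝ → ℝ := fun y => g1 y ^ 2 + g2 y ^ 2 with hH
  have cH : Continuous H := by fun_prop
  have H0 : ∀ y, 0 ≤ H y := fun y => by positivity
  set IH := ∫ y in dsk, H y with hIH
  let Q : ℝ × ℝ → ℝ × ℝ → ℝ := fun z y => (g y - g (z + (1 / 2 : ℝ) • (y - z))) ^ 2
  have cQ : Continuous (Function.uncurry Q) := by simp only [Q, Function.uncurry_def]; fun_prop
  have int2 : ∀ {f : (ℝ × ℝ) × (ℝ × ℝ) → ℝ}, Continuous f →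
      Integrable f (((volume : Measure (ℝ × ℝ)).restrict dsk).prod
        ((volume : Measure (ℝ × ℝ)).restrict dsk)) := by
    intro f hf
    rw [Measure.prod_restrict]
    exact hf.continuousOn.integrableOn_compact (isCompact_dsk.prod isCompact_dsk)
  have int1 : ∀ {f : (ℝ × ℝ) → ℝ}, Continuous f → IntegrableOn f dsk := fun hf =>
    hf.continuousOn.integrableOn_compact isCompact_dsk
  -- pointwise bound
  have hQ : ∀ z ∈ dsk, ∀ y ∈ dsk, Q z y ≤ 2 * ∫ t in (1/2:ℝ)..1, H (z + t • (y - z)) := by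
    intro z hz y hy
    let w : ℝ → ℝ := fun t => g1 (z + t • (y - z)) * (y - z).1 + g2 (z + t • (y - z)) * (y - z).2
    have cw : Continuous w := by simp only [w]; fun_prop
    have hd : ∀ t, HasDerivAt (fun t : ℝ => g (z + t • (y - z))) (w t) t := by
      intro t
      have h1 : HasDerivAt (fun t : ℝ => z + t • (y - z)) (y - z) t := by
        simpa using ((hasDerivAt_id t).smul_const (y - z)).const_add z
      have h2 := (hg (z + t • (y - z))).comp_hasDerivAt t h1
      have h3 : HasDerivAt (fun t : ℝ => g (z + t • (y - z))) _ t := h2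
      refine h3.congr_deriv ?_
      simp [w]
    have e1 : g y - g (z + (1 / 2 : ℝ) • (y - z)) = ∫ t in (1/2:ℝ)..1, w t := by
      rw [intervalIntegral.integral_eq_sub_of_hasDerivAt (fun t _ => hd t) (cw.intervalIntegrable _ _)]
      simp
    have e2 : (∫ t in (1/2:ℝ)..1, w t) ^ 2 ≤ 1 / 2 * ∫ t in (1/2:ℝ)..1, w t ^ 2 := by
      rw [intervalIntegral.integral_of_le (by norm_num), intervalIntegral.integral_of_le (by norm_num)]
      have := sq_integral_le_aux ((volume : Measure ℝ).restrict (Set.Ioc (1/2) 1)) (f := w)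
        (cw.integrableOn_Ioc) ((by fun_prop : Continuous fun t => w t ^ 2).integrableOn_Ioc)
      refine this.trans (le_of_eq ?_)
      congr 1
      simp [Measure.real]; norm_num
    have e3 : ∫ t in (1/2:ℝ)..1, w t ^ 2 ≤ ∫ t in (1/2:ℝ)..1, 4 * H (z + t • (y - z)) := by
      apply intervalIntegral.integral_mono_on (by norm_num)
      · exact (by fun_prop : Continuous fun t => w t ^ 2).intervalIntegrable _ _
      · exact (by fun_prop : Continuous fun t : ℝ => 4 * H (z + t • (y - z))).intervalIntegrable _ _
      · intro t _
        simp only [w, hH]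
        set A := g1 (z + t • (y - z))
        set B := g2 (z + t • (y - z))
        obtain ⟨a, b⟩ := y
        obtain ⟨c, d⟩ := z
        have h1 : a ^ 2 + b ^ 2 ≤ 1 := hy
        have h2 : c ^ 2 + d ^ 2 ≤ 1 := hz
        show (A * (a - c) + B * (b - d)) ^ 2 ≤ 4 * (A ^ 2 + B ^ 2)
        have h3 : (a - c) ^ 2 + (b - d) ^ 2 ≤ 4 := by nlinarith [sq_nonneg (a + c), sq_nonneg (b + d)]
        have h4 : (A * (a - c) + B * (b - d)) ^ 2 ≤ (A ^ 2 + B ^ 2) * ((a - c) ^ 2 + (b - d) ^ 2) := by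
          nlinarith [sq_nonneg (A * (b - d) - B * (a - c))]
        nlinarith [sq_nonneg A, sq_nonneg B]
    rw [intervalIntegral.integral_const_mul] at e3
    show (g y - g (z + (1 / 2 : ℝ) • (y - z))) ^ 2 ≤ _
    rw [e1]; linarith
  have hQz : ∀ z ∈ dsk, ∫ y in dsk, Q z y ≤ 4 * IH := by
    intro z hz
    have cc : Continuous (fun q : (ℝ × ℝ) × ℝ => H (z + q.2 • (q.1 - z))) := by fun_prop
    have hintg : Integrable (Function.uncurry fun (y : ℝ × ℝ) (t : ℝ) => H (z + t • (y - z)))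
        (((volume : Measure (ℝ × ℝ)).restrict dsk).prod ((volume : Measure ℝ).restrict (Set.Ioc (1/2) 1))) := by
      rw [Measure.prod_restrict]
      exact (cc.continuousOn.integrableOn_compact (isCompact_dsk.prod isCompact_Icc)).mono_set
        (Set.prod_mono le_rfl Set.Ioc_subset_Icc_self)
    calc ∫ y in dsk, Q z y ≤ ∫ y in dsk, 2 * ∫ t in Set.Ioc (1/2:ℝ) 1, H (z + t • (y - z)) := by
          apply setIntegral_mono_on
          · exact int1 (by fun_prop)
          · exact (hintg.integral_prod_left).const_mul 2
          · exact measurableSet_dsk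
          · intro y hy
            have := hQ z hz y hy
            rwa [intervalIntegral.integral_of_le (by norm_num)] at this
      _ = 2 * ∫ t in Set.Ioc (1/2:ℝ) 1, ∫ y in dsk, H (z + t • (y - z)) := by
          rw [integral_const_mul, integral_integral_swap hintg]
      _ ≤ 2 * ∫ t in Set.Ioc (1/2:ℝ) 1, 4 * IH := by
          apply mul_le_mul_of_nonneg_left _ (by norm_num)
          apply setIntegral_mono_on
          · exact hintg.integral_prod_right
          · exact integrable_const _
          · exact measurableSet_Ioc
          · intro t ht
            exact dsk_homothety cH H0 hz ht.1.le ht.2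
      _ = 4 * IH := by
          rw [integral_const]
          simp [Measure.real]
          norm_num
          ring
  have hQQ : ∫ z in dsk, ∫ y in dsk, Q z y ≤ π * (4 * IH) := by
    calc ∫ z in dsk, ∫ y in dsk, Q z y ≤ ∫ z in dsk, 4 * IH := by
          apply setIntegral_mono_on
          · exact (int2 cQ).integral_prod_left
          · exact integrable_const _
          · exact measurableSet_dsk
          · exact hQz
      _ = π * (4 * IH) := by
          rw [integral_const, dsk_real', smul_eq_mul]
  have hQQ' : ∫ y in dsk, ∫ z in dsk, Q z y ≤ π * (4 * IH) := by
    rw [integral_integral_swap (f := fun y z => Q z y)]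
    · exact hQQ
    · exact int2 (f := Function.uncurry fun y z => Q z y) (by simp only [Q, Function.uncurry_def]; fun_prop)
  have hpt : ∀ y z, (g y - g z) ^ 2 ≤ 2 * (Q z y + Q y z) := by
    intro y z
    simp only [Q]
    have e : y + (1 / 2 : ℝ) • (z - y) = z + (1 / 2 : ℝ) • (y - z) := by
      ext <;> simp <;> ring
    rw [e]
    set m := g (z + (1 / 2 : ℝ) • (y - z))
    nlinarith [sq_nonneg ((g y - m) + (g z - m))]
  have hfin : ∀ y ∈ dsk, (g y - (1 / π) * ∫ z in dsk, g z) ^ 2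
      ≤ (1 / π) * ∫ z in dsk, 2 * (Q z y + Q y z) := by
    intro y hy
    have i1 : IntegrableOn (fun z => g y - g z) dsk := int1 (by fun_prop)
    have i2 : IntegrableOn (fun z => (g y - g z) ^ 2) dsk := int1 (by fun_prop)
    have h1 := sq_integral_le_aux _ i1 i2
    rw [dsk_real'] at h1
    have e : ∫ z in dsk, (g y - g z) = π * g y - ∫ z in dsk, g z := by
      rw [integral_sub (integrable_const _) (int1 cg), integral_const, dsk_real', smul_eq_mul]
    rw [e] at h1
    have h2 : ∫ z in dsk, (g y - g z) ^ 2 ≤ ∫ z in dsk, 2 * (Q z y + Q y z) := by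
      apply setIntegral_mono i2
      · exact int1 (by simp only [Q]; fun_prop)
      · intro z; exact hpt y z
    have e2 : (g y - (1 / π) * ∫ z in dsk, g z) ^ 2 = (1 / π ^ 2) * (π * g y - ∫ z in dsk, g z) ^ 2 := by
      field_simp
    rw [e2]
    calc (1 / π ^ 2) * (π * g y - ∫ z in dsk, g z) ^ 2
        ≤ (1 / π ^ 2) * (π * ∫ z in dsk, 2 * (Q z y + Q y z)) := by
          gcongr
          exact h1.trans (by gcongr)
      _ = _ := by field_simp
  calc ∫ y in dsk, (g y - (1 / π) * ∫ z in dsk, g z) ^ 2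
      ≤ ∫ y in dsk, (1 / π) * ∫ z in dsk, 2 * (Q z y + Q y z) := by
        apply setIntegral_mono_on
        · exact int1 (by fun_prop)
        · apply Integrable.const_mul
          exact (int2 (f := fun q => 2 * (Q q.2 q.1 + Q q.1 q.2)) (by simp only [Q]; fun_prop)).integral_prod_left
        · exact measurableSet_dsk
        · exact hfin
    _ = (1 / π) * (2 * ((∫ y in dsk, ∫ z in dsk, Q z y) + ∫ y in dsk, ∫ z in dsk, Q y z)) := by
        rw [integral_const_mul]
        congr 1
        rw [← integral_add, ← integral_const_mul]
        · congr 1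
          funext y
          rw [← integral_add, ← integral_const_mul]
          · exact int1 (by simp only [Q]; fun_prop)
          · exact int1 (by simp only [Q]; fun_prop)
        · exact (int2 (f := fun q => Q q.2 q.1) (by simp only [Q]; fun_prop)).integral_prod_left
        · exact (int2 (f := fun q => Q q.1 q.2) (by simp only [Q]; fun_prop)).integral_prod_left
    _ ≤ (1 / π) * (2 * (π * (4 * IH) + π * (4 * IH))) := by gcongr
    _ = 16 * IH := by field_simp; ring

end

section
open scoped ContDiff

/-- Integral over the fundamental domain. -/
def II (ℓ : ℝ) (f : P3 → ℝ) : ℝ := ∫ p in domP ℓ, f p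

/-- `L²` norm. -/
def NN (ℓ : ℝ) (f : P3 → ℝ) : ℝ := Real.sqrt (L2sq ℓ f)

theorem domP_eq (ℓ : ℝ) : domP ℓ = Set.Ioc 0 ℓ ×ˢ dsk := rfl

theorem domP_sub (ℓ : ℝ) : domP ℓ ⊆ domC := fun p hp => hp.2

theorem measurableSet_domP (ℓ : ℝ) : MeasurableSet (domP ℓ) :=
  measurableSet_Ioc.prod measurableSet_dsk

theorem intOn {ℓ : ℝ} {f : P3 → ℝ} (hf : Continuous f) : IntegrableOn f (domP ℓ) :=
  (hf.continuousOn.integrableOn_compact (isCompact_Icc.prod isCompact_dsk)).mono_set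
    (Set.prod_mono Set.Ioc_subset_Icc_self le_rfl)

theorem II_fubini {ℓ : ℝ} {f : P3 → ℝ} (hf : Continuous f) :
    II ℓ f = ∫ α in Set.Ioc 0 ℓ, ∫ y in dsk, f (α, y) := by
  unfold II
  rw [domP_eq, Measure.volume_eq_prod, setIntegral_prod]
  exact intOn hf

theorem II_fubini' {ℓ : ℝ} {f : P3 → ℝ} (hf : Continuous f) :
    II ℓ f = ∫ y in dsk, ∫ α in Set.Ioc 0 ℓ, f (α, y) := by
  rw [II_fubini hf, integral_integral_swap]
  rw [Measure.prod_restrict]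
  exact intOn hf

theorem II_congr {ℓ : ℝ} {f g : P3 → ℝ} (h : ∀ p ∈ domC, f p = g p) : II ℓ f = II ℓ g :=
  setIntegral_congr_fun (measurableSet_domP ℓ) fun p hp => h p (domP_sub ℓ hp)

theorem II_add {ℓ : ℝ} {f g : P3 → ℝ} (hf : Continuous f) (hg : Continuous g) :
    II ℓ (fun p => f p + g p) = II ℓ f + II ℓ g := integral_add (intOn hf) (intOn hg)
theorem II_sub {ℓ : ℝ} {f g : P3 → ℝ} (hf : Continuous f) (hg : Continuous g) :
    II ℓ (fun p => f p - g p) = II ℓ f - II ℓ g := integral_sub (intOn hf) (intOn hg)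
theorem II_const_mul {ℓ : ℝ} (c : ℝ) {f : P3 → ℝ} :
    II ℓ (fun p => c * f p) = c * II ℓ f := integral_const_mul _ _
theorem II_mono {ℓ : ℝ} {f g : P3 → ℝ} (hf : Continuous f) (hg : Continuous g)
    (h : ∀ p ∈ domC, f p ≤ g p) : II ℓ f ≤ II ℓ g :=
  setIntegral_mono_on (intOn hf) (intOn hg) (measurableSet_domP ℓ) fun p hp => h p (domP_sub ℓ hp)

theorem L2sq_eq (ℓ : ℝ) (f : P3 → ℝ) : L2sq ℓ f = II ℓ (fun p => f p ^ 2) := rfl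

theorem L2sq_nonneg (ℓ : ℝ) (f : P3 → ℝ) : 0 ≤ L2sq ℓ f :=
  integral_nonneg fun p => sq_nonneg _

theorem NN_nonneg (ℓ : ℝ) (f : P3 → ℝ) : 0 ≤ NN ℓ f := Real.sqrt_nonneg _

theorem NN_sq (ℓ : ℝ) (f : P3 → ℝ) : NN ℓ f ^ 2 = II ℓ (fun p => f p ^ 2) :=
  Real.sq_sqrt (L2sq_nonneg ℓ f)

theorem NN_congr {ℓ : ℝ} {f g : P3 → ℝ} (h : ∀ p ∈ domC, f p = g p) : NN ℓ f = NN ℓ g := by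
  unfold NN
  rw [L2sq_eq, L2sq_eq, II_congr (f := fun p => f p ^ 2) (g := fun p => g p ^ 2)]
  intro p hp
  simp only [h p hp]

theorem NN_mono {ℓ : ℝ} {f g : P3 → ℝ} (hf : Continuous f) (hg : Continuous g)
    (h : ∀ p ∈ domC, |f p| ≤ |g p|) : NN ℓ f ≤ NN ℓ g := by
  apply Real.sqrt_le_sqrt
  exact II_mono (by fun_prop) (by fun_prop) fun p hp => sq_le_sq.mpr (h p hp)

theorem NN_CS {ℓ : ℝ} {f g : P3 → ℝ} (hf : Continuous f) (hg : Continuous g) :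
    |II ℓ (fun p => f p * g p)| ≤ NN ℓ f * NN ℓ g := by
  have key : ∀ t : ℝ, 0 ≤ II ℓ (fun p => g p ^ 2) * (t * t) + 2 * II ℓ (fun p => f p * g p) * t
      + II ℓ (fun p => f p ^ 2) := by
    intro t
    have h0 : 0 ≤ II ℓ (fun p => (f p + t * g p) ^ 2) := integral_nonneg fun p => sq_nonneg _
    have e : II ℓ (fun p => (f p + t * g p) ^ 2) = (t * t) * II ℓ (fun p => g p ^ 2)
        + (2 * t) * II ℓ (fun p => f p * g p) + II ℓ (fun p => f p ^ 2) := by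
      rw [← II_const_mul, ← II_const_mul, ← II_add (by fun_prop) (by fun_prop),
        ← II_add (by fun_prop) (by fun_prop)]
      congr 1; funext p; ring
    rw [e] at h0
    linarith
  have hd := discrim_le_zero key
  unfold discrim at hd
  apply abs_le_of_sq_le_sq _ (mul_nonneg (NN_nonneg _ _) (NN_nonneg _ _))
  rw [mul_pow, NN_sq, NN_sq]
  linarith

theorem NN_add {ℓ : ℝ} {f g : P3 → ℝ} (hf : Continuous f) (hg : Continuous g) :
    NN ℓ (fun p => f p + g p) ≤ NN ℓ f + NN ℓ g := by
  apply le_of_sq_le_sq _ (add_nonneg (NN_nonneg _ _) (NN_nonneg _ _))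
  rw [NN_sq, add_sq, NN_sq, NN_sq]
  have e : II ℓ (fun p => (f p + g p) ^ 2) = II ℓ (fun p => f p ^ 2)
        + 2 * II ℓ (fun p => f p * g p) + II ℓ (fun p => g p ^ 2) := by
    rw [← II_const_mul, ← II_add (by fun_prop) (by fun_prop),
        ← II_add (by fun_prop) (by fun_prop)]
    congr 1; funext p; ring
  rw [e]
  have := NN_CS (ℓ := ℓ) hf hg
  have := le_of_abs_le this
  linarith

theorem NN_const_mul {ℓ : ℝ} (c : ℝ) {f : P3 → ℝ} :
    NN ℓ (fun p => c * f p) = |c| * NN ℓ f := by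
  have h : 0 ≤ |c| * NN ℓ f := mul_nonneg (abs_nonneg _) (NN_nonneg _ _)
  rw [← abs_of_nonneg (NN_nonneg ℓ (fun p => c * f p)), ← abs_of_nonneg h]
  rw [← sq_eq_sq_iff_abs_eq_abs, mul_pow, NN_sq, NN_sq, sq_abs, ← II_const_mul]
  congr 1; funext p; ring

theorem NN_mul_le {ℓ C : ℝ} {c f : P3 → ℝ} (hc : Continuous c) (hf : Continuous f) (C0 : 0 ≤ C)
    (h : ∀ p ∈ domC, |c p| ≤ C) : NN ℓ (fun p => c p * f p) ≤ C * NN ℓ f := by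
  have := NN_const_mul (ℓ := ℓ) C (f := f)
  rw [abs_of_nonneg C0] at this
  rw [← this]
  apply NN_mono (by fun_prop) (by fun_prop)
  intro p hp
  rw [abs_mul, abs_mul, abs_of_nonneg C0]
  exact mul_le_mul_of_nonneg_right (h p hp) (abs_nonneg _)

theorem NN_neg {ℓ : ℝ} {f : P3 → ℝ} : NN ℓ (fun p => - f p) = NN ℓ f := by
  unfold NN L2sq; simp

theorem NN_sub {ℓ : ℝ} {f g : P3 → ℝ} (hf : Continuous f) (hg : Continuous g) :
    NN ℓ (fun p => f p - g p) ≤ NN ℓ f + NN ℓ g := by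
  have := NN_add (ℓ := ℓ) hf hg.neg
  simp only [Pi.neg_apply] at this
  have e : NN ℓ (-g) = NN ℓ g := NN_neg
  rw [e] at this
  simpa [sub_eq_add_neg] using this

/-! Slices -/
theorem slice_hasFDeriv {f : P3 → ℝ} (hf : ContDiff ℝ ∞ f) (α : ℝ) (y : ℝ × ℝ) :
    HasFDerivAt (fun y : ℝ × ℝ => f (α, y))
      ((pdi 1 f (α, y)) • ContinuousLinearMap.fst ℝ ℝ ℝ
        + (pdi 2 f (α, y)) • ContinuousLinearMap.snd ℝ ℝ ℝ) y := by
  have h1 : HasFDerivAt (fun y : ℝ × ℝ => ((α, y) : P3)) (ContinuousLinearMap.inr ℝ ℝ (ℝ × ℝ)) y :=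
    hasFDerivAt_prodMk_right α y
  have h2 := ((sm_diff hf (α, y)).hasFDerivAt).comp y h1
  refine (show HasFDerivAt (fun y : ℝ × ℝ => f (α, y)) _ y from h2).congr_fderiv ?_
  unfold pdi
  ext
  · simp [e3vec]
  · simp [e3vec]

theorem slice_hasDeriv {f : P3 → ℝ} (hf : ContDiff ℝ ∞ f) (α : ℝ) (y : ℝ × ℝ) :
    HasDerivAt (fun α : ℝ => f (α, y)) (pdi 0 f (α, y)) α := by
  have h1 : HasDerivAt (fun α : ℝ => ((α, y) : P3)) ((1, 0) : P3) α :=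
    (hasDerivAt_id α).prodMk (hasDerivAt_const α y)
  have h2 := ((sm_diff hf (α, y)).hasFDerivAt).comp_hasDerivAt α h1
  exact h2

theorem ibp_y {ℓ : ℝ} {F G : P3 → ℝ} (hF : ContDiff ℝ ∞ F) (hG : ContDiff ℝ ∞ G)
    (hb : ∀ p : P3, p.2.1 ^ 2 + p.2.2 ^ 2 = 1 → p.2.1 * F p + p.2.2 * G p = 0) :
    II ℓ (fun p => pdi 1 F p + pdi 2 G p) = 0 := by
  have c1 := (smooth_pdi 1 hF).continuous
  have c2 := (smooth_pdi 2 hF).continuous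
  have c3 := (smooth_pdi 1 hG).continuous
  have c4 := (smooth_pdi 2 hG).continuous
  rw [II_fubini (by fun_prop)]
  have : ∀ α, ∫ y in dsk, (pdi 1 F (α, y) + pdi 2 G (α, y)) = 0 := fun α =>
    dsk_div (slice_hasFDeriv hF α) (slice_hasFDeriv hG α) (by fun_prop) (by fun_prop) (by fun_prop)
      (by fun_prop) (fun y hy => hb (α, y) hy)
  simp_rw [this]; simp

theorem ibp_a {ℓ : ℝ} (hℓ : 0 < ℓ) {F : P3 → ℝ} (hF : ContDiff ℝ ∞ F) (hp : PerA ℓ F) :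
    II ℓ (pdi 0 F) = 0 := by
  have c1 := (smooth_pdi 0 hF).continuous
  rw [II_fubini' c1]
  have : ∀ y : ℝ × ℝ, ∫ α in Set.Ioc 0 ℓ, pdi 0 F (α, y) = 0 := by
    intro y
    rw [← intervalIntegral.integral_of_le hℓ.le,
      intervalIntegral.integral_eq_sub_of_hasDerivAt (fun α _ => slice_hasDeriv hF α y)
        ((by fun_prop : Continuous fun α => pdi 0 F (α, y)).intervalIntegrable _ _)]
    have := hp (0, y)
    simp only [zero_add] at this
    rw [sub_eq_zero]; exact this
  simp_rw [this]; simp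

theorem pT_div {F : P3 → ℝ} (hF : ContDiff ℝ ∞ F) :
    pT F = fun p => pdi 1 (fun q => - q.2.2 * F q) p + pdi 2 (fun q => q.2.1 * F q) p := by
  have e : (fun q : P3 => - q.2.2 * F q) = fun q => - (q.2.2 * F q) := by funext q; ring
  rw [e, pdi_neg, pdi_mul 1 sm_y2 hF, pdi_mul 2 sm_y1 hF, pdi1_y2, pdi2_y1]
  funext p; unfold pT; ring

theorem ibp_T {ℓ : ℝ} {F : P3 → ℝ} (hF : ContDiff ℝ ∞ F) : II ℓ (pT F) = 0 := by
  rw [pT_div hF]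
  apply ibp_y (by fun_prop) (by fun_prop)
  intro p _; ring

/-! Averages -/
/-- Disk average. -/
def avg (f : P3 → ℝ) (p : P3) : ℝ := (1 / π) * ∫ y in dsk, f (p.1, y)

theorem barDisk_eq (f : P3 → ℝ) : barDisk f = fun p => f p - avg f p := rfl

theorem hasDeriv_slice_int {f : P3 → ℝ} (hf : ContDiff ℝ ∞ f) (α : ℝ) :
    HasDerivAt (fun α => ∫ y in dsk, f (α, y)) (∫ y in dsk, pdi 0 f (α, y)) α := by
  have c0 := hf.continuous
  have c1 := (smooth_pdi 0 hf).continuous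
  obtain ⟨C, hC⟩ := ((isCompact_Icc (a := α - 1) (b := α + 1)).prod isCompact_dsk).exists_bound_of_continuousOn
    (f := pdi 0 f) c1.continuousOn
  refine (hasDerivAt_integral_of_dominated_loc_of_deriv_le (s := Metric.ball α 1)
    (F := fun α y => f (α, y)) (F' := fun α y => pdi 0 f (α, y)) (bound := fun _ => C)
    (Metric.ball_mem_nhds α one_pos) ?_ ?_ ?_ ?_ (integrable_const _) ?_).2
  · exact Eventually.of_forall fun a => (by fun_prop : Continuous fun y => f (a, y)).aestronglyMeasurable
  · exact (by fun_prop : Continuous fun y => f (α, y)).continuousOn.integrableOn_compact isCompact_dsk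
  · exact (by fun_prop : Continuous fun y => pdi 0 f (α, y)).aestronglyMeasurable
  · rw [ae_restrict_iff' measurableSet_dsk]
    refine Eventually.of_forall fun y hy a ha => hC (a, y) ⟨?_, hy⟩
    rw [Real.ball_eq_Ioo] at ha
    exact ⟨ha.1.le, ha.2.le⟩
  · exact Eventually.of_forall fun y a _ => slice_hasDeriv hf a y

theorem contDiff_slice_int (n : ℕ) : ∀ {f : P3 → ℝ}, ContDiff ℝ ∞ f →
    ContDiff ℝ n (fun α => ∫ y in dsk, f (α, y)) := by
  induction n with
  | zero =>
    intro f hf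
    exact contDiff_zero.mpr
      (continuous_iff_continuousAt.mpr fun α => (hasDeriv_slice_int hf α).continuousAt)
  | succ n ih =>
    intro f hf
    have e : deriv (fun α => ∫ y in dsk, f (α, y)) = fun α => ∫ y in dsk, pdi 0 f (α, y) :=
      funext fun α => (hasDeriv_slice_int hf α).deriv
    push_cast
    rw [contDiff_succ_iff_deriv]
    refine ⟨fun α => (hasDeriv_slice_int hf α).differentiableAt, by simp, ?_⟩
    rw [e]
    exact ih (smooth_pdi 0 hf)

theorem smooth_slice_int {f : P3 → ℝ} (hf : ContDiff ℝ ∞ f) :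
    ContDiff ℝ ∞ (fun α => ∫ y in dsk, f (α, y)) :=
  contDiff_infty.mpr fun n => contDiff_slice_int n hf

@[fun_prop]
theorem smooth_avg {f : P3 → ℝ} (hf : ContDiff ℝ ∞ f) : ContDiff ℝ ∞ (avg f) :=
  contDiff_const.mul ((smooth_slice_int hf).comp contDiff_fst)

@[fun_prop]
theorem smooth_bar {f : P3 → ℝ} (hf : ContDiff ℝ ∞ f) : ContDiff ℝ ∞ (barDisk f) := by
  rw [barDisk_eq]; exact hf.sub (smooth_avg hf)

theorem pdi_avg {f : P3 → ℝ} (hf : ContDiff ℝ ∞ f) (i : Fin 3) :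
    pdi i (avg f) = fun p => avg (pdi 0 f) p * (e3vec i).1 := by
  funext p
  have h1 : HasFDerivAt (fun q : P3 => q.1) (ContinuousLinearMap.fst ℝ ℝ (ℝ × ℝ)) p :=
    hasFDerivAt_fst
  have h2 := ((hasDeriv_slice_int hf p.1).const_mul (1 / π)).comp_hasFDerivAt p h1
  have h3 : HasFDerivAt (avg f) _ p := h2
  unfold pdi
  rw [h3.fderiv]
  simp [avg, pdi]

theorem pdi0_bar {f : P3 → ℝ} (hf : ContDiff ℝ ∞ f) : pdi 0 (barDisk f) = barDisk (pdi 0 f) := by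
  rw [barDisk_eq, barDisk_eq, pdi_sub 0 hf (smooth_avg hf), pdi_avg hf]
  funext p; simp [e3vec]
theorem pdi1_bar {f : P3 → ℝ} (hf : ContDiff ℝ ∞ f) : pdi 1 (barDisk f) = pdi 1 f := by
  rw [barDisk_eq, pdi_sub 1 hf (smooth_avg hf), pdi_avg hf]
  funext p; simp [e3vec]
theorem pdi2_bar {f : P3 → ℝ} (hf : ContDiff ℝ ∞ f) : pdi 2 (barDisk f) = pdi 2 f := by
  rw [barDisk_eq, pdi_sub 2 hf (smooth_avg hf), pdi_avg hf]
  funext p; simp [e3vec]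

theorem PerA.bar {ℓ : ℝ} {f : P3 → ℝ} (hf : PerA ℓ f) : PerA ℓ (barDisk f) := by
  intro p
  have : ∀ y : ℝ × ℝ, f (p.1 + ℓ, y) = f (p.1, y) := fun y => hf (p.1, y)
  simp only [barDisk_eq, avg, hf p, this]

theorem poincare_bar {ℓ : ℝ} {f : P3 → ℝ} (hf : ContDiff ℝ ∞ f) :
    NN ℓ (barDisk f) ≤ 4 * (NN ℓ (pdi 1 f) + NN ℓ (pdi 2 f)) := by
  have c0 := (smooth_bar hf).continuous
  have c1 := (smooth_pdi 1 hf).continuous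
  have c2 := (smooth_pdi 2 hf).continuous
  have n1 := NN_nonneg ℓ (pdi 1 f)
  have n2 := NN_nonneg ℓ (pdi 2 f)
  apply le_of_sq_le_sq _ (by positivity)
  have h1 : NN ℓ (barDisk f) ^ 2 ≤ 16 * (NN ℓ (pdi 1 f) ^ 2 + NN ℓ (pdi 2 f) ^ 2) := by
    rw [NN_sq, NN_sq, NN_sq, ← II_add (by fun_prop) (by fun_prop), ← II_const_mul,
      II_fubini (by fun_prop), II_fubini (by fun_prop)]
    have ci : ∀ {g : P3 → ℝ}, Continuous g → IntegrableOn (fun α => ∫ y in dsk, g (α, y)) (Set.Ioc 0 ℓ) := by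
      intro g hg
      have : Integrable g (((volume : Measure ℝ).restrict (Set.Ioc 0 ℓ)).prod
          ((volume : Measure (ℝ × ℝ)).restrict dsk)) := by
        rw [Measure.prod_restrict]; exact intOn hg
      exact this.integral_prod_left
    apply setIntegral_mono_on (ci (g := fun p => barDisk f p ^ 2) (by fun_prop))
      (ci (g := fun p => 16 * (pdi 1 f p ^ 2 + pdi 2 f p ^ 2)) (by fun_prop)) measurableSet_Ioc
    intro α _
    rw [integral_const_mul]
    exact dsk_poincare (slice_hasFDeriv hf α) (by fun_prop) (by fun_prop)
  nlinarith

theorem NN_avg {ℓ : ℝ} {f : P3 → ℝ} (hf : ContDiff ℝ ∞ f) : NN ℓ (avg f) ≤ NN ℓ f := by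
  have c0 := (smooth_avg hf).continuous
  have c1 := hf.continuous
  apply le_of_sq_le_sq _ (NN_nonneg _ _)
  rw [NN_sq, NN_sq, II_fubini (by fun_prop), II_fubini (by fun_prop)]
  have ci : ∀ {g : P3 → ℝ}, Continuous g → IntegrableOn (fun α => ∫ y in dsk, g (α, y)) (Set.Ioc 0 ℓ) := by
    intro g hg
    have : Integrable g (((volume : Measure ℝ).restrict (Set.Ioc 0 ℓ)).prod
        ((volume : Measure (ℝ × ℝ)).restrict dsk)) := by
      rw [Measure.prod_restrict]; exact intOn hg
    exact this.integral_prod_left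
  apply setIntegral_mono_on (ci (g := fun p => avg f p ^ 2) (by fun_prop))
    (ci (g := fun p => f p ^ 2) (by fun_prop)) measurableSet_Ioc
  intro α _
  have := sq_integral_le_aux ((volume : Measure (ℝ × ℝ)).restrict dsk) (f := fun y => f (α, y))
    ((by fun_prop : Continuous fun y => f (α, y)).continuousOn.integrableOn_compact isCompact_dsk)
    ((by fun_prop : Continuous fun y => f (α, y) ^ 2).continuousOn.integrableOn_compact isCompact_dsk)
  rw [dsk_real'] at this
  simp only [avg]
  rw [integral_const, dsk_real', smul_eq_mul]
  rw [mul_pow]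
  have hp := pi_pos
  calc π * ((1 / π) ^ 2 * (∫ y in dsk, f (α, y)) ^ 2)
      ≤ π * ((1 / π) ^ 2 * (π * ∫ y in dsk, f (α, y) ^ 2)) := by gcongr
    _ = _ := by field_simp

theorem poincare_full {ℓ : ℝ} (hℓ : 0 < ℓ) {f : P3 → ℝ} (hf : ContDiff ℝ ∞ f) (h0 : II ℓ f = 0) :
    NN ℓ f ≤ 4 * (NN ℓ (pdi 1 f) + NN ℓ (pdi 2 f)) + ℓ * NN ℓ (pdi 0 f) := by
  have c0 := (smooth_avg hf).continuous
  have c1 := (smooth_bar hf).continuous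
  have c3 := hf.continuous
  have c4 := (smooth_pdi 0 hf).continuous
  have c2 := (smooth_avg (smooth_pdi 0 hf)).continuous
  have e : NN ℓ f ≤ NN ℓ (barDisk f) + NN ℓ (avg f) := by
    have := NN_add (ℓ := ℓ) c1 c0
    have e : (fun p => barDisk f p + avg f p) = f := by funext p; simp [barDisk_eq]
    rwa [e] at this
  have h1 := poincare_bar (ℓ := ℓ) hf
  suffices h2 : NN ℓ (avg f) ≤ ℓ * NN ℓ (avg (pdi 0 f)) by
    have h3 := NN_avg (ℓ := ℓ) (smooth_pdi 0 hf)
    nlinarith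
  let m : ℝ → ℝ := fun α => avg f (α, 0)
  let m' : ℝ → ℝ := fun α => avg (pdi 0 f) (α, 0)
  have cm : Continuous m := by simp only [m]; fun_prop
  have cm' : Continuous m' := by simp only [m']; fun_prop
  have hm : ∀ α, HasDerivAt m (m' α) α := fun α => (hasDeriv_slice_int hf α).const_mul (1 / π)
  have hm0 : ∫ α in Set.Ioc 0 ℓ, m α = 0 := by
    rw [II_fubini c3] at h0
    simp only [m, avg]
    rw [integral_const_mul, h0, mul_zero]
  set S := ∫ α in Set.Ioc 0 ℓ, |m' α| with hS
  have hS0 : 0 ≤ S := integral_nonneg fun _ => abs_nonneg _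
  have hd : ∀ a ∈ Set.Ioc 0 ℓ, ∀ b ∈ Set.Ioc 0 ℓ, a ≤ b → |m b - m a| ≤ S := by
    intro a ha b hb hab
    rw [← intervalIntegral.integral_eq_sub_of_hasDerivAt (fun t _ => hm t) (cm'.intervalIntegrable a b),
      intervalIntegral.integral_of_le hab]
    refine (abs_integral_le_integral_abs).trans ?_
    exact setIntegral_mono_set cm'.abs.integrableOn_Ioc (Eventually.of_forall fun _ => abs_nonneg _)
      (LE.le.eventuallyLE (Set.Ioc_subset_Ioc ha.1.le hb.2))
  have hd' : ∀ a ∈ Set.Ioc 0 ℓ, ∀ b ∈ Set.Ioc 0 ℓ, |m a - m b| ≤ S := by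
    intro a ha b hb
    rcases le_total a b with h | h
    · rw [abs_sub_comm]; exact hd a ha b hb h
    · exact hd b hb a ha h
  have hmb : ∀ a ∈ Set.Ioc 0 ℓ, |m a| ≤ S := by
    intro a ha
    have e1 : ∫ b in Set.Ioc 0 ℓ, (m a - m b) = ℓ * m a := by
      rw [integral_sub (integrable_const _) cm.integrableOn_Ioc, hm0, integral_const]
      simp [Measure.real, hℓ.le]
    have e2 : |∫ b in Set.Ioc 0 ℓ, (m a - m b)| ≤ S * ℓ := by
      have := norm_setIntegral_le_of_norm_le_const (μ := (volume : Measure ℝ)) (s := Set.Ioc 0 ℓ)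
        (f := fun b => m a - m b) (C := S) (by simp) (fun b hb => hd' a ha b hb)
      simpa [Measure.real, hℓ.le] using this
    rw [e1, abs_mul, abs_of_pos hℓ] at e2
    nlinarith
  have hSS : S ^ 2 ≤ ℓ * ∫ α in Set.Ioc 0 ℓ, m' α ^ 2 := by
    have := sq_integral_le_aux ((volume : Measure ℝ).restrict (Set.Ioc 0 ℓ)) (f := fun α => |m' α|)
      cm'.abs.integrableOn_Ioc (by simp only [sq_abs]; exact (by fun_prop : Continuous fun x => m' x ^ 2).integrableOn_Ioc)
    simpa [Measure.real, hℓ.le] using this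
  have n0 := NN_nonneg ℓ (avg (pdi 0 f))
  apply le_of_sq_le_sq _ (by positivity)
  have sl : ∀ {g : P3 → ℝ}, Continuous g → (∀ α (y : ℝ × ℝ), g (α, y) = g (α, 0)) →
      NN ℓ g ^ 2 = π * ∫ α in Set.Ioc 0 ℓ, g (α, 0) ^ 2 := by
    intro g cg hg
    rw [NN_sq, II_fubini (by fun_prop)]
    simp_rw [fun α y => hg α y]
    rw [← integral_const_mul]
    congr 1
    funext α
    rw [integral_const, dsk_real', smul_eq_mul]
  rw [mul_pow, sl c0 (fun _ _ => rfl), sl c2 (fun _ _ => rfl)]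
  have : ∫ α in Set.Ioc 0 ℓ, m α ^ 2 ≤ ∫ α in Set.Ioc 0 ℓ, S ^ 2 := by
    apply setIntegral_mono_on (cm.pow 2).integrableOn_Ioc (integrable_const _) measurableSet_Ioc
    intro a ha
    exact sq_le_sq' (by linarith [neg_le_of_abs_le (hmb a ha)]) (le_of_abs_le (hmb a ha))
  have e3 : ∫ α in Set.Ioc 0 ℓ, S ^ 2 = ℓ * S ^ 2 := by simp [Measure.real, hℓ.le]
  rw [e3] at this
  show π * ∫ α in Set.Ioc 0 ℓ, m α ^ 2 ≤ ℓ ^ 2 * (π * ∫ α in Set.Ioc 0 ℓ, m' α ^ 2)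
  have h5 : ∫ α in Set.Ioc 0 ℓ, m α ^ 2 ≤ ℓ * (ℓ * ∫ α in Set.Ioc 0 ℓ, m' α ^ 2) :=
    this.trans (by gcongr)
  calc π * ∫ α in Set.Ioc 0 ℓ, m α ^ 2 ≤ π * (ℓ * (ℓ * ∫ α in Set.Ioc 0 ℓ, m' α ^ 2)) := by
        have := pi_pos; gcongr
    _ = _ := by ring

end

section
open scoped ContDiff

/-- Smooth cutoff used to extend `B`. -/
def etaB : ContDiffBump (0 : ℝ) := ⟨1 / 2, 3 / 4, by norm_num, by norm_num⟩

def zetaB (s : ℝ) : ℝ := s * etaB s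

@[fun_prop]
theorem smooth_zetaB : ContDiff ℝ ∞ zetaB := by
  unfold zetaB
  exact contDiff_id.mul etaB.contDiff

theorem zetaB_le (s : ℝ) : zetaB s ≤ 3 / 4 := by
  unfold zetaB
  by_cases h : |s| < 3 / 4
  · have h1 : etaB s ≤ 1 := etaB.le_one
    have h0 : 0 ≤ etaB s := etaB.nonneg
    have := abs_lt.mp h
    nlinarith
  · have : etaB s = 0 := etaB.zero_of_le_dist (by
      rw [Real.dist_eq, sub_zero]; exact not_lt.mp h)
    rw [this]; norm_num

theorem zetaB_eq {s : ℝ} (h : |s| ≤ 1 / 2) : zetaB s = s := by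
  have : etaB s = 1 := etaB.one_of_mem_closedBall (by
    rw [Metric.mem_closedBall, Real.dist_eq, sub_zero]; exact h)
  unfold zetaB; rw [this, mul_one]

/-- Extension of `B = 1 - ε κ y₁` to a positive smooth function. -/
def bt (Γ : FramedCurve) (e : ℝ) (p : P3) : ℝ := 1 - zetaB (e * Γ.κ p.1 * p.2.1)

theorem bt_ge (Γ : FramedCurve) (e : ℝ) (p : P3) : 1 / 4 ≤ bt Γ e p := by
  have := zetaB_le (e * Γ.κ p.1 * p.2.1)
  unfold bt; linarith

/-- The second order operator with coefficients `c`. -/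
def mop (e : ℝ) (c0 c1 c2 c3 v : P3 → ℝ) : P3 → ℝ := fun p =>
  pdi 1 (fun q => c0 q * pdi 1 v q) p + pdi 2 (fun q => c0 q * pdi 2 v q) p
  + e ^ 2 * (pdi 0 (fun q => c1 q * pdi 0 v q + c2 q * pT v q) p
    + pT (fun q => c2 q * pdi 0 v q + c3 q * pT v q) p)

/-- Solutions of the Neumann problem in coordinates. -/
structure Dat (Γ : FramedCurve) where
  ε : ℝ
  u : P3 → ℝ
  ρ : P3 → ℝ
  hε : 0 < ε
  hε1 : ε ≤ 1
  su : ContDiff ℝ ∞ u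
  sρ : ContDiff ℝ ∞ ρ
  pu : PerA Γ.ℓ u
  pρ : PerA Γ.ℓ ρ
  neu : ∀ p : P3, p.2.1 ^ 2 + p.2.2 ^ 2 = 1 → p.2.1 * pdi 1 u p + p.2.2 * pdi 2 u p = 0
  mean : II Γ.ℓ u = 0
  eq : ∀ p ∈ domC, mop ε (bt Γ ε) (fun p => (bt Γ ε p)⁻¹) (fun p => - Γ.τ p.1 * (bt Γ ε p)⁻¹)
    (fun p => Γ.τ p.1 ^ 2 * (bt Γ ε p)⁻¹) u p = ε ^ 2 * (bt Γ ε p * ρ p)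

variable {Γ : FramedCurve}

/-- Families of functions indexed by the solutions. -/
abbrev Fam (Γ : FramedCurve) := Dat Γ → P3 → ℝ

def Sm (f : Fam Γ) : Prop := ∀ d, ContDiff ℝ ∞ (f d)

def fp (i : Fin 3) (f : Fam Γ) : Fam Γ := fun d => pdi i (f d)
def fT (f : Fam Γ) : Fam Γ := fun d => pT (f d)
def Y1 : Fam Γ := fun _ p => p.2.1
def Y2 : Fam Γ := fun _ p => p.2.2
def eF : Fam Γ := fun d _ => d.ε

theorem Sm.fp {f : Fam Γ} (hf : Sm f) (i : Fin 3) : Sm (fp i f) := fun d => smooth_pdi i (hf d)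
theorem Sm.fT {f : Fam Γ} (hf : Sm f) : Sm (fT f) := fun d => smooth_pT (hf d)
theorem Sm.add {f g : Fam Γ} (hf : Sm f) (hg : Sm g) : Sm (f + g) := fun d => (hf d).add (hg d)
theorem Sm.sub {f g : Fam Γ} (hf : Sm f) (hg : Sm g) : Sm (f - g) := fun d => (hf d).sub (hg d)
theorem Sm.neg {f : Fam Γ} (hf : Sm f) : Sm (-f) := fun d => (hf d).neg
theorem Sm.mul {f g : Fam Γ} (hf : Sm f) (hg : Sm g) : Sm (f * g) := fun d => (hf d).mul (hg d)
theorem Sm.y1 : Sm (Y1 : Fam Γ) := fun _ => sm_y1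
theorem Sm.y2 : Sm (Y2 : Fam Γ) := fun _ => sm_y2
theorem Sm.zero : Sm (0 : Fam Γ) := fun _ => contDiff_const
theorem Sm.one : Sm (1 : Fam Γ) := fun _ => contDiff_const
theorem Sm.eF : Sm (eF : Fam Γ) := fun _ => contDiff_const

theorem fp_add (i : Fin 3) {f g : Fam Γ} (hf : Sm f) (hg : Sm g) :
    fp i (f + g) = fp i f + fp i g := funext fun d => pdi_add i (hf d) (hg d)
theorem fp_sub (i : Fin 3) {f g : Fam Γ} (hf : Sm f) (hg : Sm g) :
    fp i (f - g) = fp i f - fp i g := funext fun d => pdi_sub i (hf d) (hg d)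
theorem fp_neg (i : Fin 3) {f : Fam Γ} : fp i (-f) = - fp i f := funext fun d => pdi_neg i
theorem fp_mul (i : Fin 3) {f g : Fam Γ} (hf : Sm f) (hg : Sm g) :
    fp i (f * g) = fp i f * g + f * fp i g := funext fun d => pdi_mul i (hf d) (hg d)
theorem fp_comm (i j : Fin 3) {f : Fam Γ} (hf : Sm f) : fp i (fp j f) = fp j (fp i f) :=
  funext fun d => pdi_comm i j (hf d)
theorem fp_zero (i : Fin 3) : fp i (0 : Fam Γ) = 0 := funext fun d => pdi_const i 0
theorem fp_eF (i : Fin 3) : fp i (eF : Fam Γ) = 0 := funext fun d => pdi_const i _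
theorem fp1_y1 : fp 1 (Y1 : Fam Γ) = 1 := funext fun _ => pdi1_y1
theorem fp2_y1 : fp 2 (Y1 : Fam Γ) = 0 := funext fun _ => pdi2_y1
theorem fp0_y1 : fp 0 (Y1 : Fam Γ) = 0 := funext fun _ => pdi0_y1
theorem fp1_y2 : fp 1 (Y2 : Fam Γ) = 0 := funext fun _ => pdi1_y2
theorem fp2_y2 : fp 2 (Y2 : Fam Γ) = 1 := funext fun _ => pdi2_y2
theorem fp0_y2 : fp 0 (Y2 : Fam Γ) = 0 := funext fun _ => pdi0_y2
theorem fT_eq (f : Fam Γ) : fT f = Y1 * fp 2 f - Y2 * fp 1 f := rfl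
theorem fT_add {f g : Fam Γ} (hf : Sm f) (hg : Sm g) : fT (f + g) = fT f + fT g :=
  funext fun d => pT_add (hf d) (hg d)
theorem fT_mul {f g : Fam Γ} (hf : Sm f) (hg : Sm g) : fT (f * g) = fT f * g + f * fT g :=
  funext fun d => pT_mul (hf d) (hg d)
theorem fT_zero : fT (0 : Fam Γ) = 0 := by rw [fT_eq, fp_zero, fp_zero]; simp
theorem fT_eF : fT (eF : Fam Γ) = 0 := by rw [fT_eq, fp_eF, fp_eF]; simp
theorem fp0_fT {f : Fam Γ} (hf : Sm f) : fp 0 (fT f) = fT (fp 0 f) := funext fun d => pdi0_pT (hf d)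
theorem fp1_fT {f : Fam Γ} (hf : Sm f) : fp 1 (fT f) = fT (fp 1 f) + fp 2 f :=
  funext fun d => pdi1_pT (hf d)
theorem fp2_fT {f : Fam Γ} (hf : Sm f) : fp 2 (fT f) = fT (fp 2 f) - fp 1 f :=
  funext fun d => pdi2_pT (hf d)

/-! Coefficients -/
def Cf (c : Fam Γ) : Prop := ∃ C : ℝ × P3 → ℝ, ContDiff ℝ ∞ C ∧
  (∀ e, PerA Γ.ℓ (fun p => C (e, p))) ∧ ∀ d p, c d p = C (d.ε, p)

theorem Cf.sm {c : Fam Γ} (hc : Cf c) : Sm c := by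
  obtain ⟨C, hC, -, h⟩ := hc
  intro d
  have : c d = fun p => C (d.ε, p) := funext (h d)
  rw [this]; fun_prop

theorem Cf.per {c : Fam Γ} (hc : Cf c) (d : Dat Γ) : PerA Γ.ℓ (c d) := by
  obtain ⟨C, hC, hp, h⟩ := hc
  have : c d = fun p => C (d.ε, p) := funext (h d)
  rw [this]; exact hp _

theorem Cf.bdd {c : Fam Γ} (hc : Cf c) : ∃ K : ℝ, 0 ≤ K ∧ ∀ d, ∀ p ∈ domC, |c d p| ≤ K := by
  obtain ⟨C, hC, hp, h⟩ := hc
  obtain ⟨K, hK⟩ := ((isCompact_Icc (a := (0:ℝ)) (b := 1)).prod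
    ((isCompact_Icc (a := (0:ℝ)) (b := Γ.ℓ)).prod isCompact_dsk)).exists_bound_of_continuousOn
    (f := C) hC.continuous.continuousOn
  refine ⟨|K|, abs_nonneg _, fun d p hpp => ?_⟩
  have hper : Function.Periodic (fun α => C (d.ε, α, p.2.1, p.2.2)) Γ.ℓ := fun α =>
    hp d.ε (α, p.2.1, p.2.2)
  obtain ⟨α, hα, e⟩ := hper.exists_mem_Ico₀ Γ.hℓ p.1
  rw [h]
  have e' : C (d.ε, p) = C (d.ε, α, p.2.1, p.2.2) := e
  rw [e']
  exact (hK (d.ε, α, p.2.1, p.2.2) ⟨⟨d.hε.le, d.hε1⟩, ⟨hα.1, hα.2.le⟩, hpp⟩).trans (le_abs_self K)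

theorem Cf.fp {c : Fam Γ} (hc : Cf c) (i : Fin 3) : Cf (fp i c) := by
  obtain ⟨C, hC, hp, h⟩ := hc
  have key : ∀ e p, pdi i (fun p => C (e, p)) p = fderiv ℝ C (e, p) (0, e3vec i) := by
    intro e p
    have h1 : HasFDerivAt (fun p : P3 => C (e, p))
        ((fderiv ℝ C (e, p)).comp (ContinuousLinearMap.inr ℝ ℝ P3)) p :=
      HasFDerivAt.comp p (hC.differentiable (by simp) (e, p)).hasFDerivAt
        (hasFDerivAt_prodMk_right e p)
    unfold pdi; rw [h1.fderiv]; simp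
  refine ⟨fun q => fderiv ℝ C q (0, e3vec i), ?_, ?_, ?_⟩
  · have h1 : ContDiff ℝ ∞ (fderiv ℝ C) := hC.fderiv_right (by simp)
    exact h1.clm_apply contDiff_const
  · intro e
    have : (fun p => fderiv ℝ C (e, p) (0, e3vec i)) = pdi i (fun p => C (e, p)) :=
      funext fun p => (key e p).symm
    rw [this]; exact (hp e).pdi i
  · intro d p
    have : c d = fun p => C (d.ε, p) := funext (h d)
    show pdi i (c d) p = _
    rw [this, key]

theorem Cf.add {c e : Fam Γ} (hc : Cf c) (he : Cf e) : Cf (c + e) := by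
  obtain ⟨C, hC, hp, h⟩ := hc
  obtain ⟨C', hC', hp', h'⟩ := he
  exact ⟨fun q => C q + C' q, hC.add hC', fun e => (hp e).add (hp' e),
    fun d p => by simp [h, h']⟩
theorem Cf.mul {c e : Fam Γ} (hc : Cf c) (he : Cf e) : Cf (c * e) := by
  obtain ⟨C, hC, hp, h⟩ := hc
  obtain ⟨C', hC', hp', h'⟩ := he
  exact ⟨fun q => C q * C' q, hC.mul hC', fun e => (hp e).mul (hp' e),
    fun d p => by simp [h, h']⟩
theorem Cf.const (r : ℝ) : Cf (fun _ _ => r : Fam Γ) :=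
  ⟨fun _ => r, contDiff_const, fun _ _ => rfl, fun _ _ => rfl⟩
theorem Cf.one : Cf (1 : Fam Γ) := Cf.const 1
theorem Cf.zero : Cf (0 : Fam Γ) := Cf.const 0
theorem Cf.neg {c : Fam Γ} (hc : Cf c) : Cf (-c) := by
  have := (Cf.const (Γ := Γ) (-1)).mul hc
  convert this using 1
  funext d p; simp
theorem Cf.sub {c e : Fam Γ} (hc : Cf c) (he : Cf e) : Cf (c - e) := by
  rw [sub_eq_add_neg]; exact hc.add he.neg
theorem Cf.y1 : Cf (Y1 : Fam Γ) :=
  ⟨fun q => q.2.2.1, by fun_prop, fun _ _ => rfl, fun _ _ => rfl⟩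
theorem Cf.y2 : Cf (Y2 : Fam Γ) :=
  ⟨fun q => q.2.2.2, by fun_prop, fun _ _ => rfl, fun _ _ => rfl⟩
theorem Cf.eF : Cf (eF : Fam Γ) :=
  ⟨fun q => q.1, by fun_prop, fun _ _ => rfl, fun _ _ => rfl⟩
theorem Cf.fT {c : Fam Γ} (hc : Cf c) : Cf (fT c) := by
  rw [fT_eq]; exact (Cf.y1.mul (hc.fp 2)).sub (Cf.y2.mul (hc.fp 1))

def a0 : Fam Γ := fun d => bt Γ d.ε
def a1 : Fam Γ := fun d p => (bt Γ d.ε p)⁻¹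
def a2 : Fam Γ := fun d p => - Γ.τ p.1 * (bt Γ d.ε p)⁻¹
def a3 : Fam Γ := fun d p => Γ.τ p.1 ^ 2 * (bt Γ d.ε p)⁻¹

theorem Cf.a0 : Cf (a0 : Fam Γ) := by
  have h : ContDiff ℝ ∞ Γ.κ := Γ.smooth_κ
  refine ⟨fun q => bt Γ q.1 q.2, ?_, fun e p => ?_, fun _ _ => rfl⟩
  · unfold bt; fun_prop
  · simp only [bt, Γ.periodic_κ p.1]
theorem Cf.a1 : Cf (a1 : Fam Γ) := by
  obtain ⟨C, hC, hp, h⟩ := (Cf.a0 : Cf (_root_.a0 : Fam Γ))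
  have h : ContDiff ℝ ∞ Γ.κ := Γ.smooth_κ
  refine ⟨fun q => (bt Γ q.1 q.2)⁻¹, ?_, fun e p => ?_, fun _ _ => rfl⟩
  · apply ContDiff.inv
    · unfold bt; fun_prop
    · intro q; have := bt_ge Γ q.1 q.2; positivity
  · simp only [bt, Γ.periodic_κ p.1]
theorem Cf.tau : Cf (fun _ p => Γ.τ p.1 : Fam Γ) := by
  have h : ContDiff ℝ ∞ Γ.τ := Γ.smooth_τ
  exact ⟨fun q => Γ.τ q.2.1, by fun_prop, fun e p => Γ.periodic_τ p.1, fun _ _ => rfl⟩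
theorem Cf.a2 : Cf (a2 : Fam Γ) := Cf.tau.neg.mul Cf.a1
theorem Cf.a3 : Cf (a3 : Fam Γ) := by
  have := (Cf.tau.mul Cf.tau).mul (Cf.a1 (Γ := Γ))
  convert this using 1
  funext d p; simp [_root_.a3, _root_.a1, sq]

/-! Bounded families -/
def Bd0 (f : Fam Γ) (R : Dat Γ → ℝ) : Prop := Sm f ∧ ∃ C : ℝ, 0 ≤ C ∧ ∀ d, NN Γ.ℓ (f d) ≤ C * R d

def Bd : ℕ → Fam Γ → (Dat Γ → ℝ) → Prop
  | 0, f, R => Bd0 f R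
  | J + 1, f, R => Bd0 f R ∧ Bd J (fp 1 f) R ∧ Bd J (fp 2 f) R

theorem Bd.zero' {J : ℕ} {f : Fam Γ} {R : Dat Γ → ℝ} (h : Bd J f R) : Bd 0 f R := by
  cases J with
  | zero => exact h
  | succ J => exact h.1

theorem Bd.sm {J : ℕ} {f : Fam Γ} {R : Dat Γ → ℝ} (h : Bd J f R) : Sm f := h.zero'.1

theorem Bd.pred {J : ℕ} : ∀ {f : Fam Γ} {R : Dat Γ → ℝ}, Bd (J + 1) f R → Bd J f R := by
  induction J with
  | zero => intro f R h; exact h.1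
  | succ J ih => intro f R h; exact ⟨h.1, ih h.2.1, ih h.2.2⟩

theorem Bd0.add {f g : Fam Γ} {R : Dat Γ → ℝ} (hf : Bd0 f R) (hg : Bd0 g R) : Bd0 (f + g) R := by
  obtain ⟨sf, C, C0, h⟩ := hf
  obtain ⟨sg, C', C0', h'⟩ := hg
  refine ⟨sf.add sg, C + C', by positivity, fun d => ?_⟩
  have := NN_add (ℓ := Γ.ℓ) (sf d).continuous (sg d).continuous
  calc NN Γ.ℓ ((f + g) d) ≤ NN Γ.ℓ (f d) + NN Γ.ℓ (g d) := this
    _ ≤ (C + C') * R d := by have := h d; have := h' d; linarith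

theorem Bd0.coef {c f : Fam Γ} {R : Dat Γ → ℝ} (hc : Cf c) (hf : Bd0 f R) : Bd0 (c * f) R := by
  obtain ⟨sf, C, C0, h⟩ := hf
  obtain ⟨K, K0, hK⟩ := hc.bdd
  refine ⟨hc.sm.mul sf, K * C, by positivity, fun d => ?_⟩
  have := NN_mul_le (ℓ := Γ.ℓ) (hc.sm d).continuous (sf d).continuous K0 (hK d)
  calc NN Γ.ℓ ((c * f) d) ≤ K * NN Γ.ℓ (f d) := this
    _ ≤ K * (C * R d) := by gcongr; exact h d
    _ = _ := by ring

theorem Bd.add {J : ℕ} : ∀ {f g : Fam Γ} {R : Dat Γ → ℝ}, Bd J f R → Bd J g R → Bd J (f + g) R := by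
  induction J with
  | zero => intro f g R hf hg; exact Bd0.add hf hg
  | succ J ih =>
    intro f g R hf hg
    refine ⟨Bd0.add hf.1 hg.1, ?_, ?_⟩
    · rw [fp_add 1 hf.sm hg.sm]; exact ih hf.2.1 hg.2.1
    · rw [fp_add 2 hf.sm hg.sm]; exact ih hf.2.2 hg.2.2

theorem Bd.coef {J : ℕ} : ∀ {c f : Fam Γ} {R : Dat Γ → ℝ}, Cf c → Bd J f R → Bd J (c * f) R := by
  induction J with
  | zero => intro c f R hc hf; exact Bd0.coef hc hf
  | succ J ih =>
    intro c f R hc hf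
    refine ⟨Bd0.coef hc hf.1, ?_, ?_⟩
    · rw [fp_mul 1 hc.sm hf.sm]; exact (ih (hc.fp 1) hf.pred).add (ih hc hf.2.1)
    · rw [fp_mul 2 hc.sm hf.sm]; exact (ih (hc.fp 2) hf.pred).add (ih hc hf.2.2)

theorem Bd.neg {J : ℕ} {f : Fam Γ} {R : Dat Γ → ℝ} (hf : Bd J f R) : Bd J (-f) R := by
  have := Bd.coef (Cf.one (Γ := Γ)).neg hf
  simpa using this
theorem Bd.sub {J : ℕ} {f g : Fam Γ} {R : Dat Γ → ℝ} (hf : Bd J f R) (hg : Bd J g R) :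
    Bd J (f - g) R := by
  rw [sub_eq_add_neg]; exact hf.add hg.neg

theorem Bd.mono {J : ℕ} {R R' : Dat Γ → ℝ} (h : ∀ d, R d ≤ R' d) :
    ∀ {f : Fam Γ}, Bd J f R → Bd J f R' := by
  have h0 : ∀ {f : Fam Γ}, Bd0 f R → Bd0 f R' := by
    rintro f ⟨sf, C, C0, hC⟩
    exact ⟨sf, C, C0, fun d => (hC d).trans (by gcongr; exact h d)⟩
  induction J with
  | zero => intro f hf; exact h0 hf
  | succ J ih => intro f hf; exact ⟨h0 hf.1, ih hf.2.1, ih hf.2.2⟩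

/-- equality on the solid torus. -/
def EqC (f g : Fam Γ) : Prop := ∀ d, ∀ p ∈ domC, f d p = g d p

theorem EqC.fp {f g : Fam Γ} (hf : Sm f) (hg : Sm g) (h : EqC f g) (i : Fin 3) :
    EqC (fp i f) (fp i g) := fun d => pdi_congr_domC i (hf d) (hg d) (h d)
theorem EqC.fT {f g : Fam Γ} (hf : Sm f) (hg : Sm g) (h : EqC f g) :
    EqC (fT f) (fT g) := fun d => pT_congr_domC (hf d) (hg d) (h d)
theorem EqC.symm {f g : Fam Γ} (h : EqC f g) : EqC g f := fun d p hp => (h d p hp).symm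

theorem Bd.congr {J : ℕ} : ∀ {f g : Fam Γ} {R : Dat Γ → ℝ}, Bd J f R → Sm g → EqC f g → Bd J g R := by
  have h0 : ∀ {f g : Fam Γ} {R : Dat Γ → ℝ}, Bd0 f R → Sm g → EqC f g → Bd0 g R := by
    rintro f g R ⟨sf, C, C0, hC⟩ sg h
    exact ⟨sg, C, C0, fun d => by rw [← NN_congr (h d)]; exact hC d⟩
  induction J with
  | zero => intro f g R hf sg h; exact h0 hf sg h
  | succ J ih =>
    intro f g R hf sg h
    exact ⟨h0 hf.1 sg h, ih hf.2.1 (sg.fp 1) (h.fp hf.sm sg 1), ih hf.2.2 (sg.fp 2) (h.fp hf.sm sg 2)⟩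

theorem Bd.eps2 {J : ℕ} : ∀ {f : Fam Γ} {R : Dat Γ → ℝ}, Bd J f R →
    Bd J (eF * eF * f) (fun d => d.ε ^ 2 * R d) := by
  have h0 : ∀ {f : Fam Γ} {R : Dat Γ → ℝ}, Bd0 f R → Bd0 (eF * eF * f) (fun d => d.ε ^ 2 * R d) := by
    rintro f R ⟨sf, C, C0, hC⟩
    refine ⟨(Sm.eF.mul Sm.eF).mul sf, C, C0, fun d => ?_⟩
    have : NN Γ.ℓ ((eF * eF * f : Fam Γ) d) = |d.ε * d.ε| * NN Γ.ℓ (f d) :=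
      NN_const_mul (f := f d) (d.ε * d.ε)
    rw [this, abs_of_nonneg (mul_self_nonneg _)]
    nlinarith [hC d, mul_le_mul_of_nonneg_left (hC d) (mul_self_nonneg d.ε)]
  induction J with
  | zero => intro f R hf; exact h0 hf
  | succ J ih =>
    intro f R hf
    have key : ∀ i, fp i (eF * eF * f) = eF * eF * fp i f := by
      intro i
      rw [fp_mul i (Sm.eF.mul Sm.eF) hf.sm, fp_mul i Sm.eF Sm.eF, fp_eF]; ring
    refine ⟨h0 hf.1, ?_, ?_⟩
    · rw [key]; exact ih hf.2.1
    · rw [key]; exact ih hf.2.2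

end

section
open scoped ContDiff
variable {Γ : FramedCurve}

/-! Interior estimate. -/
theorem hess_zero {ℓ : ℝ} {g : P3 → ℝ} (hg : ContDiff ℝ ∞ g)
    (h1 : ∀ p : P3, p.2.1 ^ 2 + p.2.2 ^ 2 = 1 → pdi 1 g p = 0) :
    II ℓ (fun p => pdi 1 (pdi 1 g) p * pdi 2 (pdi 2 g) p - pdi 1 (pdi 2 g) p * pdi 1 (pdi 2 g) p) = 0 := by
  have s1 := smooth_pdi 1 hg
  have s2 := smooth_pdi 2 hg
  have s22 := smooth_pdi 2 s2
  have s12 := smooth_pdi 1 s2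
  rw [← ibp_y (ℓ := ℓ) (F := fun p => pdi 1 g p * pdi 2 (pdi 2 g) p)
    (G := fun p => - (pdi 1 g p * pdi 1 (pdi 2 g) p)) (s1.mul s22) (s1.mul s12).neg
    (fun p hp => by rw [h1 p hp]; ring)]
  congr 1
  funext p
  rw [pdi_neg, pdi_mul 1 s1 s22, pdi_mul 2 s1 s12, pdi_comm 1 2 s2, pdi_comm 2 1 hg]
  ring

theorem hess_le {ℓ : ℝ} {g : P3 → ℝ} (hg : ContDiff ℝ ∞ g)
    (h1 : ∀ p : P3, p.2.1 ^ 2 + p.2.2 ^ 2 = 1 → pdi 1 g p = 0) :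
    NN ℓ (pdi 1 (pdi 1 g)) ≤ NN ℓ (fun p => pdi 1 (pdi 1 g) p + pdi 2 (pdi 2 g) p) ∧
    NN ℓ (pdi 1 (pdi 2 g)) ≤ NN ℓ (fun p => pdi 1 (pdi 1 g) p + pdi 2 (pdi 2 g) p) ∧
    NN ℓ (pdi 2 (pdi 2 g)) ≤ NN ℓ (fun p => pdi 1 (pdi 1 g) p + pdi 2 (pdi 2 g) p) := by
  have s1 := smooth_pdi 1 hg
  have s2 := smooth_pdi 2 hg
  have c22 := (smooth_pdi 2 s2).continuous
  have c12 := (smooth_pdi 1 s2).continuous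
  have c11 := (smooth_pdi 1 s1).continuous
  have key : NN ℓ (fun p => pdi 1 (pdi 1 g) p + pdi 2 (pdi 2 g) p) ^ 2 =
      NN ℓ (pdi 1 (pdi 1 g)) ^ 2 + 2 * NN ℓ (pdi 1 (pdi 2 g)) ^ 2 + NN ℓ (pdi 2 (pdi 2 g)) ^ 2 := by
    have h0 := hess_zero (ℓ := ℓ) hg h1
    have e : NN ℓ (pdi 1 (pdi 1 g)) ^ 2 + 2 * NN ℓ (pdi 1 (pdi 2 g)) ^ 2 + NN ℓ (pdi 2 (pdi 2 g)) ^ 2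
       + 2 * II ℓ (fun p => pdi 1 (pdi 1 g) p * pdi 2 (pdi 2 g) p - pdi 1 (pdi 2 g) p * pdi 1 (pdi 2 g) p)
       = NN ℓ (fun p => pdi 1 (pdi 1 g) p + pdi 2 (pdi 2 g) p) ^ 2 := by
      simp only [NN_sq]
      rw [← II_const_mul, ← II_const_mul, ← II_add (by fun_prop) (by fun_prop),
        ← II_add (by fun_prop) (by fun_prop), ← II_add (by fun_prop) (by fun_prop)]
      congr 1; funext p; ring
    rw [← e, h0]; ring
  have n := NN_nonneg ℓ (fun p => pdi 1 (pdi 1 g) p + pdi 2 (pdi 2 g) p)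
  refine ⟨?_, ?_, ?_⟩ <;> apply abs_le_of_sq_le_sq' _ n |>.2 <;>
    nlinarith [sq_nonneg (NN ℓ (pdi 1 (pdi 1 g))), sq_nonneg (NN ℓ (pdi 1 (pdi 2 g))),
      sq_nonneg (NN ℓ (pdi 2 (pdi 2 g)))]

/-- The fast Laplacian. -/
def fL (v : Fam Γ) : Fam Γ := fp 1 (fp 1 v) + fp 2 (fp 2 v)

theorem Sm.fL {v : Fam Γ} (h : Sm v) : Sm (fL v) :=
  ((h.fp 1).fp 1).add ((h.fp 2).fp 2)

def fW : Fam Γ := 1 - (Y1 * Y1 + Y2 * Y2)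
theorem Cf.fW : Cf (fW : Fam Γ) := Cf.one.sub ((Cf.y1.mul Cf.y1).add (Cf.y2.mul Cf.y2))

theorem Bd0_of_le {f g : Fam Γ} {R : Dat Γ → ℝ} (hf : Bd 0 f R) (sg : Sm g)
    (h : ∀ d, NN Γ.ℓ (g d) ≤ NN Γ.ℓ (f d)) : Bd 0 g R := by
  obtain ⟨sf, C, C0, hC⟩ := hf
  exact ⟨sg, C, C0, fun d => (h d).trans (hC d)⟩

theorem fp_prod2 (i l : Fin 3) {c v : Fam Γ} (hc : Sm c) (hv : Sm v) :
    fp i (fp l (c * v)) = c * fp i (fp l v) + (fp i c * fp l v + fp l c * fp i v + fp i (fp l c) * v) := by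
  rw [fp_mul l hc hv, fp_add i ((hc.fp l).mul hv) (hc.mul (hv.fp l)), fp_mul i (hc.fp l) hv,
    fp_mul i hc (hv.fp l)]
  ring

theorem interior_est {v : Fam Γ} {R : Dat Γ → ℝ} (hL : Bd 0 (fL v) R) (h1 : Bd 0 (fp 1 v) R)
    (h2 : Bd 0 (fp 2 v) R) (h0 : Bd 0 v R) :
    Bd 0 (fW * fW * fp 1 (fp 1 v)) R ∧ Bd 0 (fW * fW * fp 1 (fp 2 v)) R ∧
      Bd 0 (fW * fW * fp 2 (fp 2 v)) R := by
  have sv := h0.sm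
  set φ : Fam Γ := fW * fW with hφ
  have cφ : Cf φ := Cf.fW.mul Cf.fW
  have rest : ∀ i l, Bd 0 (fp i v) R → Bd 0 (fp l v) R →
      Bd 0 (fp i φ * fp l v + fp l φ * fp i v + fp i (fp l φ) * v) R := fun i l hi hl =>
    ((hl.coef (cφ.fp i)).add (hi.coef (cφ.fp l))).add (h0.coef ((cφ.fp l).fp i))
  have hg : Bd 0 (fL (φ * v)) R := by
    have : fL (φ * v) = φ * fL v + ((fp 1 φ * fp 1 v + fp 1 φ * fp 1 v + fp 1 (fp 1 φ) * v) +
        (fp 2 φ * fp 2 v + fp 2 φ * fp 2 v + fp 2 (fp 2 φ) * v)) := by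
      unfold fL; rw [fp_prod2 1 1 cφ.sm sv, fp_prod2 2 2 cφ.sm sv]; ring
    rw [this]
    exact (hL.coef cφ).add ((rest 1 1 h1 h1).add (rest 2 2 h2 h2))
  have sg : Sm (φ * v) := cφ.sm.mul sv
  have hb : ∀ d (p : P3), p.2.1 ^ 2 + p.2.2 ^ 2 = 1 → pdi 1 ((φ * v) d) p = 0 := by
    intro d p hp
    have e : fp 1 (φ * v) = fW * ((fp 1 fW + fp 1 fW) * v + fW * fp 1 v) := by
      rw [fp_mul 1 cφ.sm sv, hφ, fp_mul 1 Cf.fW.sm Cf.fW.sm]; ring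
    have : pdi 1 ((φ * v) d) p = (fW : Fam Γ) d p * (((fp 1 fW + fp 1 fW) * v + fW * fp 1 v : Fam Γ) d p) :=
      congrFun (congrFun e d) p
    rw [this]
    have : (fW : Fam Γ) d p = 0 := by
      show (1 : ℝ) - (p.2.1 * p.2.1 + p.2.2 * p.2.2) = 0
      linarith
    rw [this, zero_mul]
  have H : ∀ i l, Bd 0 (fp i v) R → Bd 0 (fp l v) R → Bd 0 (fp i (fp l (φ * v))) R →
      Bd 0 (φ * fp i (fp l v)) R := by
    intro i l hi hl h
    have : φ * fp i (fp l v) = fp i (fp l (φ * v)) -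
        (fp i φ * fp l v + fp l φ * fp i v + fp i (fp l φ) * v) := by
      rw [fp_prod2 i l cφ.sm sv]; ring
    rw [this]; exact h.sub (rest i l hi hl)
  exact ⟨H 1 1 h1 h1 (Bd0_of_le hg ((sg.fp 1).fp 1) fun d => (hess_le (sg d) (hb d)).1),
    H 1 2 h1 h2 (Bd0_of_le hg ((sg.fp 2).fp 1) fun d => (hess_le (sg d) (hb d)).2.1),
    H 2 2 h2 h2 (Bd0_of_le hg ((sg.fp 2).fp 2) fun d => (hess_le (sg d) (hb d)).2.2)⟩

/-- From `|y|² f` and `w² f` to `f`. -/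
theorem patch {f : Fam Γ} {R : Dat Γ → ℝ} (sf : Sm f) (h1 : Bd 0 ((Y1 * Y1 + Y2 * Y2) * f) R)
    (h2 : Bd 0 (fW * fW * f) R) : Bd 0 f R := by
  have h : f = (1 + fW) * ((Y1 * Y1 + Y2 * Y2) * f) + fW * fW * f := by
    unfold fW; ring
  rw [h]
  exact (h1.coef (Cf.one.add Cf.fW)).add h2

def fbar (v : Fam Γ) : Fam Γ := fun d => barDisk (v d)

theorem fp1_bar {v : Fam Γ} (h : Sm v) : fp 1 (fbar v) = fp 1 v := funext fun d => pdi1_bar (h d)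
theorem fp2_bar {v : Fam Γ} (h : Sm v) : fp 2 (fbar v) = fp 2 v := funext fun d => pdi2_bar (h d)

theorem Bd_bar {v : Fam Γ} {R : Dat Γ → ℝ} (sv : Sm v) (h1 : Bd 0 (fp 1 v) R) (h2 : Bd 0 (fp 2 v) R) :
    Bd 0 (fbar v) R := by
  obtain ⟨_, C, C0, hC⟩ := h1
  obtain ⟨_, C', C0', hC'⟩ := h2
  refine ⟨fun d => smooth_bar (sv d), 4 * (C + C'), by positivity, fun d => ?_⟩
  have : NN Γ.ℓ (fbar v d) ≤ 4 * (NN Γ.ℓ (fp 1 v d) + NN Γ.ℓ (fp 2 v d)) := poincare_bar (sv d)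
  have := hC d; have := hC' d
  linarith

theorem hess0 {v : Fam Γ} {R : Dat Γ → ℝ} (sv : Sm v) (hL : Bd 0 (fL v) R)
    (h1 : Bd 0 (fp 1 v) R) (h2 : Bd 0 (fp 2 v) R)
    (t1 : Bd 0 (fp 1 (fT v)) R) (t2 : Bd 0 (fp 2 (fT v)) R) :
    Bd 0 (fp 1 (fp 1 v)) R ∧ Bd 0 (fp 1 (fp 2 v)) R ∧ Bd 0 (fp 2 (fp 2 v)) R := by
  have b := Bd_bar sv h1 h2
  have e1 := fp1_bar sv
  have e2 := fp2_bar sv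
  obtain ⟨i1, i2, i3⟩ := interior_est (v := fbar v) (R := R)
    (by unfold fL; rw [e1, e2]; exact hL) (by rw [e1]; exact h1) (by rw [e2]; exact h2) b
  rw [e1] at i1; rw [e2] at i2 i3
  set a := fp 1 (fT v) - fp 2 v with ha
  set c := fp 2 (fT v) + fp 1 v with hc
  have ea : a = Y1 * fp 1 (fp 2 v) - Y2 * fp 1 (fp 1 v) := by
    rw [ha, fp1_fT sv, fT_eq, fp_comm 2 1 sv]; ring
  have ec : c = Y1 * fp 2 (fp 2 v) - Y2 * fp 1 (fp 2 v) := by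
    rw [hc, fp2_fT sv, fT_eq]; ring
  have ba : Bd 0 a R := t1.sub h2
  have bc : Bd 0 c R := t2.add h1
  refine ⟨patch ((sv.fp 1).fp 1) ?_ i1, patch ((sv.fp 2).fp 1) ?_ i2, patch ((sv.fp 2).fp 2) ?_ i3⟩
  · have : (Y1 * Y1 + Y2 * Y2) * fp 1 (fp 1 v) = Y1 * Y1 * fL v - Y2 * a - Y1 * c := by
      rw [ea, ec]; unfold fL; ring
    rw [this]
    exact ((hL.coef (Cf.y1.mul Cf.y1)).sub (ba.coef Cf.y2)).sub (bc.coef Cf.y1)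
  · have : (Y1 * Y1 + Y2 * Y2) * fp 1 (fp 2 v) = Y1 * Y2 * fL v + Y1 * a - Y2 * c := by
      rw [ea, ec]; unfold fL; ring
    rw [this]
    exact ((hL.coef (Cf.y1.mul Cf.y2)).add (ba.coef Cf.y1)).sub (bc.coef Cf.y2)
  · have : (Y1 * Y1 + Y2 * Y2) * fp 2 (fp 2 v) = Y2 * Y2 * fL v + Y2 * a + Y1 * c := by
      rw [ea, ec]; unfold fL; ring
    rw [this]
    exact ((hL.coef (Cf.y2.mul Cf.y2)).add (ba.coef Cf.y2)).add (bc.coef Cf.y1)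

theorem hessJ (J : ℕ) : ∀ {v : Fam Γ} {R : Dat Γ → ℝ}, Sm v → Bd J (fL v) R →
    Bd J (fp 1 v) R → Bd J (fp 2 v) R → Bd J (fp 1 (fT v)) R → Bd J (fp 2 (fT v)) R →
    Bd J (fp 1 (fp 1 v)) R ∧ Bd J (fp 1 (fp 2 v)) R ∧ Bd J (fp 2 (fp 2 v)) R := by
  induction J with
  | zero => intro v R sv hL h1 h2 t1 t2; exact hess0 sv hL h1 h2 t1 t2
  | succ J ih =>
    intro v R sv hL h1 h2 t1 t2
    obtain ⟨b1, b2, b3⟩ := hess0 sv hL.zero' h1.zero' h2.zero' t1.zero' t2.zero'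
    have L1 : fL (fp 1 v) = fp 1 (fL v) := by
      unfold fL
      rw [fp_add 1 ((sv.fp 1).fp 1) ((sv.fp 2).fp 2), fp_comm 1 2 (sv.fp 2), fp_comm 1 2 sv]
    have L2 : fL (fp 2 v) = fp 2 (fL v) := by
      unfold fL
      rw [fp_add 2 ((sv.fp 1).fp 1) ((sv.fp 2).fp 2), fp_comm 2 1 (sv.fp 1), fp_comm 2 1 sv]
    have T1 : fT (fp 1 v) = fp 1 (fT v) - fp 2 v := by rw [fp1_fT sv]; ring
    have T2 : fT (fp 2 v) = fp 2 (fT v) + fp 1 v := by rw [fp2_fT sv]; ring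
    obtain ⟨p1, p2, p3⟩ := ih (v := fp 1 v) (R := R) (sv.fp 1) (by rw [L1]; exact hL.2.1) h1.2.1 h1.2.2
      (by rw [T1, fp_sub 1 (sv.fT.fp 1) (sv.fp 2)]; exact t1.2.1.sub h2.2.1)
      (by rw [T1, fp_sub 2 (sv.fT.fp 1) (sv.fp 2)]; exact t1.2.2.sub h2.2.2)
    obtain ⟨q1, q2, q3⟩ := ih (v := fp 2 v) (R := R) (sv.fp 2) (by rw [L2]; exact hL.2.2) h2.2.1 h2.2.2
      (by rw [T2, fp_add 1 (sv.fT.fp 2) (sv.fp 1)]; exact t2.2.1.add h1.2.1)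
      (by rw [T2, fp_add 2 (sv.fT.fp 2) (sv.fp 1)]; exact t2.2.2.add h1.2.2)
    refine ⟨⟨b1, p1, ?_⟩, ⟨b2, q1, ?_⟩, ⟨b3, ?_, q3⟩⟩
    · rw [fp_comm 2 1 (sv.fp 1)]; exact p2
    · rw [fp_comm 2 1 (sv.fp 2)]; exact q2
    · rw [fp_comm 1 2 (sv.fp 2), fp_comm 1 2 sv]; exact p3

end

section
open scoped ContDiff
variable {Γ : FramedCurve}

/-! Sobolev bounds on the source. -/
def RR (m : ℕ) (d : Dat Γ) : ℝ := Real.sqrt (SobSq Γ.ℓ m d.ρ)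

theorem RR_nonneg (m : ℕ) (d : Dat Γ) : 0 ≤ RR m d := Real.sqrt_nonneg _

theorem RR_mono {m n : ℕ} (h : m ≤ n) (d : Dat Γ) : RR m d ≤ RR n d := by
  apply Real.sqrt_le_sqrt
  apply Finset.sum_le_sum_of_subset_of_nonneg
  · intro x hx; simp only [Finset.mem_range] at *; omega
  · intro i _ _; exact integral_nonneg fun p => by positivity

theorem pdIter_eq (l : List (Fin 3)) {f : P3 → ℝ} (hf : ContDiff ℝ ∞ f) :
    ∃ m : Fin l.length → P3, (∀ i, ‖m i‖ ≤ 1) ∧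
      ∀ p, pdIter l f p = iteratedFDeriv ℝ l.length f p m := by
  induction l with
  | nil => exact ⟨fun i => i.elim0, fun i => i.elim0, fun p => by simp [pdIter]⟩
  | cons i l ih =>
    obtain ⟨m, hm, h⟩ := ih
    refine ⟨Fin.cons (e3vec i) m, ?_, ?_⟩
    · intro k
      refine Fin.cases ?_ (fun k => ?_) k
      · fin_cases i <;> simp [e3vec, Prod.norm_def]
      · simpa using hm k
    · intro p
      have e : pdIter l f = fun q => iteratedFDeriv ℝ l.length f q m := funext h
      show pdi i (pdIter l f) p = _
      rw [e]
      unfold pdi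
      have hd : DifferentiableAt ℝ (iteratedFDeriv ℝ l.length f) p :=
        (hf.differentiable_iteratedFDeriv (m := l.length) (by exact_mod_cast WithTop.coe_lt_top _)) p
      have := iteratedFDeriv_succ_apply_left (𝕜 := ℝ) (f := f) (x := p) (Fin.cons (e3vec i) m : Fin (l.length + 1) → P3)
      refine Eq.trans ?_ this.symm
      rw [fderiv_continuousMultilinear_apply_const_apply hd]
      simp

theorem smooth_pdIter (l : List (Fin 3)) {f : P3 → ℝ} (hf : ContDiff ℝ ∞ f) :
    ContDiff ℝ ∞ (pdIter l f) := by
  induction l with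
  | nil => exact hf
  | cons i l ih => exact smooth_pdi i ih

theorem NN_pdIter_le (l : List (Fin 3)) (m : ℕ) (h : l.length ≤ m) (d : Dat Γ) :
    NN Γ.ℓ (pdIter l d.ρ) ≤ RR m d := by
  refine le_trans ?_ (RR_mono h d)
  apply Real.sqrt_le_sqrt
  have c : Continuous (fun p => ‖iteratedFDeriv ℝ l.length d.ρ p‖ ^ 2) :=
    ((d.sρ.continuous_iteratedFDeriv (m := l.length) (by exact_mod_cast le_top)).norm).pow 2
  have h1 : L2sq Γ.ℓ (pdIter l d.ρ) ≤ ∫ p in domP Γ.ℓ, ‖iteratedFDeriv ℝ l.length d.ρ p‖ ^ 2 := by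
    obtain ⟨v, hv, e⟩ := pdIter_eq l d.sρ
    apply II_mono ((smooth_pdIter l d.sρ).continuous.pow 2) c
    intro p _
    show (pdIter l d.ρ p) ^ 2 ≤ _
    rw [e]
    have := (iteratedFDeriv ℝ l.length d.ρ p).le_opNorm v
    have h2 : ∏ i, ‖v i‖ ≤ 1 := Finset.prod_le_one (fun i _ => norm_nonneg _) (fun i _ => hv i)
    have h3 : ‖iteratedFDeriv ℝ l.length d.ρ p v‖ ≤ ‖iteratedFDeriv ℝ l.length d.ρ p‖ :=
      this.trans (mul_le_of_le_one_right (norm_nonneg _) h2)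
    rw [← sq_abs, ← Real.norm_eq_abs]
    gcongr
  refine h1.trans ?_
  exact Finset.single_le_sum (f := fun j => ∫ p in domP Γ.ℓ, ‖iteratedFDeriv ℝ j d.ρ p‖ ^ 2)
    (fun i _ => integral_nonneg fun p => by positivity) (Finset.self_mem_range_succ _)

inductive LC : ℕ → Fam Γ → Prop
  | mk (m : ℕ) (c : Fam Γ) (l : List (Fin 3)) (hc : Cf c) (hl : l.length ≤ m) :
      LC m (c * fun d => pdIter l d.ρ)
  | add (m : ℕ) (f g : Fam Γ) (hf : LC m f) (hg : LC m g) : LC m (f + g)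

theorem LC.sm {m : ℕ} {f : Fam Γ} (h : LC m f) : Sm f := by
  induction h with
  | mk c l hc hl => exact hc.sm.mul fun d => smooth_pdIter l d.sρ
  | add f g _ _ h1 h2 => exact h1.add h2

theorem LC.coef {m : ℕ} {f c : Fam Γ} (hc : Cf c) (h : LC m f) : LC m (c * f) := by
  induction h with
  | mk c' l hc' hl => rw [← mul_assoc]; exact LC.mk _ _ _ (hc.mul hc') hl
  | add f g _ _ h1 h2 => rw [mul_add]; exact LC.add _ _ _ h1 h2

theorem LC.fp {m : ℕ} {f : Fam Γ} (h : LC m f) (i : Fin 3) : LC (m + 1) (fp i f) := by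
  induction h with
  | mk c l hc hl =>
    rw [fp_mul i hc.sm (fun d => smooth_pdIter l d.sρ)]
    exact LC.add _ _ _ (LC.mk _ _ _ (hc.fp i) (by omega)) (LC.mk _ c (i :: l) hc (by simp; omega))
  | add f g hf hg h1 h2 => rw [fp_add i hf.sm hg.sm]; exact LC.add _ _ _ h1 h2

theorem LC.fT {m : ℕ} {f : Fam Γ} (h : LC m f) : LC (m + 1) (fT f) := by
  rw [fT_eq, sub_eq_add_neg, ← neg_mul]
  exact LC.add _ _ _ ((h.fp 2).coef Cf.y1) ((h.fp 1).coef Cf.y2.neg)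

theorem LC.bd0 {m : ℕ} {f : Fam Γ} (h : LC m f) : Bd 0 f (RR m) := by
  induction h with
  | mk c l hc hl =>
    apply Bd.coef hc
    exact ⟨fun d => smooth_pdIter l d.sρ, 1, by norm_num, fun d => by
      rw [one_mul]; exact NN_pdIter_le l m hl d⟩
  | add f g _ _ h1 h2 => exact h1.add h2

theorem LC.bd {J : ℕ} : ∀ {m : ℕ} {f : Fam Γ}, LC m f → Bd J f (RR (m + J)) := by
  induction J with
  | zero => intro m f h; exact h.bd0
  | succ J ih =>
    intro m f h
    refine ⟨h.bd0.mono (RR_mono (by omega)), ?_, ?_⟩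
    · exact (ih (h.fp 1)).mono (RR_mono (by omega))
    · exact (ih (h.fp 2)).mono (RR_mono (by omega))

/-! Tangential derivatives. -/
def Zop : Bool → Fam Γ → Fam Γ
  | true => fp 0
  | false => fT

def ZZ (w : List Bool) (v : Fam Γ) : Fam Γ := w.foldr Zop v

theorem Sm.Z {f : Fam Γ} (h : Sm f) (b : Bool) : Sm (Zop b f) := by
  cases b
  · exact h.fT
  · exact h.fp 0
theorem Cf.Z {f : Fam Γ} (h : Cf f) (b : Bool) : Cf (Zop b f) := by
  cases b
  · exact h.fT
  · exact h.fp 0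
theorem LC.Z {m : ℕ} {f : Fam Γ} (h : LC m f) (b : Bool) : LC (m + 1) (Zop b f) := by
  cases b
  · exact h.fT
  · exact h.fp 0
theorem Z_add (b : Bool) {f g : Fam Γ} (hf : Sm f) (hg : Sm g) : Zop b (f + g) = Zop b f + Zop b g := by
  cases b
  · exact fT_add hf hg
  · exact fp_add 0 hf hg
theorem Z_mul (b : Bool) {f g : Fam Γ} (hf : Sm f) (hg : Sm g) :
    Zop b (f * g) = Zop b f * g + f * Zop b g := by
  cases b
  · exact fT_mul hf hg
  · exact fp_mul 0 hf hg
theorem Z_zero (b : Bool) : Zop b (0 : Fam Γ) = 0 := by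
  cases b
  · exact fT_zero
  · exact fp_zero 0
theorem Z_eF (b : Bool) : Zop b (eF : Fam Γ) = 0 := by
  cases b
  · exact fT_eF
  · exact fp_eF 0
theorem Z_e2 (b : Bool) {f : Fam Γ} (hf : Sm f) : Zop b (eF * eF * f) = eF * eF * Zop b f := by
  rw [Z_mul b (Sm.eF.mul Sm.eF) hf, Z_mul b Sm.eF Sm.eF, Z_eF]; ring
theorem Z_fp0 (b : Bool) {f : Fam Γ} (hf : Sm f) : Zop b (fp 0 f) = fp 0 (Zop b f) := by
  cases b
  · exact (fp0_fT hf).symm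
  · rfl
theorem Z_fT (b : Bool) {f : Fam Γ} (hf : Sm f) : Zop b (fT f) = fT (Zop b f) := by
  cases b
  · rfl
  · exact fp0_fT hf
theorem EqC.Z {f g : Fam Γ} (hf : Sm f) (hg : Sm g) (h : EqC f g) (b : Bool) :
    EqC (Zop b f) (Zop b g) := by
  cases b
  · exact h.fT hf hg
  · exact h.fp hf hg 0

/-! Operators. -/
def dv (c v : Fam Γ) : Fam Γ := fp 1 (c * fp 1 v) + fp 2 (c * fp 2 v)
def tg (c : Fin 4 → Fam Γ) (v : Fam Γ) : Fam Γ :=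
  fp 0 (c 1 * fp 0 v + c 2 * fT v) + fT (c 2 * fp 0 v + c 3 * fT v)
def Mop (c : Fin 4 → Fam Γ) (v : Fam Γ) : Fam Γ := dv (c 0) v + eF * eF * tg c v

theorem Sm.dv {c v : Fam Γ} (hc : Sm c) (hv : Sm v) : Sm (dv c v) :=
  ((hc.mul (hv.fp 1)).fp 1).add ((hc.mul (hv.fp 2)).fp 2)
theorem Sm.tg {c : Fin 4 → Fam Γ} {v : Fam Γ} (hc : ∀ i, Sm (c i)) (hv : Sm v) : Sm (tg c v) :=
  ((((hc 1).mul (hv.fp 0)).add ((hc 2).mul hv.fT)).fp 0).add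
    (((hc 2).mul (hv.fp 0)).add ((hc 3).mul hv.fT)).fT
theorem Sm.Mop {c : Fin 4 → Fam Γ} {v : Fam Γ} (hc : ∀ i, Sm (c i)) (hv : Sm v) : Sm (Mop c v) :=
  (Sm.dv (hc 0) hv).add ((Sm.eF.mul Sm.eF).mul (Sm.tg hc hv))

theorem Z_dv (b : Bool) {c v : Fam Γ} (hc : Sm c) (hv : Sm v) :
    Zop b (dv c v) = dv c (Zop b v) + dv (Zop b c) v := by
  have m1 := hc.mul (hv.fp 1)
  have m2 := hc.mul (hv.fp 2)
  cases b
  · show fT (dv c v) = dv c (fT v) + dv (fT c) v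
    unfold dv
    have T : ∀ {f : Fam Γ}, Sm f → fT (fp 1 f) = fp 1 (fT f) - fp 2 f ∧
        fT (fp 2 f) = fp 2 (fT f) + fp 1 f := by
      intro f hf
      rw [fp1_fT hf, fp2_fT hf]
      exact ⟨by ring, by ring⟩
    have e1 : fT (c * fp 1 v) = fT c * fp 1 v + c * fp 1 (fT v) - c * fp 2 v := by
      rw [fT_mul hc (hv.fp 1), (T hv).1]; ring
    have e2 : fT (c * fp 2 v) = fT c * fp 2 v + c * fp 2 (fT v) + c * fp 1 v := by
      rw [fT_mul hc (hv.fp 2), (T hv).2]; ring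
    have t1 := hc.fT.mul (hv.fp 1)
    have t2 := hc.fT.mul (hv.fp 2)
    have q1 := hc.mul (hv.fT.fp 1)
    have q2 := hc.mul (hv.fT.fp 2)
    rw [fT_add (m1.fp 1) (m2.fp 2), (T m1).1, (T m2).2, e1, e2, fp_sub 1 (t1.add q1) m2,
      fp_add 1 t1 q1, fp_add 2 (t2.add q2) m1, fp_add 2 t2 q2]
    ring
  · show fp 0 (dv c v) = dv c (fp 0 v) + dv (fp 0 c) v
    unfold dv
    rw [fp_add 0 (m1.fp 1) (m2.fp 2), fp_comm 0 1 m1, fp_comm 0 2 m2, fp_mul 0 hc (hv.fp 1),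
      fp_mul 0 hc (hv.fp 2), fp_add 1 ((hc.fp 0).mul (hv.fp 1)) (hc.mul ((hv.fp 1).fp 0)),
      fp_add 2 ((hc.fp 0).mul (hv.fp 2)) (hc.mul ((hv.fp 2).fp 0)), fp_comm 0 1 hv, fp_comm 0 2 hv]
    ring

theorem Z_tg (b : Bool) {c : Fin 4 → Fam Γ} {v : Fam Γ} (hc : ∀ i, Sm (c i)) (hv : Sm v) :
    Zop b (tg c v) = tg c (Zop b v) + tg (fun i => Zop b (c i)) v := by
  unfold tg
  have h0 := hv.fp 0
  have hT := hv.fT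
  have hz := hv.Z b
  have key : ∀ i j, Zop b (c i * fp 0 v + c j * fT v) =
      (c i * fp 0 (Zop b v) + c j * fT (Zop b v)) + (Zop b (c i) * fp 0 v + Zop b (c j) * fT v) := by
    intro i j
    rw [Z_add b ((hc i).mul h0) ((hc j).mul hT), Z_mul b (hc i) h0, Z_mul b (hc j) hT, Z_fp0 b hv,
      Z_fT b hv]
    ring
  have s : ∀ i j, Sm (c i * fp 0 v + c j * fT v) := fun i j => ((hc i).mul h0).add ((hc j).mul hT)
  have s1 : ∀ i j, Sm (c i * fp 0 (Zop b v) + c j * fT (Zop b v)) := fun i j =>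
    ((hc i).mul (hz.fp 0)).add ((hc j).mul hz.fT)
  have s2 : ∀ i j, Sm (Zop b (c i) * fp 0 v + Zop b (c j) * fT v) := fun i j =>
    (((hc i).Z b).mul h0).add (((hc j).Z b).mul hT)
  rw [Z_add b ((s 1 2).fp 0) (s 2 3).fT, Z_fp0 b (s 1 2), Z_fT b (s 2 3), key, key,
    fp_add 0 (s1 1 2) (s2 1 2), fT_add (s1 2 3) (s2 2 3)]
  ring

theorem Z_Mop (b : Bool) {c : Fin 4 → Fam Γ} {v : Fam Γ} (hc : ∀ i, Sm (c i)) (hv : Sm v) :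
    Zop b (Mop c v) = Mop c (Zop b v) + Mop (fun i => Zop b (c i)) v := by
  unfold Mop
  rw [Z_add b (Sm.dv (hc 0) hv) ((Sm.eF.mul Sm.eF).mul (Sm.tg hc hv)), Z_dv b (hc 0) hv,
    Z_e2 b (Sm.tg hc hv), Z_tg b hc hv]
  ring

theorem Mop_neg {c : Fin 4 → Fam Γ} {v : Fam Γ} : Mop (fun i => - c i) v = - Mop c v := by
  unfold Mop dv tg
  have h : ∀ f g x y : Fam Γ, -f * x + -g * y = -(f * x + g * y) := fun f g x y => by ring
  rw [h, h, neg_mul, neg_mul, fp_neg, fp_neg, fp_neg]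
  have : ∀ f : Fam Γ, fT (-f) = - fT f := fun f => by rw [fT_eq, fT_eq, fp_neg, fp_neg]; ring
  rw [this]; ring

/-! Admissible families. -/
structure Adm (v : Fam Γ) : Prop where
  sm : Sm v
  per : ∀ d, PerA Γ.ℓ (v d)
  neu : ∀ d (p : P3), p.2.1 ^ 2 + p.2.2 ^ 2 = 1 → (Y1 * fp 1 v + Y2 * fp 2 v : Fam Γ) d p = 0

theorem Adm.fp0 {v : Fam Γ} (h : Adm v) : Adm (fp 0 v) := by
  refine ⟨h.sm.fp 0, fun d => (h.per d).pdi 0, fun d p hp => ?_⟩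
  have s : Sm (Y1 * fp 1 v + Y2 * fp 2 v) := (Sm.y1.mul (h.sm.fp 1)).add (Sm.y2.mul (h.sm.fp 2))
  have e : Y1 * fp 1 (fp 0 v) + Y2 * fp 2 (fp 0 v) = fp 0 (Y1 * fp 1 v + Y2 * fp 2 v) := by
    rw [fp_add 0 (Sm.y1.mul (h.sm.fp 1)) (Sm.y2.mul (h.sm.fp 2)), fp_mul 0 Sm.y1 (h.sm.fp 1),
      fp_mul 0 Sm.y2 (h.sm.fp 2), fp0_y1, fp0_y2, fp_comm 0 1 h.sm, fp_comm 0 2 h.sm]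
    ring
  rw [e]
  have h1 := slice_hasDeriv (s d) p.1 p.2
  have h2 : (fun α : ℝ => (Y1 * fp 1 v + Y2 * fp 2 v : Fam Γ) d (α, p.2)) = fun _ => 0 :=
    funext fun α => h.neu d (α, p.2) hp
  rw [h2] at h1
  exact h1.unique (hasDerivAt_const _ _)

theorem pT_zero_bdry {f : P3 → ℝ} (hf : ContDiff ℝ ∞ f)
    (h : ∀ p : P3, p.2.1 ^ 2 + p.2.2 ^ 2 = 1 → f p = 0) (p : P3) (hp : p.2.1 ^ 2 + p.2.2 ^ 2 = 1) :
    pT f p = 0 := by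
  have c1 : HasDerivAt (fun t : ℝ => ((p.2.1 * cos t - p.2.2 * sin t, p.2.1 * sin t + p.2.2 * cos t) : ℝ × ℝ))
      ((-p.2.2, p.2.1) : ℝ × ℝ) 0 := by
    have a := ((hasDerivAt_cos 0).const_mul p.2.1).sub ((hasDerivAt_sin 0).const_mul p.2.2)
    have b := ((hasDerivAt_sin 0).const_mul p.2.1).add ((hasDerivAt_cos 0).const_mul p.2.2)
    have := a.prodMk b
    simpa using this
  have h1 := slice_hasFDeriv hf p.1 p.2
  have h1' : HasFDerivAt (fun y : ℝ × ℝ => f (p.1, y)) ((pdi 1 f (p.1, p.2)) • ContinuousLinearMap.fst ℝ ℝ ℝ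
        + (pdi 2 f (p.1, p.2)) • ContinuousLinearMap.snd ℝ ℝ ℝ)
      ((p.2.1 * cos 0 - p.2.2 * sin 0, p.2.1 * sin 0 + p.2.2 * cos 0) : ℝ × ℝ) := by simpa using h1
  have h2 := h1'.comp_hasDerivAt (0:ℝ) c1
  have h3 : ((fun y : ℝ × ℝ => f (p.1, y)) ∘ fun t : ℝ => ((p.2.1 * cos t - p.2.2 * sin t, p.2.1 * sin t + p.2.2 * cos t) : ℝ × ℝ))
      = fun _ => 0 := by
    funext t
    apply h
    show (p.2.1 * cos t - p.2.2 * sin t) ^ 2 + (p.2.1 * sin t + p.2.2 * cos t) ^ 2 = 1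
    nlinarith [sin_sq_add_cos_sq t]
  rw [h3] at h2
  have := h2.unique (hasDerivAt_const _ _)
  simp at this
  unfold pT
  linarith

theorem Adm.fT {v : Fam Γ} (h : Adm v) : Adm (fT v) := by
  refine ⟨h.sm.fT, fun d => (h.per d).pT, fun d p hp => ?_⟩
  have s : Sm (Y1 * fp 1 v + Y2 * fp 2 v) := (Sm.y1.mul (h.sm.fp 1)).add (Sm.y2.mul (h.sm.fp 2))
  have ty1 : _root_.fT (Y1 : Fam Γ) = - Y2 := by rw [fT_eq, fp1_y1, fp2_y1]; ring
  have ty2 : _root_.fT (Y2 : Fam Γ) = Y1 := by rw [fT_eq, fp1_y2, fp2_y2]; ring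
  have e : Y1 * fp 1 (_root_.fT v) + Y2 * fp 2 (_root_.fT v) = _root_.fT (Y1 * fp 1 v + Y2 * fp 2 v) := by
    rw [fT_add (Sm.y1.mul (h.sm.fp 1)) (Sm.y2.mul (h.sm.fp 2)), fT_mul Sm.y1 (h.sm.fp 1),
      fT_mul Sm.y2 (h.sm.fp 2), ty1, ty2, fp1_fT h.sm, fp2_fT h.sm]
    ring
  rw [e]
  exact pT_zero_bdry (s d) (h.neu d) p hp

theorem Adm.Z {v : Fam Γ} (h : Adm v) (b : Bool) : Adm (Zop b v) := by
  cases b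
  · exact h.fT
  · exact h.fp0
theorem Adm.ZZ {v : Fam Γ} (h : Adm v) (w : List Bool) : Adm (ZZ w v) := by
  induction w with
  | nil => exact h
  | cons b w ih => exact ih.Z b

def U : Fam Γ := fun d => d.u
def FF : Fam Γ := a0 * fun d => d.ρ
theorem admU : Adm (U : Fam Γ) := ⟨fun d => d.su, fun d => d.pu, fun d p hp => d.neu p hp⟩
theorem lcF (w : List Bool) : LC w.length (ZZ w (FF : Fam Γ)) := by
  induction w with
  | nil => exact LC.mk 0 a0 [] Cf.a0 le_rfl
  | cons b w ih => exact ih.Z b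

def aC : Fin 4 → Fam Γ := ![a0, a1, a2, a3]
theorem Cf.aC (i : Fin 4) : Cf (aC i : Fam Γ) := by
  fin_cases i
  · exact Cf.a0
  · exact Cf.a1
  · exact Cf.a2
  · exact Cf.a3

theorem eqU : EqC (Mop aC (U : Fam Γ)) (eF * eF * FF) := by
  intro d p hp
  have := d.eq p hp
  rw [sq] at this
  rw [show (eF * eF * FF : Fam Γ) d p = d.ε * d.ε * (bt Γ d.ε p * d.ρ p) from rfl, ← this]
  unfold mop
  rw [sq]
  rfl

inductive ML : ℕ → Fam Γ → Prop
  | mk (m : ℕ) (c : Fin 4 → Fam Γ) (w : List Bool) (hc : ∀ i, Cf (c i)) (hw : w.length < m) :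
      ML m (Mop c (ZZ w U))
  | add (m : ℕ) (f g : Fam Γ) (hf : ML m f) (hg : ML m g) : ML m (f + g)
  | zero (m : ℕ) : ML m 0

theorem ML.sm {m : ℕ} {f : Fam Γ} (h : ML m f) : Sm f := by
  induction h with
  | mk c w hc hw => exact Sm.Mop (fun i => (hc i).sm) (admU.ZZ w).sm
  | add f g _ _ h1 h2 => exact h1.add h2
  | zero => exact Sm.zero

theorem ML.Z {m : ℕ} {f : Fam Γ} (h : ML m f) (b : Bool) : ML (m + 1) (Zop b f) := by
  induction h with
  | mk c w hc hw =>
    rw [Z_Mop b (fun i => (hc i).sm) (admU.ZZ w).sm]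
    exact ML.add _ _ _ (ML.mk _ c (b :: w) hc (by simp; omega))
      (ML.mk _ _ w (fun i => (hc i).Z b) (by omega))
  | add f g hf hg h1 h2 => rw [Z_add b hf.sm hg.sm]; exact ML.add _ _ _ h1 h2
  | zero => rw [Z_zero]; exact ML.zero _

theorem eqW (w : List Bool) : ∃ g : Fam Γ, ML w.length g ∧
    EqC (Mop aC (ZZ w U)) (eF * eF * ZZ w FF + g) := by
  induction w with
  | nil => exact ⟨0, ML.zero _, by rw [add_zero]; exact eqU⟩
  | cons b w ih =>
    obtain ⟨g, hg, h⟩ := ih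
    have sv := (admU (Γ := Γ)).ZZ w |>.sm
    have sF := (lcF (Γ := Γ) w).sm
    refine ⟨Zop b g + Mop (fun i => - Zop b (aC i)) (ZZ w U), ML.add _ _ _ (hg.Z b)
      (ML.mk _ _ w (fun i => ((Cf.aC i).Z b).neg) (by simp)), ?_⟩
    have h2 := h.Z (Sm.Mop (fun i => (Cf.aC i).sm) sv) (((Sm.eF.mul Sm.eF).mul sF).add hg.sm) b
    rw [Z_Mop b (fun i => (Cf.aC i).sm) sv, Z_add b ((Sm.eF.mul Sm.eF).mul sF) hg.sm, Z_e2 b sF] at h2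
    rw [Mop_neg]
    intro d p hp
    have := h2 d p hp
    simp only [Pi.add_apply, Pi.mul_apply, Pi.neg_apply, ZZ, List.foldr_cons] at this ⊢
    linarith

end

section
open scoped ContDiff
variable {Γ : FramedCurve}

/-! Energy estimates. -/
def En (v : Fam Γ) (d : Dat Γ) : ℝ :=
  NN Γ.ℓ (fp 1 v d) + NN Γ.ℓ (fp 2 v d) + d.ε * NN Γ.ℓ (fp 0 v d)

def IF (f : Fam Γ) (d : Dat Γ) : ℝ := II Γ.ℓ (f d)

theorem IF_add {f g : Fam Γ} (hf : Sm f) (hg : Sm g) (d : Dat Γ) : IF (f + g) d = IF f d + IF g d :=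
  II_add (hf d).continuous (hg d).continuous
theorem IF_sub {f g : Fam Γ} (hf : Sm f) (hg : Sm g) (d : Dat Γ) : IF (f - g) d = IF f d - IF g d :=
  II_sub (hf d).continuous (hg d).continuous
theorem IF_CS {f g : Fam Γ} (hf : Sm f) (hg : Sm g) (d : Dat Γ) :
    |IF (f * g) d| ≤ NN Γ.ℓ (f d) * NN Γ.ℓ (g d) :=
  NN_CS (hf d).continuous (hg d).continuous
theorem IF_e2 {f : Fam Γ} (d : Dat Γ) : IF (eF * eF * f) d = d.ε ^ 2 * IF f d := by
  rw [sq]; exact II_const_mul (d.ε * d.ε)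

theorem En_nonneg (v : Fam Γ) (d : Dat Γ) : 0 ≤ En v d := by
  have := NN_nonneg Γ.ℓ (fp 1 v d)
  have := NN_nonneg Γ.ℓ (fp 2 v d)
  have := mul_nonneg d.hε.le (NN_nonneg Γ.ℓ (fp 0 v d))
  unfold En; linarith

theorem abs_y1_le {p : P3} (hp : p ∈ domC) : |p.2.1| ≤ 1 := by
  have h : p.2.1 ^ 2 + p.2.2 ^ 2 ≤ 1 := hp
  rw [abs_le]; constructor <;> nlinarith [sq_nonneg p.2.2]
theorem abs_y2_le {p : P3} (hp : p ∈ domC) : |p.2.2| ≤ 1 := by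
  have h : p.2.1 ^ 2 + p.2.2 ^ 2 ≤ 1 := hp
  rw [abs_le]; constructor <;> nlinarith [sq_nonneg p.2.1]

theorem NN_fT_le {v : Fam Γ} (hv : Sm v) (d : Dat Γ) :
    NN Γ.ℓ (fT v d) ≤ NN Γ.ℓ (fp 1 v d) + NN Γ.ℓ (fp 2 v d) := by
  have h1 := NN_mul_le (ℓ := Γ.ℓ) (Sm.y1 d).continuous ((hv.fp 2) d).continuous zero_le_one
    (fun p hp => abs_y1_le hp)
  have h2 := NN_mul_le (ℓ := Γ.ℓ) (Sm.y2 d).continuous ((hv.fp 1) d).continuous zero_le_one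
    (fun p hp => abs_y2_le hp)
  have h3 := NN_sub (ℓ := Γ.ℓ) ((Sm.y1.mul (hv.fp 2)) d).continuous ((Sm.y2.mul (hv.fp 1)) d).continuous
  have h4 : NN Γ.ℓ (fT v d) ≤ _ := h3
  refine h4.trans ?_
  have : NN Γ.ℓ ((Y1 * fp 2 v : Fam Γ) d) ≤ _ := h1
  have : NN Γ.ℓ ((Y2 * fp 1 v : Fam Γ) d) ≤ _ := h2
  linarith

theorem NN_eF {f : Fam Γ} (d : Dat Γ) : NN Γ.ℓ ((eF * f : Fam Γ) d) = d.ε * NN Γ.ℓ (f d) := by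
  have := NN_const_mul (ℓ := Γ.ℓ) (f := f d) d.ε
  rw [abs_of_pos d.hε] at this
  exact this

theorem En1 (v : Fam Γ) (d : Dat Γ) : NN Γ.ℓ (fp 1 v d) ≤ En v d := by
  have := NN_nonneg Γ.ℓ (fp 2 v d)
  have := mul_nonneg d.hε.le (NN_nonneg Γ.ℓ (fp 0 v d))
  unfold En; linarith
theorem En2 (v : Fam Γ) (d : Dat Γ) : NN Γ.ℓ (fp 2 v d) ≤ En v d := by
  have := NN_nonneg Γ.ℓ (fp 1 v d)
  have := mul_nonneg d.hε.le (NN_nonneg Γ.ℓ (fp 0 v d))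
  unfold En; linarith
theorem EnZ {v : Fam Γ} (hv : Sm v) (b : Bool) (d : Dat Γ) :
    d.ε * NN Γ.ℓ (Zop b v d) ≤ En v d := by
  have h1 := NN_nonneg Γ.ℓ (fp 1 v d)
  have h2 := NN_nonneg Γ.ℓ (fp 2 v d)
  have h0 := mul_nonneg d.hε.le (NN_nonneg Γ.ℓ (fp 0 v d))
  cases b
  · have h := NN_fT_le hv d
    have h3 : d.ε * NN Γ.ℓ (fT v d) ≤ 1 * (NN Γ.ℓ (fp 1 v d) + NN Γ.ℓ (fp 2 v d)) :=
      mul_le_mul d.hε1 h (NN_nonneg _ _) zero_le_one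
    show d.ε * NN Γ.ℓ (fT v d) ≤ _
    unfold En; linarith
  · show d.ε * NN Γ.ℓ (fp 0 v d) ≤ _
    unfold En; linarith
theorem EnZ' {v : Fam Γ} (hv : Sm v) (b : Bool) (d : Dat Γ) :
    NN Γ.ℓ ((eF * Zop b v : Fam Γ) d) ≤ En v d := by
  rw [NN_eF]; exact EnZ hv b d

theorem tri {c f g : Fam Γ} {E E' : Dat Γ → ℝ} (hc : Cf c) (hf : Sm f) (hg : Sm g)
    (h : ∀ d, NN Γ.ℓ (f d) ≤ E d) (h' : ∀ d, NN Γ.ℓ (g d) ≤ E' d) :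
    ∃ K : ℝ, 0 ≤ K ∧ ∀ d, |IF (c * f * g) d| ≤ K * (E d * E' d) := by
  obtain ⟨K, K0, hK⟩ := hc.bdd
  refine ⟨K, K0, fun d => ?_⟩
  have h1 := NN_mul_le (ℓ := Γ.ℓ) (hc.sm d).continuous (hf d).continuous K0 (hK d)
  have h2 := IF_CS (hc.sm.mul hf) hg d
  have h1' : NN Γ.ℓ ((c * f : Fam Γ) d) ≤ K * NN Γ.ℓ (f d) := h1
  have n1 := NN_nonneg Γ.ℓ (f d)
  have n2 := NN_nonneg Γ.ℓ (g d)
  calc _ ≤ _ := h2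
    _ ≤ (K * NN Γ.ℓ (f d)) * NN Γ.ℓ (g d) := by gcongr
    _ ≤ (K * E d) * E' d := by
        have := h d
        have := h' d
        gcongr
        exact mul_nonneg K0 (n1.trans (h d))
    _ = _ := by ring

def Qf (c : Fin 4 → Fam Γ) (v φ : Fam Γ) : Fam Γ :=
  c 0 * fp 1 v * fp 1 φ + c 0 * fp 2 v * fp 2 φ + c 1 * (eF * fp 0 v) * (eF * fp 0 φ)
  + c 2 * (eF * fT v) * (eF * fp 0 φ) + c 2 * (eF * fp 0 v) * (eF * fT φ)
  + c 3 * (eF * fT v) * (eF * fT φ)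

theorem Qf_eq {c : Fin 4 → Fam Γ} (hc : ∀ i, Cf (c i)) {v φ : Fam Γ} (hv : Adm v) (sφ : Sm φ)
    (pφ : ∀ d, PerA Γ.ℓ (φ d)) (d : Dat Γ) : IF (Mop c v * φ) d = - IF (Qf c v φ) d := by
  have sv := hv.sm
  have s0 := (hc 0).sm
  have e2 : Sm (eF * eF : Fam Γ) := Sm.eF.mul Sm.eF
  have m1 := s0.mul (sv.fp 1)
  have m2 := s0.mul (sv.fp 2)
  have q : ∀ i j, Sm (c i * fp 0 v + c j * fT v) := fun i j =>
    ((hc i).sm.mul (sv.fp 0)).add ((hc j).sm.mul sv.fT)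
  have sM : Sm (Mop c v * φ) := (Sm.Mop (fun i => (hc i).sm) sv).mul sφ
  have et : Sm (eF * fT v) := Sm.eF.mul sv.fT
  have e0 : Sm (eF * fp 0 v) := Sm.eF.mul (sv.fp 0)
  have ft : Sm (eF * fT φ) := Sm.eF.mul sφ.fT
  have f0 : Sm (eF * fp 0 φ) := Sm.eF.mul (sφ.fp 0)
  have sQ : Sm (Qf c v φ) := by
    unfold Qf
    exact ((((((m1.mul (sφ.fp 1)).add (m2.mul (sφ.fp 2))).add
      (((hc 1).sm.mul e0).mul f0)).add (((hc 2).sm.mul et).mul f0)).add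
      (((hc 2).sm.mul e0).mul ft)).add (((hc 3).sm.mul et).mul ft))
  have key : Mop c v * φ + Qf c v φ = (fp 1 (c 0 * fp 1 v * φ) + fp 2 (c 0 * fp 2 v * φ))
      + fp 0 (eF * eF * (c 1 * fp 0 v + c 2 * fT v) * φ)
      + fT (eF * eF * (c 2 * fp 0 v + c 3 * fT v) * φ) := by
    have a := Z_e2 true (q 1 2)
    have b := Z_e2 false (q 2 3)
    simp only [Zop] at a b
    rw [fp_mul 1 m1 sφ, fp_mul 2 m2 sφ, fp_mul 0 (e2.mul (q 1 2)) sφ, fT_mul (e2.mul (q 2 3)) sφ,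
      a, b]
    unfold Mop dv tg Qf
    ring
  have i1 : IF (fp 1 (c 0 * fp 1 v * φ) + fp 2 (c 0 * fp 2 v * φ)) d = 0 := by
    apply ibp_y ((m1.mul sφ) d) ((m2.mul sφ) d)
    intro p hp
    have := hv.neu d p hp
    simp only [Pi.add_apply, Pi.mul_apply] at this ⊢
    have h' : p.2.1 * fp 1 v d p + p.2.2 * fp 2 v d p = 0 := this
    linear_combination (c 0 d p * φ d p) * h'
  have i2 : IF (fp 0 (eF * eF * (c 1 * fp 0 v + c 2 * fT v) * φ)) d = 0 := by
    apply ibp_a Γ.hℓ (((e2.mul (q 1 2)).mul sφ) d)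
    refine PerA.mul (PerA.mul (fun _ => rfl) (PerA.add (PerA.mul ((hc 1).per d) ?_) (PerA.mul ((hc 2).per d) ?_))) (pφ d)
    · exact (hv.per d).pdi 0
    · exact (hv.per d).pT
  have i3 : IF (fT (eF * eF * (c 2 * fp 0 v + c 3 * fT v) * φ)) d = 0 :=
    ibp_T (((e2.mul (q 2 3)).mul sφ) d)
  have t1 := ((m1.mul sφ).fp 1).add ((m2.mul sφ).fp 2)
  have t2 := ((e2.mul (q 1 2)).mul sφ).fp 0
  have t3 := ((e2.mul (q 2 3)).mul sφ).fT
  have : IF (Mop c v * φ + Qf c v φ) d = IF _ d := congrArg (fun f => IF f d) key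
  rw [IF_add sM sQ, IF_add (t1.add t2) t3, IF_add t1 t2, i1, i2, i3] at this
  linarith

theorem Qf_bdd {c : Fin 4 → Fam Γ} (hc : ∀ i, Cf (c i)) {v φ : Fam Γ} (hv : Adm v) (sφ : Sm φ)
    (pφ : ∀ d, PerA Γ.ℓ (φ d)) :
    ∃ K : ℝ, 0 ≤ K ∧ ∀ d, |IF (Mop c v * φ) d| ≤ K * (En v d * En φ d) := by
  have sv := hv.sm
  have et : Sm (eF * fT v) := Sm.eF.mul sv.fT
  have e0 : Sm (eF * fp 0 v) := Sm.eF.mul (sv.fp 0)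
  have ft : Sm (eF * fT φ) := Sm.eF.mul sφ.fT
  have f0 : Sm (eF * fp 0 φ) := Sm.eF.mul (sφ.fp 0)
  obtain ⟨K1, k1, h1⟩ := tri (hc 0) (sv.fp 1) (sφ.fp 1) (En1 v) (En1 φ)
  obtain ⟨K2, k2, h2⟩ := tri (hc 0) (sv.fp 2) (sφ.fp 2) (En2 v) (En2 φ)
  obtain ⟨K3, k3, h3⟩ := tri (hc 1) e0 f0 (EnZ' sv true) (EnZ' sφ true)
  obtain ⟨K4, k4, h4⟩ := tri (hc 2) et f0 (EnZ' sv false) (EnZ' sφ true)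
  obtain ⟨K5, k5, h5⟩ := tri (hc 2) e0 ft (EnZ' sv true) (EnZ' sφ false)
  obtain ⟨K6, k6, h6⟩ := tri (hc 3) et ft (EnZ' sv false) (EnZ' sφ false)
  refine ⟨K1 + K2 + K3 + K4 + K5 + K6, by positivity, fun d => ?_⟩
  rw [Qf_eq hc hv sφ pφ, abs_neg]
  unfold Qf
  have s1 := ((hc 0).sm.mul (sv.fp 1)).mul (sφ.fp 1)
  have s2 := ((hc 0).sm.mul (sv.fp 2)).mul (sφ.fp 2)
  have s3 := ((hc 1).sm.mul e0).mul f0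
  have s4 := ((hc 2).sm.mul et).mul f0
  have s5 := ((hc 2).sm.mul e0).mul ft
  have s6 := ((hc 3).sm.mul et).mul ft
  rw [IF_add ((((s1.add s2).add s3).add s4).add s5) s6, IF_add (((s1.add s2).add s3).add s4) s5,
    IF_add ((s1.add s2).add s3) s4, IF_add (s1.add s2) s3, IF_add s1 s2]
  have q1 := abs_le.mp (h1 d)
  have q2 := abs_le.mp (h2 d)
  have q3 := abs_le.mp (h3 d)
  have q4 := abs_le.mp (h4 d)
  have q5 := abs_le.mp (h5 d)
  have q6 := abs_le.mp (h6 d)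
  rw [abs_le]; constructor <;> nlinarith

theorem NN_add_sq_le {a b c : ℝ} : (a + b + c) ^ 2 ≤ 3 * (a ^ 2 + b ^ 2 + c ^ 2) := by
  nlinarith [sq_nonneg (a - b), sq_nonneg (a - c), sq_nonneg (b - c)]

theorem coer {v : Fam Γ} (hv : Adm v) :
    ∃ K : ℝ, 0 ≤ K ∧ ∀ d, En v d ^ 2 ≤ K * |IF (Mop aC v * v) d| := by
  obtain ⟨t, t0, ht⟩ := (Cf.tau (Γ := Γ)).bdd
  obtain ⟨b, b0, hb⟩ := (Cf.a0 (Γ := Γ)).bdd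
  have sv := hv.sm
  let D := 4 * (1 + 4 * t ^ 2) + 2 * b
  have D0 : 0 ≤ D := by positivity
  refine ⟨3 * D, by positivity, fun d => ?_⟩
  rw [Qf_eq Cf.aC hv sv hv.per, abs_neg]
  have sQ : Sm (Qf aC v v) := by
    have et : Sm (eF * fT v) := Sm.eF.mul sv.fT
    have e0 : Sm (eF * fp 0 v) := Sm.eF.mul (sv.fp 0)
    have c := fun i => (Cf.aC (Γ := Γ) i).sm
    unfold Qf
    exact (((((((c 0).mul (sv.fp 1)).mul (sv.fp 1)).add (((c 0).mul (sv.fp 2)).mul (sv.fp 2))).add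
      (((c 1).mul e0).mul e0)).add (((c 2).mul et).mul e0)).add
      (((c 2).mul e0).mul et)).add (((c 3).mul et).mul et)
  have c1 := ((sv.fp 1) d).continuous
  have c2 := ((sv.fp 2) d).continuous
  have c0 := ((sv.fp 0) d).continuous
  have k1 : Continuous (fun p => fp 1 v d p ^ 2) := c1.pow 2
  have k2 : Continuous (fun p => fp 2 v d p ^ 2) := c2.pow 2
  have k0 : Continuous (fun p => d.ε ^ 2 * fp 0 v d p ^ 2) := continuous_const.mul (c0.pow 2)
  have k12 : Continuous (fun p => fp 1 v d p ^ 2 + fp 2 v d p ^ 2) := k1.add k2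
  have main : NN Γ.ℓ (fp 1 v d) ^ 2 + NN Γ.ℓ (fp 2 v d) ^ 2 + (d.ε * NN Γ.ℓ (fp 0 v d)) ^ 2
      ≤ D * IF (Qf aC v v) d := by
    rw [mul_pow, NN_sq, NN_sq, NN_sq, ← II_const_mul, ← II_add k1 k2, ← II_add k12 k0]
    unfold IF
    rw [← II_const_mul]
    apply II_mono (k12.add k0)
      (continuous_const.mul (sQ d).continuous)
    intro p hp
    have hB := bt_ge Γ d.ε p
    have hBb : bt Γ d.ε p ≤ b := (le_abs_self _).trans (hb d p hp)
    have htp : |Γ.τ p.1| ≤ t := ht d p hp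
    have htt : Γ.τ p.1 ^ 2 ≤ t ^ 2 := by rw [← sq_abs]; gcongr
    set B := bt Γ d.ε p with hBdef
    set x := fp 1 v d p with hx
    set y := fp 2 v d p with hy
    set z := fp 0 v d p with hz
    set T := fT v d p with hT
    set e := d.ε with he
    set τ := Γ.τ p.1 with hτ
    have hTT : T ^ 2 ≤ x ^ 2 + y ^ 2 := by
      have h : p.2.1 ^ 2 + p.2.2 ^ 2 ≤ 1 := hp
      have e : T = p.2.1 * y - p.2.2 * x := rfl
      rw [e]
      nlinarith [sq_nonneg (p.2.1 * x + p.2.2 * y), sq_nonneg x, sq_nonneg y]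
    have hQ : Qf aC v v d p = B * (x ^ 2 + y ^ 2) + e ^ 2 * (B⁻¹ * (z - τ * T) ^ 2) := by
      show B * x * x + B * y * y + B⁻¹ * (e * z) * (e * z) + (-τ * B⁻¹) * (e * T) * (e * z)
        + (-τ * B⁻¹) * (e * z) * (e * T) + (τ ^ 2 * B⁻¹) * (e * T) * (e * T) = _
      ring
    show x ^ 2 + y ^ 2 + e ^ 2 * z ^ 2 ≤ D * Qf aC v v d p
    rw [hQ]
    have hBi : b⁻¹ ≤ B⁻¹ := inv_anti₀ (by linarith) hBb
    have e1 : e ^ 2 ≤ 1 := by have := d.hε; have := d.hε1; nlinarith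
    have hb1 : b * B⁻¹ ≥ 1 := by
      have : 0 < B := by linarith
      rw [ge_iff_le, ← div_eq_mul_inv, one_le_div this]; exact hBb
    have hz2 : z ^ 2 ≤ 2 * (z - τ * T) ^ 2 + 2 * (τ ^ 2 * T ^ 2) := by nlinarith [sq_nonneg (z - 2 * (τ * T))]
    have hh : τ ^ 2 * T ^ 2 ≤ t ^ 2 * (x ^ 2 + y ^ 2) := by
      apply mul_le_mul htt hTT (sq_nonneg _) (sq_nonneg _)
    set w := (z - τ * T) ^ 2 with hw
    have w0 : 0 ≤ w := sq_nonneg _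
    set s := x ^ 2 + y ^ 2 with hs
    have s0 : 0 ≤ s := by positivity
    have A1 : e ^ 2 * z ^ 2 ≤ e ^ 2 * (2 * w) + 2 * (t ^ 2 * s) := by
      calc e ^ 2 * z ^ 2 ≤ e ^ 2 * (2 * w + 2 * (t ^ 2 * s)) := by gcongr; linarith
        _ ≤ _ := by nlinarith [mul_nonneg (sq_nonneg t) s0]
    have A2 : e ^ 2 * (2 * w) ≤ 2 * b * (e ^ 2 * (B⁻¹ * w)) := by
      have := mul_nonneg (sq_nonneg e) w0
      nlinarith
    have A3 : s + 2 * (t ^ 2 * s) ≤ 4 * (1 + 4 * t ^ 2) * (B * s) := by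
      have := mul_nonneg (sq_nonneg t) s0
      nlinarith [mul_nonneg (sub_nonneg.mpr hB) s0, mul_nonneg (sub_nonneg.mpr hB) this]
    have A4 : 0 ≤ B * s := mul_nonneg (by linarith) s0
    have A5 : 0 ≤ e ^ 2 * (B⁻¹ * w) := by
      have : 0 < B := by linarith
      positivity
    show s + e ^ 2 * z ^ 2 ≤ D * (B * s + e ^ 2 * (B⁻¹ * w))
    have : 0 ≤ 4 * (1 + 4 * t ^ 2) * (e ^ 2 * (B⁻¹ * w)) := by positivity
    have : 0 ≤ 2 * b * (B * s) := by positivity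
    show s + e ^ 2 * z ^ 2 ≤ (4 * (1 + 4 * t ^ 2) + 2 * b) * (B * s + e ^ 2 * (B⁻¹ * w))
    linarith
  calc En v d ^ 2 ≤ _ := NN_add_sq_le
    _ ≤ 3 * (D * IF (Qf aC v v) d) := by gcongr
    _ ≤ 3 * D * |IF (Qf aC v v) d| := by rw [mul_assoc]; gcongr; exact le_abs_self _

theorem En_close {v : Fam Γ} (hv : Adm v) {S : Dat Γ → ℝ} (S0 : ∀ d, 0 ≤ S d)
    (h : ∃ C : ℝ, 0 ≤ C ∧ ∀ d, |IF (Mop aC v * v) d| ≤ C * (S d * En v d)) :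
    ∃ C : ℝ, 0 ≤ C ∧ ∀ d, En v d ≤ C * S d := by
  obtain ⟨C, C0, h⟩ := h
  obtain ⟨K, K0, hK⟩ := coer hv
  refine ⟨K * C, by positivity, fun d => ?_⟩
  have h1 := hK d
  have h2 := mul_le_mul_of_nonneg_left (h d) K0
  have h3 := En_nonneg v d
  by_contra hh
  push Not at hh
  have : 0 ≤ K * C * S d := mul_nonneg (by positivity) (S0 d)
  have h4 : 0 < En v d := by linarith
  nlinarith

end

section
open scoped ContDiff
variable {Γ : FramedCurve}

def EnB (v : Fam Γ) (S : Dat Γ → ℝ) : Prop := ∃ C : ℝ, 0 ≤ C ∧ ∀ d, En v d ≤ C * S d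

theorem ZZ_per {f : Fam Γ} (h : ∀ d, PerA Γ.ℓ (f d)) (w : List Bool) : ∀ d, PerA Γ.ℓ (ZZ w f d) := by
  induction w with
  | nil => exact h
  | cons b w ih =>
    intro d
    cases b
    · exact (ih d).pT
    · exact (ih d).pdi 0

theorem FF_per (d : Dat Γ) : PerA Γ.ℓ ((FF : Fam Γ) d) := (Cf.a0.per d).mul d.pρ

theorem ibp_Z {f g : Fam Γ} (hf : Sm f) (hg : Sm g) (pf : ∀ d, PerA Γ.ℓ (f d))
    (pg : ∀ d, PerA Γ.ℓ (g d)) (b : Bool) (d : Dat Γ) : IF (Zop b f * g) d = - IF (f * Zop b g) d := by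
  have h : IF (Zop b (f * g)) d = 0 := by
    cases b
    · exact ibp_T ((hf.mul hg) d)
    · exact ibp_a Γ.hℓ ((hf.mul hg) d) ((pf d).mul (pg d))
  rw [Z_mul b hf hg, IF_add ((hf.Z b).mul hg) (hf.mul (hg.Z b))] at h
  linarith

theorem ML.test {m : ℕ} {g φ : Fam Γ} (hg : ML m g)
    (IH : ∀ w : List Bool, w.length < m → EnB (ZZ w U : Fam Γ) (fun d => d.ε * RR (w.length - 1) d))
    (sφ : Sm φ) (pφ : ∀ d, PerA Γ.ℓ (φ d)) :
    ∃ C : ℝ, 0 ≤ C ∧ ∀ d, |IF (g * φ) d| ≤ C * ((d.ε * RR (m - 1) d) * En φ d) := by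
  induction hg with
  | mk c w hc hw =>
    obtain ⟨K, K0, hK⟩ := Qf_bdd hc (admU.ZZ w) sφ pφ
    obtain ⟨C, C0, hC⟩ := IH w hw
    refine ⟨K * C, by positivity, fun d => (hK d).trans ?_⟩
    have h1 := En_nonneg φ d
    have h2 := RR_mono (show w.length - 1 ≤ m - 1 by omega) d
    have h3 := d.hε
    calc K * (En (ZZ w U) d * En φ d) ≤ K * ((C * (d.ε * RR (w.length - 1) d)) * En φ d) := by
          gcongr; exact hC d
      _ ≤ K * ((C * (d.ε * RR (m - 1) d)) * En φ d) := by gcongr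
      _ = _ := by ring
  | add f g hf hg h1 h2 =>
    obtain ⟨C, C0, hC⟩ := h1
    obtain ⟨D, D0, hD⟩ := h2
    refine ⟨C + D, by positivity, fun d => ?_⟩
    rw [add_mul, IF_add (hf.sm.mul sφ) (hg.sm.mul sφ)]
    refine (abs_add_le _ _).trans ?_
    rw [add_mul]
    exact add_le_add (hC d) (hD d)
  | zero =>
    refine ⟨0, le_rfl, fun d => ?_⟩
    have : IF (0 * φ : Fam Γ) d = 0 := by
      rw [zero_mul]; simp [IF, II]
    rw [this]; simp

theorem IF_congr {f g : Fam Γ} (h : EqC f g) (d : Dat Γ) : IF f d = IF g d := II_congr (h d)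

theorem EqC.mul_right {f g : Fam Γ} (h : EqC f g) (φ : Fam Γ) : EqC (f * φ) (g * φ) := by
  intro d p hp
  show f d p * φ d p = g d p * φ d p
  rw [h d p hp]

theorem T_est (n : ℕ) : ∀ w : List Bool, w.length = n →
    EnB (ZZ w U : Fam Γ) (fun d => d.ε * RR (w.length - 1) d) := by
  induction n using Nat.strong_induction_on with
  | _ n ih =>
  intro w hw
  have hv := (admU (Γ := Γ)).ZZ w
  have S0 : ∀ d : Dat Γ, 0 ≤ d.ε * RR (w.length - 1) d := fun d => mul_nonneg d.hε.le (RR_nonneg _ _)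
  apply En_close hv S0
  obtain ⟨g, hg, he⟩ := eqW (Γ := Γ) w
  obtain ⟨C, C0, hC⟩ := hg.test (fun w' h' => ih _ (hw ▸ h') w' rfl) hv.sm hv.per
  have sF := (lcF (Γ := Γ) w).sm
  have key : ∃ D : ℝ, 0 ≤ D ∧ ∀ d : Dat Γ, |IF (eF * eF * (ZZ w FF * ZZ w U)) d| ≤
      D * ((d.ε * RR (w.length - 1) d) * En (ZZ w U) d) := by
    cases w with
    | nil =>
      obtain ⟨-, D, D0, hD⟩ := (lcF (Γ := Γ) []).bd0
      refine ⟨D * (4 + Γ.ℓ), mul_nonneg D0 (by linarith [Γ.hℓ]), fun d => ?_⟩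
      rw [IF_e2, abs_mul, abs_of_nonneg (sq_nonneg _)]
      have h1 := IF_CS sF hv.sm d
      have h2 := poincare_full Γ.hℓ d.su d.mean
      have h3 : d.ε * NN Γ.ℓ (ZZ [] U d) ≤ (4 + Γ.ℓ) * En (ZZ [] U) d := by
        have e1 := NN_nonneg Γ.ℓ (pdi 1 d.u)
        have e2 := NN_nonneg Γ.ℓ (pdi 2 d.u)
        have e0 := NN_nonneg Γ.ℓ (pdi 0 d.u)
        have hl := Γ.hℓ
        have h := d.hε
        have h' := d.hε1
        show d.ε * NN Γ.ℓ d.u ≤ (4 + Γ.ℓ) * (NN Γ.ℓ (pdi 1 d.u) + NN Γ.ℓ (pdi 2 d.u) + d.ε * NN Γ.ℓ (pdi 0 d.u))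
        calc d.ε * NN Γ.ℓ d.u ≤ d.ε * (4 * (NN Γ.ℓ (pdi 1 d.u) + NN Γ.ℓ (pdi 2 d.u)) + Γ.ℓ * NN Γ.ℓ (pdi 0 d.u)) := by gcongr
          _ = 4 * (d.ε * (NN Γ.ℓ (pdi 1 d.u) + NN Γ.ℓ (pdi 2 d.u))) + Γ.ℓ * (d.ε * NN Γ.ℓ (pdi 0 d.u)) := by ring
          _ ≤ 4 * (1 * (NN Γ.ℓ (pdi 1 d.u) + NN Γ.ℓ (pdi 2 d.u))) + Γ.ℓ * (d.ε * NN Γ.ℓ (pdi 0 d.u)) := by gcongr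
          _ ≤ _ := by
            have : 0 ≤ Γ.ℓ * (NN Γ.ℓ (pdi 1 d.u) + NN Γ.ℓ (pdi 2 d.u)) := by positivity
            have : 0 ≤ 4 * (d.ε * NN Γ.ℓ (pdi 0 d.u)) := by positivity
            linarith
      have h4 := hD d
      have n1 := NN_nonneg Γ.ℓ (ZZ [] FF d)
      have n2 := NN_nonneg Γ.ℓ (ZZ [] U d)
      have n3 := d.hε
      have n4 := RR_nonneg 0 d
      calc d.ε ^ 2 * |IF (ZZ [] FF * ZZ [] U) d| ≤ d.ε ^ 2 * ((D * RR 0 d) * NN Γ.ℓ (ZZ [] U d)) := by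
            gcongr
            exact h1.trans (by gcongr; exact h4)
        _ = D * (d.ε * RR 0 d) * (d.ε * NN Γ.ℓ (ZZ [] U d)) := by ring
        _ ≤ D * (d.ε * RR 0 d) * ((4 + Γ.ℓ) * En (ZZ [] U) d) := by gcongr
        _ = _ := by simp only [List.length_nil]; ring
    | cons b w' =>
      obtain ⟨-, D, D0, hD⟩ := (lcF (Γ := Γ) w').bd0
      refine ⟨D, D0, fun d => ?_⟩
      have sF' := (lcF (Γ := Γ) w').sm
      rw [IF_e2, abs_mul, abs_of_nonneg (sq_nonneg _)]
      have e : IF (ZZ (b :: w') FF * ZZ (b :: w') U) d = - IF (ZZ w' FF * Zop b (ZZ (b :: w') U)) d :=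
        ibp_Z sF' hv.sm (ZZ_per FF_per w') hv.per b d
      rw [e, abs_neg]
      have h1 := IF_CS sF' (hv.sm.Z b) d
      have h3 := EnZ hv.sm b d
      have h4 := hD d
      have n1 := NN_nonneg Γ.ℓ (ZZ w' FF d)
      have n2 := NN_nonneg Γ.ℓ (Zop b (ZZ (b :: w') U) d)
      have n3 := d.hε
      have n4 := RR_nonneg w'.length d
      calc _ ≤ d.ε ^ 2 * ((D * RR w'.length d) * NN Γ.ℓ (Zop b (ZZ (b :: w') U) d)) := by
            gcongr
            exact h1.trans (by gcongr)
        _ = D * (d.ε * RR w'.length d) * (d.ε * NN Γ.ℓ (Zop b (ZZ (b :: w') U) d)) := by ring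
        _ ≤ D * (d.ε * RR w'.length d) * En (ZZ (b :: w') U) d := by gcongr
        _ = _ := by simp only [List.length_cons, Nat.add_sub_cancel]; ring
  obtain ⟨D, D0, hD⟩ := key
  refine ⟨D + C, by positivity, fun d => ?_⟩
  rw [IF_congr (he.mul_right _), add_mul, mul_assoc,
    IF_add ((Sm.eF.mul Sm.eF).mul (sF.mul hv.sm)) (hg.sm.mul hv.sm), add_mul]
  exact (abs_add_le _ _).trans (add_le_add (hD d) (hC d))

/-- Two tangential derivatives are gained. -/
theorem T_bd (w : List Bool) : Bd 0 (ZZ w U : Fam Γ) (RR (w.length - 2)) := by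
  cases w with
  | nil =>
    obtain ⟨C, C0, hC⟩ := T_est (Γ := Γ) 0 [] rfl
    refine ⟨fun d => d.su, (4 + Γ.ℓ) * C, mul_nonneg (by linarith [Γ.hℓ]) C0, fun d => ?_⟩
    have h := hC d
    have e1 := NN_nonneg Γ.ℓ (pdi 1 d.u)
    have e2 := NN_nonneg Γ.ℓ (pdi 2 d.u)
    have e0 := NN_nonneg Γ.ℓ (pdi 0 d.u)
    have hl := Γ.hℓ
    have p1 := d.hε
    have p2 := d.hε1
    have r := RR_nonneg 0 d
    have h1 : NN Γ.ℓ (pdi 1 d.u) + NN Γ.ℓ (pdi 2 d.u) + d.ε * NN Γ.ℓ (pdi 0 d.u) ≤ C * (d.ε * RR 0 d) := h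
    have h2 := poincare_full Γ.hℓ d.su d.mean
    have h3 : NN Γ.ℓ (pdi 0 d.u) ≤ C * RR 0 d := by
      have : d.ε * NN Γ.ℓ (pdi 0 d.u) ≤ d.ε * (C * RR 0 d) := by linarith
      exact le_of_mul_le_mul_left this p1
    have h4 : NN Γ.ℓ (pdi 1 d.u) + NN Γ.ℓ (pdi 2 d.u) ≤ C * RR 0 d := by
      have : C * (d.ε * RR 0 d) ≤ C * (1 * RR 0 d) := by gcongr
      have : 0 ≤ d.ε * NN Γ.ℓ (pdi 0 d.u) := by positivity
      linarith
    show NN Γ.ℓ d.u ≤ (4 + Γ.ℓ) * C * RR 0 d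
    have := mul_le_mul_of_nonneg_left h3 hl.le
    linarith
  | cons b w =>
    obtain ⟨C, C0, hC⟩ := T_est (Γ := Γ) _ w rfl
    refine ⟨(admU.ZZ _).sm, C, C0, fun d => ?_⟩
    have h := (EnZ (admU.ZZ w).sm b d).trans (hC d)
    have : d.ε * NN Γ.ℓ (Zop b (ZZ w U) d) ≤ d.ε * (C * RR (w.length - 1) d) := by linarith
    exact le_of_mul_le_mul_left this d.hε

end

section
open scoped ContDiff
variable {Γ : FramedCurve}

theorem tg_bd {J : ℕ} {c : Fin 4 → Fam Γ} (hc : ∀ i, Cf (c i)) {v : Fam Γ} {R : Dat Γ → ℝ}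
    (h1 : ∀ b, Bd J (Zop b v) R) (h2 : ∀ b b', Bd J (Zop b (Zop b' v)) R) : Bd J (tg c v) R := by
  have s0 : Sm (fp 0 v) := (h1 true).sm
  have sT : Sm (fT v) := (h1 false).sm
  have key : ∀ b i j, Bd J (Zop b (c i * fp 0 v + c j * fT v)) R := by
    intro b i j
    have e : Zop b (c i * fp 0 v + c j * fT v) = (Zop b (c i) * fp 0 v + c i * Zop b (fp 0 v))
        + (Zop b (c j) * fT v + c j * Zop b (fT v)) := by
      rw [Z_add b ((hc i).sm.mul s0) ((hc j).sm.mul sT)]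
      rw [Z_mul b (hc i).sm s0, Z_mul b (hc j).sm sT]
    rw [e]
    exact ((Bd.coef ((hc i).Z b) (h1 true)).add (Bd.coef (hc i) (h2 b true))).add
      ((Bd.coef ((hc j).Z b) (h1 false)).add (Bd.coef (hc j) (h2 b false)))
  exact (key true 1 2).add (key false 2 3)

theorem dv_eq {c v : Fam Γ} (hc : Sm c) (hv : Sm v) : dv c v =
    (fp 1 c * fp 1 v + fp 2 c * fp 2 v) + c * fL v := by
  unfold dv fL
  rw [fp_mul 1 hc (hv.fp 1), fp_mul 2 hc (hv.fp 2)]; ring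

def Rm (m : ℕ) (d : Dat Γ) : ℝ := d.ε ^ 2 * RR m d

theorem Rm_mono {m n : ℕ} (h : m ≤ n) (d : Dat Γ) : Rm m d ≤ Rm n d :=
  mul_le_mul_of_nonneg_left (RR_mono h d) (sq_nonneg _)

theorem Rm_le (m : ℕ) (d : Dat Γ) : Rm m d ≤ RR m d := by
  have := d.hε; have := d.hε1
  exact mul_le_of_le_one_left (RR_nonneg _ _) (by nlinarith)

theorem ibp_dv {c v φ : Fam Γ} (hc : Sm c) (hv : Adm v) (sφ : Sm φ) (d : Dat Γ) :
    IF (dv c v * φ) d = - IF (c * (fp 1 v * fp 1 φ + fp 2 v * fp 2 φ)) d := by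
  have sv := hv.sm
  have m1 := hc.mul (sv.fp 1)
  have m2 := hc.mul (sv.fp 2)
  have i1 : IF (fp 1 (c * fp 1 v * φ) + fp 2 (c * fp 2 v * φ)) d = 0 := by
    apply ibp_y ((m1.mul sφ) d) ((m2.mul sφ) d)
    intro p hp
    have := hv.neu d p hp
    simp only [Pi.add_apply, Pi.mul_apply] at this ⊢
    have h' : p.2.1 * fp 1 v d p + p.2.2 * fp 2 v d p = 0 := this
    linear_combination (c d p * φ d p) * h'
  have e : fp 1 (c * fp 1 v * φ) + fp 2 (c * fp 2 v * φ) =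
      dv c v * φ + c * (fp 1 v * fp 1 φ + fp 2 v * fp 2 φ) := by
    unfold dv
    rw [fp_mul 1 m1 sφ, fp_mul 2 m2 sφ]; ring
  rw [e, IF_add ((Sm.dv hc sv).mul sφ) (hc.mul (((sv.fp 1).mul (sφ.fp 1)).add ((sv.fp 2).mul (sφ.fp 2))))] at i1
  linarith

theorem close2 {a b k : ℝ} (ha : 0 ≤ a) (hb : 0 ≤ b) (hk : 0 ≤ k) (h : a ^ 2 + b ^ 2 ≤ k * (a + b)) :
    a + b ≤ 2 * k := by
  by_contra hh
  push Not at hh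
  rcases (add_nonneg ha hb).eq_or_lt with h0 | h0
  · have ha0 : a = 0 := by linarith
    have hb0 : b = 0 := by linarith
    linarith
  · nlinarith [sq_nonneg (a - b)]

/-- Gradient bound from the weighted divergence. -/
theorem grad_bd {v : Fam Γ} (hv : Adm v) {R : Dat Γ → ℝ} (h : Bd 0 (dv a0 v) R) :
    Bd 0 (fp 1 v) R ∧ Bd 0 (fp 2 v) R := by
  obtain ⟨sh, C, C0, hC⟩ := h
  have sv := hv.sm
  have sb : Sm (fbar v) := fun d => smooth_bar (sv d)
  have key : ∀ d, NN Γ.ℓ (fp 1 v d) + NN Γ.ℓ (fp 2 v d) ≤ 32 * C * R d := by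
    intro d
    have n1 := NN_nonneg Γ.ℓ (fp 1 v d)
    have n2 := NN_nonneg Γ.ℓ (fp 2 v d)
    have nh := NN_nonneg Γ.ℓ (dv a0 v d)
    have h1 := ibp_dv Cf.a0.sm hv sb d
    rw [fp1_bar sv, fp2_bar sv] at h1
    have h2 := IF_CS sh sb d
    have h3 : NN Γ.ℓ (fbar v d) ≤ 4 * (NN Γ.ℓ (fp 1 v d) + NN Γ.ℓ (fp 2 v d)) := poincare_bar (sv d)
    have h4 : (1 / 4) * (NN Γ.ℓ (fp 1 v d) ^ 2 + NN Γ.ℓ (fp 2 v d) ^ 2) ≤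
        IF (a0 * (fp 1 v * fp 1 v + fp 2 v * fp 2 v)) d := by
      have c1 : Continuous (fun p => fp 1 v d p ^ 2) := ((sv.fp 1) d).continuous.pow 2
      have c2 : Continuous (fun p => fp 2 v d p ^ 2) := ((sv.fp 2) d).continuous.pow 2
      rw [NN_sq, NN_sq, ← II_add c1 c2, ← II_const_mul]
      apply II_mono (continuous_const.mul (c1.add c2)) ((Cf.a0.sm.mul (((sv.fp 1).mul (sv.fp 1)).add ((sv.fp 2).mul (sv.fp 2)))) d).continuous
      intro p hp
      have hB := bt_ge Γ d.ε p
      show 1 / 4 * (fp 1 v d p ^ 2 + fp 2 v d p ^ 2) ≤ bt Γ d.ε p * (fp 1 v d p * fp 1 v d p + fp 2 v d p * fp 2 v d p)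
      rw [← sq, ← sq]
      gcongr
    rw [h1, abs_neg] at h2
    have h5 := (le_abs_self _).trans h2
    have h6 : NN Γ.ℓ (dv a0 v d) * NN Γ.ℓ (fbar v d) ≤ NN Γ.ℓ (dv a0 v d) * (4 * (NN Γ.ℓ (fp 1 v d) + NN Γ.ℓ (fp 2 v d))) := by gcongr
    have := close2 (k := 16 * NN Γ.ℓ (dv a0 v d)) n1 n2 (by linarith) (by linarith)
    have := hC d
    linarith
  have R0 : 0 ≤ 32 * C := by linarith
  refine ⟨⟨sv.fp 1, _, R0, fun d => ?_⟩, ⟨sv.fp 2, _, R0, fun d => ?_⟩⟩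
  · have := key d; have := NN_nonneg Γ.ℓ (fp 2 v d); linarith
  · have := key d; have := NN_nonneg Γ.ℓ (fp 1 v d); linarith

theorem fL_fT {v : Fam Γ} (sv : Sm v) : fL (fT v) = fT (fL v) := by
  unfold fL
  rw [fT_add ((sv.fp 1).fp 1) ((sv.fp 2).fp 2), fp1_fT sv, fp2_fT sv, fp_add 1 (sv.fp 1).fT (sv.fp 2),
    fp_sub 2 (sv.fp 2).fT (sv.fp 1), fp1_fT (sv.fp 1), fp2_fT (sv.fp 2), fp_comm 1 2 sv]
  ring

theorem gradT_bd {v : Fam Γ} (hv : Adm v) {R : Dat Γ → ℝ} (h : Bd 0 (fL v) R) :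
    Bd 0 (fp 1 (fT v)) R ∧ Bd 0 (fp 2 (fT v)) R := by
  obtain ⟨sh, C, C0, hC⟩ := h
  have ht := hv.fT
  have sv := ht.sm
  have key : ∀ d, NN Γ.ℓ (fp 1 (fT v) d) + NN Γ.ℓ (fp 2 (fT v) d) ≤ 2 * C * R d := by
    intro d
    have n1 := NN_nonneg Γ.ℓ (fp 1 (fT v) d)
    have n2 := NN_nonneg Γ.ℓ (fp 2 (fT v) d)
    have h1 := ibp_dv Sm.one ht sv d
    have e : dv 1 (fT v) = fT (fL v) := by
      rw [← fL_fT hv.sm]; unfold dv fL; rw [one_mul, one_mul]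
    have e2 : IF (fT (fL v) * fT v) d = - IF (fL v * fT (fT v)) d := by
      have h : IF (fT (fL v * fT v)) d = 0 := ibp_T ((sh.mul sv) d)
      rw [fT_mul sh sv, IF_add (sh.fT.mul sv) (sh.mul sv.fT)] at h
      linarith
    rw [e, e2, one_mul] at h1
    have h4 : NN Γ.ℓ (fp 1 (fT v) d) ^ 2 + NN Γ.ℓ (fp 2 (fT v) d) ^ 2 =
        IF (fp 1 (fT v) * fp 1 (fT v) + fp 2 (fT v) * fp 2 (fT v)) d := by
      rw [IF_add ((sv.fp 1).mul (sv.fp 1)) ((sv.fp 2).mul (sv.fp 2)), NN_sq, NN_sq]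
      simp only [sq]
      rfl
    have h2 := (le_abs_self _).trans (IF_CS sh sv.fT d)
    have h3 := NN_fT_le sv d
    have nh := NN_nonneg Γ.ℓ (fL v d)
    have h6 : NN Γ.ℓ (fL v d) * NN Γ.ℓ (fT (fT v) d) ≤ NN Γ.ℓ (fL v d) * (NN Γ.ℓ (fp 1 (fT v) d) + NN Γ.ℓ (fp 2 (fT v) d)) := by gcongr
    have := close2 (k := NN Γ.ℓ (fL v d)) n1 n2 (by linarith) (by linarith)
    have := hC d
    linarith
  have R0 : 0 ≤ 2 * C := by linarith
  refine ⟨⟨sv.fp 1, _, R0, fun d => ?_⟩, ⟨sv.fp 2, _, R0, fun d => ?_⟩⟩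
  · have := key d; have := NN_nonneg Γ.ℓ (fp 2 (fT v) d); linarith
  · have := key d; have := NN_nonneg Γ.ℓ (fp 1 (fT v) d); linarith

theorem fL_bd {J : ℕ} {v : Fam Γ} (sv : Sm v) {R : Dat Γ → ℝ} (h : Bd J (dv a0 v) R)
    (h1 : Bd J (fp 1 v) R) (h2 : Bd J (fp 2 v) R) : Bd J (fL v) R := by
  have e : fL v = a1 * (dv a0 v - (fp 1 a0 * fp 1 v + fp 2 a0 * fp 2 v)) := by
    rw [dv_eq Cf.a0.sm sv, add_sub_cancel_left, ← mul_assoc]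
    have : (a1 * a0 : Fam Γ) = 1 := by
      funext d p
      have := bt_ge Γ d.ε p
      exact inv_mul_cancel₀ (show bt Γ d.ε p ≠ 0 by positivity)
    rw [this, one_mul]
  rw [e]
  exact Bd.coef Cf.a1 (h.sub ((Bd.coef (Cf.a0.fp 1) h1).add (Bd.coef (Cf.a0.fp 2) h2)))

def PJ (J : ℕ) (w : List Bool) : Prop :=
  Bd (J + 1) (fp 1 (ZZ w U) : Fam Γ) (Rm (w.length + J)) ∧
  Bd (J + 1) (fp 2 (ZZ w U) : Fam Γ) (Rm (w.length + J))

theorem PJ_intro {J : ℕ} {v : Fam Γ} {R : Dat Γ → ℝ} (h1 : Bd J (fp 1 v) R) (h2 : Bd J (fp 2 v) R)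
    (sv : Sm v)
    (h : Bd J (fp 1 (fp 1 v)) R ∧ Bd J (fp 1 (fp 2 v)) R ∧ Bd J (fp 2 (fp 2 v)) R) :
    Bd (J + 1) (fp 1 v) R ∧ Bd (J + 1) (fp 2 v) R :=
  ⟨⟨h1.zero', h.1, by rw [fp_comm 2 1 sv]; exact h.2.1⟩, ⟨h2.zero', h.2.1, h.2.2⟩⟩

theorem Mop_bd {J m : ℕ} {g : Fam Γ} (hg : ML m g)
    (tan : ∀ w : List Bool, 1 ≤ w.length → Bd J (ZZ w U : Fam Γ) (RR (w.length + J - 2)))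
    (IH : ∀ w : List Bool, w.length < m → PJ (Γ := Γ) J w) : Bd J g (Rm (m + J)) := by
  induction hg with
  | mk c w hc hw =>
    obtain ⟨h1, h2⟩ := IH w hw
    have sv := (admU (Γ := Γ)).ZZ w |>.sm
    have hm : ∀ d : Dat Γ, Rm (w.length + J) d ≤ Rm (m + J) d := Rm_mono (by omega)
    have t : Bd J (tg c (ZZ w U)) (RR (m + J)) := by
      apply tg_bd hc
      · intro b
        exact (tan (b :: w) (by simp)).mono (RR_mono (by simp; omega))
      · intro b b'
        exact (tan (b :: b' :: w) (by simp)).mono (RR_mono (by simp; omega))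
    have a : Bd J (dv (c 0) (ZZ w U)) (Rm (m + J)) := by
      rw [dv_eq (hc 0).sm sv]
      exact Bd.mono hm (((Bd.coef ((hc 0).fp 1) h1.pred).add (Bd.coef ((hc 0).fp 2) h2.pred)).add
        (Bd.coef (hc 0) (h1.2.1.add h2.2.2)))
    exact a.add t.eps2
  | add f g _ _ h1 h2 => exact h1.add h2
  | zero =>
    have := Bd.coef (Cf.zero (Γ := Γ)) (LC.bd (J := J) (lcF (Γ := Γ) [])).eps2
    rw [zero_mul] at this
    exact this.mono (fun d => Rm_mono (by simp) d)

theorem PJ_step (J : ℕ)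
    (tan : ∀ w : List Bool, 1 ≤ w.length → Bd J (ZZ w U : Fam Γ) (RR (w.length + J - 2)))
    (X : ∀ w : List Bool, Bd J (dv a0 (ZZ w U) : Fam Γ) (Rm (w.length + J)) →
      (Bd J (fp 1 (ZZ w U) : Fam Γ) (Rm (w.length + J)) ∧ Bd J (fp 2 (ZZ w U) : Fam Γ) (Rm (w.length + J)))
      ∧ (Bd J (fL (ZZ w U) : Fam Γ) (Rm (w.length + J)) →
        Bd J (fp 1 (fT (ZZ w U)) : Fam Γ) (Rm (w.length + J)) ∧
        Bd J (fp 2 (fT (ZZ w U)) : Fam Γ) (Rm (w.length + J)))) (n : ℕ) :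
    ∀ w : List Bool, w.length = n → PJ (Γ := Γ) J w := by
  induction n using Nat.strong_induction_on with
  | _ n ih =>
  intro w hw
  have hv := (admU (Γ := Γ)).ZZ w
  obtain ⟨g, hg, he⟩ := eqW (Γ := Γ) w
  have bg := Mop_bd hg tan (fun w' h' => ih _ (hw ▸ h') w' rfl)
  have t : Bd J (tg aC (ZZ w U) : Fam Γ) (RR (w.length + J)) := by
    apply tg_bd Cf.aC
    · intro b
      exact (tan (b :: w) (by simp)).mono (RR_mono (by simp; omega))
    · intro b b'
      exact (tan (b :: b' :: w) (by simp)).mono (RR_mono (by simp; omega))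
  have bF : Bd J (eF * eF * ZZ w FF : Fam Γ) (Rm (w.length + J)) := (lcF w).bd.eps2
  have bt : Bd J (eF * eF * tg aC (ZZ w U) : Fam Γ) (Rm (w.length + J)) := t.eps2
  have sd : Sm (dv a0 (ZZ w U) : Fam Γ) := Sm.dv Cf.a0.sm hv.sm
  have bd : Bd J (dv a0 (ZZ w U) : Fam Γ) (Rm (w.length + J)) := by
    refine ((bF.add bg).sub bt).congr sd ?_
    intro d p hp
    have h1 := he d p hp
    have h2 : Mop aC (ZZ w U : Fam Γ) d p = dv a0 (ZZ w U : Fam Γ) d p + (eF * eF * tg aC (ZZ w U) : Fam Γ) d p := rfl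
    rw [h2] at h1
    show (eF * eF * ZZ w FF + g : Fam Γ) d p - (eF * eF * tg aC (ZZ w U) : Fam Γ) d p = _
    linarith
  obtain ⟨⟨h1, h2⟩, hT⟩ := X w bd
  have hL := fL_bd hv.sm bd h1 h2
  obtain ⟨t1, t2⟩ := hT hL
  exact PJ_intro h1 h2 hv.sm (hessJ J hv.sm hL h1 h2 t1 t2)

theorem PJ_all (J : ℕ) : ∀ w : List Bool, PJ (Γ := Γ) J w := by
  induction J using Nat.strong_induction_on with
  | _ J ih =>
  have tan : ∀ w : List Bool, 1 ≤ w.length → Bd J (ZZ w U : Fam Γ) (RR (w.length + J - 2)) := by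
    intro w hw
    match J, ih with
    | 0, _ => exact T_bd w
    | 1, _ =>
      obtain ⟨C, C0, hC⟩ := T_est (Γ := Γ) _ w rfl
      have sv := (admU (Γ := Γ)).ZZ w |>.sm
      have k : ∀ d : Dat Γ, C * (d.ε * RR (w.length - 1) d) ≤ C * RR (w.length + 1 - 2) d := by
        intro d
        have := RR_nonneg (w.length - 1) d
        have := d.hε1
        have e : w.length + 1 - 2 = w.length - 1 := by omega
        rw [e]
        gcongr
        nlinarith
      refine ⟨(T_bd w).mono (RR_mono (by omega)), ⟨sv.fp 1, C, C0, fun d => ?_⟩, ⟨sv.fp 2, C, C0, fun d => ?_⟩⟩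
      · exact (En1 _ d).trans ((hC d).trans (k d))
      · exact (En2 _ d).trans ((hC d).trans (k d))
    | J + 2, ih =>
      obtain ⟨h1, h2⟩ := ih J (by omega) w
      exact ⟨(T_bd w).mono (RR_mono (by omega)), h1.mono (fun d => (Rm_le _ d).trans (RR_mono (by omega) d)),
        h2.mono (fun d => (Rm_le _ d).trans (RR_mono (by omega) d))⟩
  intro w
  refine PJ_step J tan ?_ _ w rfl
  intro w hb
  have hv := (admU (Γ := Γ)).ZZ w
  match J, ih with
  | 0, _ => exact ⟨grad_bd hv hb, fun h => gradT_bd hv h⟩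
  | J + 1, ih =>
    obtain ⟨h1, h2⟩ := ih J (by omega) w
    obtain ⟨k1, k2⟩ := ih J (by omega) (false :: w)
    refine ⟨⟨h1.mono (Rm_mono (by omega)), h2.mono (Rm_mono (by omega))⟩, fun _ => ⟨?_, ?_⟩⟩
    · exact k1.mono (Rm_mono (by simp; omega))
    · exact k2.mono (Rm_mono (by simp; omega))

end

section
open scoped ContDiff
variable {Γ : FramedCurve}

theorem pdIter_snoc (l : List (Fin 3)) (i : Fin 3) (f : P3 → ℝ) :
    pdIter (l ++ [i]) f = pdIter l (pdi i f) := by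
  simp [pdIter]

theorem Bd_iter {R : Dat Γ → ℝ} (l : List (Fin 2)) : ∀ (J : ℕ) (f : Fam Γ), l.length ≤ J → Bd J f R →
    Bd 0 (fun d => pdIter (l.map Fin.succ) (f d) : Fam Γ) R := by
  induction l using List.reverseRecOn with
  | nil => intro J f _ h; exact h.zero'
  | append_singleton l i ih =>
    intro J f hl h
    simp only [List.length_append, List.length_singleton] at hl
    obtain ⟨J, rfl⟩ : ∃ J', J = J' + 1 := ⟨J - 1, by omega⟩
    simp only [List.map_append, List.map_cons, List.map_nil, pdIter_snoc]
    fin_cases i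
    · exact ih J (fp 1 f) (by omega) h.2.1
    · exact ih J (fp 2 f) (by omega) h.2.2

theorem iter_bar (k : ℕ) (d : Dat Γ) : pdIter (List.replicate k (0 : Fin 3)) (barDisk d.u) =
    fbar (ZZ (List.replicate k true) U) d := by
  induction k with
  | zero => rfl
  | succ k ih =>
    rw [List.replicate_succ]
    show pdi 0 (pdIter _ _) = _
    rw [ih]
    exact pdi0_bar ((admU.ZZ _).sm d)

theorem bar_bd (j k : ℕ) : Bd j (fbar (ZZ (List.replicate k true) U) : Fam Γ) (Rm (j - 2 + k)) := by
  have sv := (admU (Γ := Γ)).ZZ (List.replicate k true) |>.sm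
  obtain ⟨h1, h2⟩ := PJ_all (Γ := Γ) 0 (List.replicate k true)
  have b0 : Bd 0 (fbar (ZZ (List.replicate k true) U) : Fam Γ) (Rm k) := by
    apply (Bd_bar sv h1.zero' h2.zero').mono
    exact Rm_mono (by simp)
  match j with
  | 0 => exact b0.mono (Rm_mono (by omega))
  | 1 =>
    refine ⟨b0.mono (Rm_mono (by omega)), ?_, ?_⟩
    · rw [fp1_bar sv]; exact h1.zero'.mono (Rm_mono (by simp))
    · rw [fp2_bar sv]; exact h2.zero'.mono (Rm_mono (by simp))
  | J + 2 =>
    obtain ⟨k1, k2⟩ := PJ_all (Γ := Γ) J (List.replicate k true)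
    refine ⟨b0.mono (Rm_mono (by omega)), ?_, ?_⟩
    · rw [fp1_bar sv]; exact k1.mono (Rm_mono (by simp; omega))
    · rw [fp2_bar sv]; exact k2.mono (Rm_mono (by simp; omega))

theorem final_dat (Γ : FramedCurve) (j k : ℕ) : ∃ C : ℝ, 0 ≤ C ∧ ∀ d : Dat Γ,
    Real.sqrt (mixedNormSq Γ.ℓ j k (barDisk d.u)) ≤ C * Rm (j - 2 + k) d := by
  have h : ∀ s : Fin j → Fin 2, ∃ C : ℝ, 0 ≤ C ∧ ∀ d : Dat Γ,
      NN Γ.ℓ (pdIter ((List.ofFn s).map Fin.succ) (pdIter (List.replicate k (0 : Fin 3)) (barDisk d.u)))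
        ≤ C * Rm (j - 2 + k) d := by
    intro s
    obtain ⟨-, C, C0, hC⟩ := Bd_iter (List.ofFn s) j _ (by simp) (bar_bd (Γ := Γ) j k)
    refine ⟨C, C0, fun d => ?_⟩
    rw [iter_bar]; exact hC d
  choose C C0 hC using h
  refine ⟨Real.sqrt (∑ s, C s ^ 2), Real.sqrt_nonneg _, fun d => ?_⟩
  have R0 : 0 ≤ Rm (j - 2 + k) d := mul_nonneg (sq_nonneg _) (RR_nonneg _ _)
  rw [Real.sqrt_le_left (by positivity), mul_pow, Real.sq_sqrt (by positivity), Finset.sum_mul]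
  unfold mixedNormSq
  apply Finset.sum_le_sum
  intro s _
  rw [L2sq_eq, ← NN_sq, ← mul_pow]
  have := hC s d
  have := NN_nonneg Γ.ℓ (pdIter ((List.ofFn s).map Fin.succ) (pdIter (List.replicate k (0 : Fin 3)) (barDisk d.u)))
  gcongr

end

section
open scoped ContDiff
variable (Γ : FramedCurve)

theorem smooth_gam : ContDiff ℝ ∞ Γ.γ :=
  contDiff_iff_contDiffAt.mpr fun t => (Γ.analytic_γ t).contDiffAt

theorem smooth_tan : ContDiff ℝ ∞ (deriv Γ.γ) := by
  have h := smooth_gam Γ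
  rw [contDiff_infty_iff_deriv] at h
  exact h.2

theorem has_gam (t : ℝ) : HasDerivAt Γ.γ (deriv Γ.γ t) t :=
  ((smooth_gam Γ).differentiable (by simp) t).hasDerivAt

theorem has_tan (t : ℝ) : HasDerivAt (deriv Γ.γ) (Γ.κ t • Γ.e₁ t) t := by
  rw [← Γ.frenet₁ t]
  exact ((smooth_tan Γ).differentiable (by simp) t).hasDerivAt

theorem has_e1 (t : ℝ) : HasDerivAt Γ.e₁ (Γ.τ t • Γ.e₂ t - Γ.κ t • deriv Γ.γ t) t := by
  rw [← Γ.frenet₂ t]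
  exact (Γ.smooth_e₁.differentiable (by simp) t).hasDerivAt

theorem has_e2 (t : ℝ) : HasDerivAt Γ.e₂ (-(Γ.τ t) • Γ.e₁ t) t := by
  rw [← Γ.frenet₃ t]
  exact (Γ.smooth_e₂.differentiable (by simp) t).hasDerivAt

/-- the tube parametrisation -/
def phiT (ε : ℝ) (p : P3) : E3 := tubeCoord Γ ε p.1 (p.2.1, p.2.2)

theorem smooth_phiT (ε : ℝ) : ContDiff ℝ ∞ (phiT Γ ε) := by
  unfold phiT tubeCoord
  have h0 := smooth_gam Γ
  have h1 : ContDiff ℝ ∞ Γ.e₁ := Γ.smooth_e₁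
  have h2 : ContDiff ℝ ∞ Γ.e₂ := Γ.smooth_e₂
  fun_prop

theorem hasF_fst {g : ℝ → E3} {g' : E3} {p : P3} (h : HasDerivAt g g' p.1) :
    HasFDerivAt (fun q : P3 => g q.1) ((ContinuousLinearMap.toSpanSingleton ℝ g').comp
      (ContinuousLinearMap.fst ℝ ℝ (ℝ × ℝ))) p :=
  HasFDerivAt.comp p h.hasFDerivAt hasFDerivAt_fst

theorem fderiv_phiT (ε : ℝ) (p v : P3) : fderiv ℝ (phiT Γ ε) p v =
    v.1 • ((1 - ε * Γ.κ p.1 * p.2.1) • deriv Γ.γ p.1 + (ε * Γ.τ p.1 * p.2.1) • Γ.e₂ p.1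
      - (ε * Γ.τ p.1 * p.2.2) • Γ.e₁ p.1)
    + (v.2.1 * ε) • Γ.e₁ p.1 + (v.2.2 * ε) • Γ.e₂ p.1 := by
  have h := ((hasF_fst (has_gam Γ p.1)).add
    (((hasFDeriv_y1 p).const_mul ε).smul (hasF_fst (has_e1 Γ p.1)))).add
    (((hasFDeriv_y2 p).const_mul ε).smul (hasF_fst (has_e2 Γ p.1)))
  have h' : HasFDerivAt (phiT Γ ε) _ p := h
  rw [h'.fderiv]
  simp
  module

variable {Γ} {F : E3 → ℝ}

/-- `DF(Φ) V`. -/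
def hV (Γ : FramedCurve) (F : E3 → ℝ) (ε : ℝ) (V : ℝ → E3) (p : P3) : ℝ :=
  fderiv ℝ F (phiT Γ ε p) (V p.1)

theorem smooth_hV (hF : ContDiff ℝ ∞ F) (ε : ℝ) {V : ℝ → E3} (hV' : ContDiff ℝ ∞ V) :
    ContDiff ℝ ∞ (hV Γ F ε V) := by
  have h1 : ContDiff ℝ ∞ (fderiv ℝ F) := hF.fderiv_right (by simp)
  unfold hV
  exact (h1.comp (smooth_phiT Γ ε)).clm_apply (hV'.comp contDiff_fst)

theorem fderiv_hV (hF : ContDiff ℝ ∞ F) (ε : ℝ) {V : ℝ → E3} {V' : E3} {p : P3}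
    (h : HasDerivAt V V' p.1) (v : P3) :
    fderiv ℝ (hV Γ F ε V) p v = fderiv ℝ (fderiv ℝ F) (phiT Γ ε p) (fderiv ℝ (phiT Γ ε) p v) (V p.1)
      + v.1 * fderiv ℝ F (phiT Γ ε p) V' := by
  have h1 : ContDiff ℝ ∞ (fderiv ℝ F) := hF.fderiv_right (by simp)
  have hd := (h1.differentiable (by simp) (phiT Γ ε p)).hasFDerivAt.comp p
    ((smooth_phiT Γ ε).differentiable (by simp) p).hasFDerivAt
  have h2 : HasFDerivAt (hV Γ F ε V) _ p := hd.clm_apply (hasF_fst h)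
  rw [h2.fderiv]
  simp
  ring

theorem fderiv_pull (hF : ContDiff ℝ ∞ F) (ε : ℝ) (p v : P3) :
    fderiv ℝ (pullT Γ ε F) p v = fderiv ℝ F (phiT Γ ε p) (fderiv ℝ (phiT Γ ε) p v) := by
  have hd : HasFDerivAt (pullT Γ ε F) _ p := (hF.differentiable (by simp) (phiT Γ ε p)).hasFDerivAt.comp p
    ((smooth_phiT Γ ε).differentiable (by simp) p).hasFDerivAt
  rw [hd.fderiv]; rfl

theorem smooth_pull (hF : ContDiff ℝ ∞ F) (ε : ℝ) : ContDiff ℝ ∞ (pullT Γ ε F) :=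
  hF.comp (smooth_phiT Γ ε)

theorem pdi1_pull (hF : ContDiff ℝ ∞ F) (ε : ℝ) :
    pdi 1 (pullT Γ ε F) = fun p => ε * hV Γ F ε Γ.e₁ p := by
  funext p
  unfold pdi hV; rw [fderiv_pull hF, fderiv_phiT]; simp [e3vec]

theorem pdi2_pull (hF : ContDiff ℝ ∞ F) (ε : ℝ) :
    pdi 2 (pullT Γ ε F) = fun p => ε * hV Γ F ε Γ.e₂ p := by
  funext p
  unfold pdi hV; rw [fderiv_pull hF, fderiv_phiT]; simp [e3vec]

theorem pdi0_pull (hF : ContDiff ℝ ∞ F) (ε : ℝ) (p : P3) :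
    pdi 0 (pullT Γ ε F) p = Γ.τ p.1 * pT (pullT Γ ε F) p
      + (1 - ε * Γ.κ p.1 * p.2.1) * hV Γ F ε (deriv Γ.γ) p := by
  unfold pT
  rw [pdi1_pull hF, pdi2_pull hF]
  unfold pdi hV; rw [fderiv_pull hF, fderiv_phiT]; simp [e3vec]; ring

theorem pdi_hT (hF : ContDiff ℝ ∞ F) (ε : ℝ) (p : P3) :
    pdi 0 (hV Γ F ε (deriv Γ.γ)) p - Γ.τ p.1 * pT (hV Γ F ε (deriv Γ.γ)) p =
      (1 - ε * Γ.κ p.1 * p.2.1) *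
        fderiv ℝ (fderiv ℝ F) (phiT Γ ε p) (deriv Γ.γ p.1) (deriv Γ.γ p.1)
      + Γ.κ p.1 * hV Γ F ε Γ.e₁ p := by
  unfold pT pdi
  rw [fderiv_hV hF ε (has_tan Γ p.1), fderiv_hV hF ε (has_tan Γ p.1), fderiv_hV hF ε (has_tan Γ p.1),
    fderiv_phiT, fderiv_phiT, fderiv_phiT]
  unfold hV
  simp [e3vec]; ring

theorem pdi1_h1 (hF : ContDiff ℝ ∞ F) (ε : ℝ) (p : P3) :
    pdi 1 (hV Γ F ε Γ.e₁) p = ε * fderiv ℝ (fderiv ℝ F) (phiT Γ ε p) (Γ.e₁ p.1) (Γ.e₁ p.1) := by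
  unfold pdi
  rw [fderiv_hV hF ε (has_e1 Γ p.1), fderiv_phiT]
  simp [e3vec]

theorem pdi2_h2 (hF : ContDiff ℝ ∞ F) (ε : ℝ) (p : P3) :
    pdi 2 (hV Γ F ε Γ.e₂) p = ε * fderiv ℝ (fderiv ℝ F) (phiT Γ ε p) (Γ.e₂ p.1) (Γ.e₂ p.1) := by
  unfold pdi
  rw [fderiv_hV hF ε (has_e2 Γ p.1), fderiv_phiT]
  simp [e3vec]

theorem lap3_eq (hF : ContDiff ℝ ∞ F) (x : E3) (b : OrthonormalBasis (Fin 3) ℝ E3) :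
    lap3 F x = ∑ i, fderiv ℝ (fderiv ℝ F) x (b i) (b i) := by
  have h1 : ContDiff ℝ ∞ (fderiv ℝ F) := hF.fderiv_right (by simp)
  have hd : DifferentiableAt ℝ (fderiv ℝ F) x := (h1.differentiable (by simp)) x
  have key : ∀ a c : E3, fderiv ℝ (fun q => fderiv ℝ F q a) x c = fderiv ℝ (fderiv ℝ F) x c a := by
    intro a c
    rw [fderiv_clm_apply hd (differentiableAt_const a)]
    simp
  have e : ∀ b' : OrthonormalBasis (Fin 3) ℝ E3,
      Laplacian.laplacian F x = ∑ i, fderiv ℝ (fderiv ℝ F) x (b' i) (b' i) := by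
    intro b'
    rw [InnerProductSpace.laplacian_eq_iteratedFDeriv_orthonormalBasis F b']
    simp [iteratedFDeriv_two_apply]
  rw [← e b, e (EuclideanSpace.basisFun (Fin 3) ℝ)]
  unfold lap3
  refine Finset.sum_congr rfl fun i _ => ?_
  unfold pd
  rw [key]; simp

theorem lap3_frame (hF : ContDiff ℝ ∞ F) (x : E3) (t : ℝ) :
    lap3 F x = fderiv ℝ (fderiv ℝ F) x (deriv Γ.γ t) (deriv Γ.γ t)
      + fderiv ℝ (fderiv ℝ F) x (Γ.e₁ t) (Γ.e₁ t) + fderiv ℝ (fderiv ℝ F) x (Γ.e₂ t) (Γ.e₂ t) := by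
  have ho : Orthonormal ℝ ![deriv Γ.γ t, Γ.e₁ t, Γ.e₂ t] := by
    constructor
    · intro i; fin_cases i
      · exact Γ.unit_speed t
      · exact Γ.unit_e₁ t
      · exact Γ.unit_e₂ t
    · intro i k hik
      have a := Γ.orth₀₁ t
      have b := Γ.orth₀₂ t
      have c := Γ.orth₁₂ t
      have a' := (real_inner_comm (Γ.e₁ t) (deriv Γ.γ t)).symm.trans a
      have b' := (real_inner_comm (Γ.e₂ t) (deriv Γ.γ t)).symm.trans b
      have c' := (real_inner_comm (Γ.e₂ t) (Γ.e₁ t)).symm.trans c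
      fin_cases i <;> fin_cases k <;> simp_all
  have hc : Fintype.card (Fin 3) = Module.finrank ℝ E3 := by simp
  let B := (basisOfOrthonormalOfCardEqFinrank ho hc).toOrthonormalBasis (by
    rw [coe_basisOfOrthonormalOfCardEqFinrank]; exact ho)
  rw [lap3_eq hF x B, Fin.sum_univ_three]
  simp [B]

theorem mop_pull (hF : ContDiff ℝ ∞ F) {ε : ℝ} (hb : ∀ p ∈ domC, bt Γ ε p = 1 - ε * Γ.κ p.1 * p.2.1)
    {p : P3} (hp : p ∈ domO) :
    mop ε (bt Γ ε) (fun p => (bt Γ ε p)⁻¹) (fun p => - Γ.τ p.1 * (bt Γ ε p)⁻¹)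
      (fun p => Γ.τ p.1 ^ 2 * (bt Γ ε p)⁻¹) (pullT Γ ε F) p
    = ε ^ 2 * (bt Γ ε p * lap3 F (phiT Γ ε p)) := by
  have hsub : ∀ q ∈ domO, q ∈ domC := fun q hq => show q.2.1 ^ 2 + q.2.2 ^ 2 ≤ 1 from le_of_lt hq
  have hnh : ∀ᶠ q in 𝓝 p, q ∈ domO := isOpen_domO.mem_nhds hp
  have cg : ∀ {f g : P3 → ℝ}, (∀ q ∈ domO, f q = g q) → ∀ i, pdi i f p = pdi i g p := by
    intro f g h i
    unfold pdi
    rw [Filter.EventuallyEq.fderiv_eq (hnh.mono h)]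
  have sκ : ContDiff ℝ ∞ Γ.κ := Γ.smooth_κ
  have sτ : ContDiff ℝ ∞ Γ.τ := Γ.smooth_τ
  have sτ' : ContDiff ℝ ∞ (fun p : P3 => Γ.τ p.1) := by fun_prop
  have sk' : ContDiff ℝ ∞ (fun p : P3 => Γ.κ p.1) := by fun_prop
  have s1 := smooth_hV (Γ := Γ) hF ε (V := Γ.e₁) Γ.smooth_e₁
  have s2 := smooth_hV (Γ := Γ) hF ε (V := Γ.e₂) Γ.smooth_e₂
  have sT := smooth_hV (Γ := Γ) hF ε (smooth_tan Γ)
  have sB : ContDiff ℝ ∞ (fun p : P3 => 1 - ε * Γ.κ p.1 * p.2.1) := by fun_prop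
  have bne : ∀ q, bt Γ ε q ≠ 0 := fun q => by
    have := bt_ge Γ ε q
    intro h; rw [h] at this; norm_num at this
  have dk : ∀ i, i ≠ 0 → ∀ g : ℝ → ℝ, ContDiff ℝ ∞ g → pdi i (fun p : P3 => g p.1) p = 0 := by
    intro i hi g hg
    have h2 : HasFDerivAt (fun p : P3 => g p.1) _ p :=
      HasFDerivAt.comp p (hg.differentiable (by simp) p.1).hasFDerivAt hasFDerivAt_fst
    unfold pdi; rw [h2.fderiv]
    fin_cases i
    · exact absurd rfl hi
    · simp [e3vec]
    · simp [e3vec]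
  have dB : ∀ i, i ≠ 0 → pdi i (fun p : P3 => 1 - ε * Γ.κ p.1 * p.2.1) p
      = - (ε * Γ.κ p.1) * pdi i (fun p : P3 => p.2.1) p := by
    intro i hi
    have sx : ContDiff ℝ ∞ (fun q : P3 => ε * Γ.κ q.1) := by fun_prop
    rw [pdi_sub i contDiff_const (sx.mul sm_y1), pdi_mul i sx sm_y1, pdi_const]
    beta_reduce
    rw [dk i hi (fun t => ε * Γ.κ t) (by fun_prop)]; simp
  have A1 : pdi 1 (fun q => bt Γ ε q * pdi 1 (pullT Γ ε F) q) p =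
      ε ^ 2 * (bt Γ ε p * fderiv ℝ (fderiv ℝ F) (phiT Γ ε p) (Γ.e₁ p.1) (Γ.e₁ p.1)
        - Γ.κ p.1 * hV Γ F ε Γ.e₁ p) := by
    rw [cg (g := fun q => (1 - ε * Γ.κ q.1 * q.2.1) * (ε * hV Γ F ε Γ.e₁ q))
      (fun q hq => by rw [hb q (hsub q hq), pdi1_pull hF]),
      pdi_mul 1 sB (contDiff_const.mul s1), pdi_const_mul 1 ε s1]
    beta_reduce
    rw [dB 1 (by decide), pdi1_y1,
      hb p (hsub p hp), pdi1_h1 hF]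
    ring
  have A2 : pdi 2 (fun q => bt Γ ε q * pdi 2 (pullT Γ ε F) q) p =
      ε ^ 2 * (bt Γ ε p * fderiv ℝ (fderiv ℝ F) (phiT Γ ε p) (Γ.e₂ p.1) (Γ.e₂ p.1)) := by
    rw [cg (g := fun q => (1 - ε * Γ.κ q.1 * q.2.1) * (ε * hV Γ F ε Γ.e₂ q))
      (fun q hq => by rw [hb q (hsub q hq), pdi2_pull hF]),
      pdi_mul 2 sB (contDiff_const.mul s2), pdi_const_mul 2 ε s2]
    beta_reduce
    rw [dB 2 (by decide), pdi2_y1,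
      hb p (hsub p hp), pdi2_h2 hF]
    ring
  have A3 : pdi 0 (fun q => (bt Γ ε q)⁻¹ * pdi 0 (pullT Γ ε F) q
      + (- Γ.τ q.1 * (bt Γ ε q)⁻¹) * pT (pullT Γ ε F) q) p = pdi 0 (hV Γ F ε (deriv Γ.γ)) p := by
    apply cg
    intro q hq
    rw [pdi0_pull hF, ← hb q (hsub q hq)]
    field_simp [bne q]
    ring
  have A4 : pT (fun q => (- Γ.τ q.1 * (bt Γ ε q)⁻¹) * pdi 0 (pullT Γ ε F) q
      + (Γ.τ q.1 ^ 2 * (bt Γ ε q)⁻¹) * pT (pullT Γ ε F) q) p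
      = - Γ.τ p.1 * pT (hV Γ F ε (deriv Γ.γ)) p := by
    have e : ∀ q ∈ domO, (- Γ.τ q.1 * (bt Γ ε q)⁻¹) * pdi 0 (pullT Γ ε F) q
      + (Γ.τ q.1 ^ 2 * (bt Γ ε q)⁻¹) * pT (pullT Γ ε F) q
      = (fun q : P3 => - Γ.τ q.1) q * hV Γ F ε (deriv Γ.γ) q := by
      intro q hq
      rw [pdi0_pull hF, ← hb q (hsub q hq)]
      field_simp [bne q]
      ring
    unfold pT at e ⊢
    rw [cg e 1, cg e 2, pdi_mul 1 sτ'.neg sT, pdi_mul 2 sτ'.neg sT]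
    beta_reduce
    rw [dk 1 (by decide) (fun t => - Γ.τ t) (by fun_prop),
      dk 2 (by decide) (fun t => - Γ.τ t) (by fun_prop)]
    ring
  have h5 := pdi_hT (Γ := Γ) hF ε p
  rw [← hb p (hsub p hp)] at h5
  unfold mop
  rw [A1, A2, A3, A4, lap3_frame (Γ := Γ) hF _ p.1]
  linear_combination ε ^ 2 * h5

end

section
open scoped ContDiff
theorem cutoff_ext {f : E3 → ℝ} {Ω K : Set E3} (hΩ : IsOpen Ω) (hK : IsClosed K) (hs : K ⊆ Ω)
    (hf : ContDiffOn ℝ ∞ f Ω) :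
    ∃ F : E3 → ℝ, ContDiff ℝ ∞ F ∧ ∀ x ∈ K, F =ᶠ[𝓝 x] f := by
  obtain ⟨χ, h0, h1, -⟩ := exists_contMDiffMap_zero_one_nhds_of_isClosed (n := (⊤ : ℕ∞))
    (modelWithCornersSelf ℝ E3) hΩ.isClosed_compl hK
    (Set.disjoint_left.mpr fun x hx hx' => hx (hs hx'))
  have hχ : ContDiff ℝ ∞ χ := χ.contMDiff.contDiff
  refine ⟨fun x => χ x * f x, ?_, ?_⟩
  · rw [contDiff_iff_contDiffAt]
    intro x
    by_cases hx : x ∈ Ω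
    · exact hχ.contDiffAt.mul (hf.contDiffAt (hΩ.mem_nhds hx))
    · have h : ∀ᶠ z in 𝓝 x, χ z = 0 := h0.filter_mono (nhds_le_nhdsSet hx)
      have h2 : (fun z => χ z * f z) =ᶠ[𝓝 x] fun _ => 0 := by
        filter_upwards [h] with z hz
        rw [hz, zero_mul]
      exact contDiffAt_const.congr_of_eventuallyEq h2
  · intro x hx
    have h : ∀ᶠ z in 𝓝 x, χ z = 1 := h1.filter_mono (nhds_le_nhdsSet hx)
    filter_upwards [h] with z hz
    rw [hz, one_mul]

theorem phiT_mem_tube (Γ : FramedCurve) {ε : ℝ} (hε : 0 < ε) {p : P3} (hp : p ∈ domO) :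
    phiT Γ ε p ∈ TubeSet Γ ε := by
  have hp' : p.2.1 ^ 2 + p.2.2 ^ 2 < 1 := hp
  unfold TubeSet
  rw [Metric.mem_thickening_iff]
  refine ⟨Γ.γ p.1, ⟨p.1, rfl⟩, ?_⟩
  rw [dist_eq_norm]
  have e : phiT Γ ε p - Γ.γ p.1 = ε • (p.2.1 • Γ.e₁ p.1 + p.2.2 • Γ.e₂ p.1) := by
    unfold phiT tubeCoord; module
  rw [e, norm_smul, Real.norm_of_nonneg hε.le]
  have hn : ‖p.2.1 • Γ.e₁ p.1 + p.2.2 • Γ.e₂ p.1‖ ^ 2 = p.2.1 ^ 2 + p.2.2 ^ 2 := by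
    rw [norm_add_sq_real, norm_smul, norm_smul, Γ.unit_e₁, Γ.unit_e₂, inner_smul_left,
      inner_smul_right, Γ.orth₁₂]
    simp
  have : ‖p.2.1 • Γ.e₁ p.1 + p.2.2 • Γ.e₂ p.1‖ < 1 := by
    by_contra hc
    nlinarith [not_lt.mp hc]
  nlinarith

theorem phiT_mem_closure (Γ : FramedCurve) {ε : ℝ} (hε : 0 < ε) {p : P3} (hp : p ∈ domC) :
    phiT Γ ε p ∈ closure (TubeSet Γ ε) :=
  map_mem_closure (smooth_phiT Γ ε).continuous (domC_subset_closure hp)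
    fun q hq => phiT_mem_tube Γ hε hq

theorem pdIter_ev (l : List (Fin 3)) {f g : P3 → ℝ} {p : P3} (h : f =ᶠ[𝓝 p] g) :
    pdIter l f =ᶠ[𝓝 p] pdIter l g := by
  induction l with
  | nil => exact h
  | cons i l ih =>
    have := ih.fderiv (𝕜 := ℝ)
    filter_upwards [this] with q hq
    show fderiv ℝ (pdIter l f) q _ = fderiv ℝ (pdIter l g) q _
    rw [hq]

theorem mixedNormSq_congr {ℓ : ℝ} {f g : P3 → ℝ} (h : ∀ p ∈ domC, f =ᶠ[𝓝 p] g) (j k : ℕ) :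
    mixedNormSq ℓ j k f = mixedNormSq ℓ j k g := by
  unfold mixedNormSq L2sq
  refine Finset.sum_congr rfl fun s _ => ?_
  refine setIntegral_congr_fun (measurableSet_domP ℓ) fun p hp => ?_
  rw [(pdIter_ev _ (pdIter_ev _ (h p (domP_sub ℓ hp)))).eq_of_nhds]

theorem SobSq_congr {ℓ : ℝ} {f g : P3 → ℝ} (h : ∀ p ∈ domC, f =ᶠ[𝓝 p] g) (k : ℕ) :
    SobSq ℓ k f = SobSq ℓ k g := by
  unfold SobSq
  refine Finset.sum_congr rfl fun s _ => ?_
  refine setIntegral_congr_fun (measurableSet_domP ℓ) fun p hp => ?_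
  rw [((h p (domP_sub ℓ hp)).iteratedFDeriv ℝ s).eq_of_nhds]

theorem barDisk_ev {f g : P3 → ℝ} (h : ∀ p ∈ domC, f =ᶠ[𝓝 p] g) :
    ∀ p ∈ domC, barDisk f =ᶠ[𝓝 p] barDisk g := by
  intro p hp
  filter_upwards [h p hp] with q hq
  unfold barDisk
  rw [hq]
  congr 2
  refine setIntegral_congr_fun measurableSet_dsk fun y hy => ?_
  exact (h (q.1, y.1, y.2) hy).eq_of_nhds

theorem lap3_ev {f g : E3 → ℝ} {x : E3} (h : f =ᶠ[𝓝 x] g) : lap3 f x = lap3 g x := by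
  unfold lap3
  refine Finset.sum_congr rfl fun i _ => ?_
  have h1 : pd i f =ᶠ[𝓝 x] pd i g := by
    filter_upwards [h.fderiv (𝕜 := ℝ)] with z hz
    unfold pd; rw [hz]
  show fderiv ℝ (pd i f) x _ = fderiv ℝ (pd i g) x _
  rw [h1.fderiv_eq]

theorem perA_pull (Γ : FramedCurve) (ε : ℝ) (f : E3 → ℝ) : PerA Γ.ℓ (pullT Γ ε f) := by
  intro p
  unfold pullT tubeCoord
  simp only [Γ.periodic_γ p.1, Γ.periodic_e₁ p.1, Γ.periodic_e₂ p.1]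

theorem kap_bdd (Γ : FramedCurve) : ∃ K : ℝ, 0 ≤ K ∧ ∀ t, |Γ.κ t| ≤ K := by
  obtain ⟨K, hK⟩ := (isCompact_Icc (a := (0:ℝ)) (b := Γ.ℓ)).exists_bound_of_continuousOn
    Γ.smooth_κ.continuous.continuousOn
  refine ⟨K, (norm_nonneg _).trans (hK 0 ⟨le_rfl, Γ.hℓ.le⟩), fun t => ?_⟩
  obtain ⟨s, hs, e⟩ := Γ.periodic_κ.exists_mem_Ico₀ Γ.hℓ t
  rw [e]; exact hK s ⟨hs.1, hs.2.le⟩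

theorem circ_param {a b : ℝ} (h : a ^ 2 + b ^ 2 = 1) : ∃ θ : ℝ, a = cos θ ∧ b = sin θ := by
  have hz : ‖(⟨a, b⟩ : ℂ)‖ = 1 := by
    rw [Complex.norm_def, Complex.normSq_mk, ← sq, ← sq, h, Real.sqrt_one]
  obtain ⟨θ, hθ⟩ := (Complex.norm_eq_one_iff _).mp hz
  refine ⟨θ, ?_, ?_⟩
  · have := congrArg Complex.re hθ
    rw [Complex.exp_ofReal_mul_I_re] at this; exact this.symm
  · have := congrArg Complex.im hθ
    rw [Complex.exp_ofReal_mul_I_im] at this; exact this.symm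

theorem exists_dat (Γ : FramedCurve) {ε : ℝ} (hε : 0 < ε) (hε1 : ε ≤ 1)
    (hb : ∀ p ∈ domC, bt Γ ε p = 1 - ε * Γ.κ p.1 * p.2.1) {Ψ Ρ : E3 → ℝ}
    (hN : NeumannSol Γ ε Ψ Ρ) :
    ∃ d : Dat Γ, d.ε = ε ∧ (∀ p ∈ domC, d.u =ᶠ[𝓝 p] pullT Γ ε Ψ)
      ∧ (∀ p ∈ domC, d.ρ =ᶠ[𝓝 p] pullT Γ ε Ρ) := by
  obtain ⟨⟨Ω, hΩ, hsub, sΨ, sΡ⟩, hL, hB, hM⟩ := hN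
  obtain ⟨F, sF, hF⟩ := cutoff_ext hΩ isClosed_closure hsub sΨ
  obtain ⟨R, sR, hR⟩ := cutoff_ext hΩ isClosed_closure hsub sΡ
  have eF : ∀ p ∈ domC, pullT Γ ε F =ᶠ[𝓝 p] pullT Γ ε Ψ := fun p hp =>
    (smooth_phiT Γ ε).continuous.continuousAt.eventually (hF _ (phiT_mem_closure Γ hε hp))
  have eR : ∀ p ∈ domC, pullT Γ ε R =ᶠ[𝓝 p] pullT Γ ε Ρ := fun p hp =>
    (smooth_phiT Γ ε).continuous.continuousAt.eventually (hR _ (phiT_mem_closure Γ hε hp))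
  have sκ : ContDiff ℝ ∞ Γ.κ := Γ.smooth_κ
  have sτ : ContDiff ℝ ∞ Γ.τ := Γ.smooth_τ
  have sb : ContDiff ℝ ∞ (bt Γ ε) := by
    have h : ContDiff ℝ ∞ (fun p : P3 => ε * Γ.κ p.1 * p.2.1) := by fun_prop
    exact contDiff_const.sub (smooth_zetaB.comp h)
  have bne : ∀ q, bt Γ ε q ≠ 0 := fun q => by
    have := bt_ge Γ ε q
    intro h; rw [h] at this; norm_num at this
  have sbi : ContDiff ℝ ∞ (fun p => (bt Γ ε p)⁻¹) := sb.inv bne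
  have su := smooth_pull (Γ := Γ) sF ε
  have sρ := smooth_pull (Γ := Γ) sR ε
  refine ⟨⟨ε, pullT Γ ε F, pullT Γ ε R, hε, hε1, su, sρ, perA_pull _ _ _, perA_pull _ _ _,
    ?_, ?_, ?_⟩, rfl, eF, eR⟩
  · intro p hp
    obtain ⟨θ, h1, h2⟩ := circ_param hp
    have hc : p ∈ domC := le_of_eq hp
    have := hB p.1 θ
    rw [← h1, ← h2] at this
    rw [pdi1_pull sF, pdi2_pull sF]
    unfold hV
    beta_reduce
    rw [(hF _ (phiT_mem_closure Γ hε hc)).fderiv_eq]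
    have e : fderiv ℝ Ψ (phiT Γ ε p) (p.2.1 • Γ.e₁ p.1 + p.2.2 • Γ.e₂ p.1) = 0 := this
    rw [map_add, map_smul, map_smul, smul_eq_mul, smul_eq_mul] at e
    linear_combination ε * e
  · rw [II_congr (g := pullT Γ ε Ψ) fun p hp => (eF p hp).eq_of_nhds]
    exact hM
  · have s0 := smooth_pdi 0 su
    have s1 := smooth_pdi 1 su
    have s2 := smooth_pdi 2 su
    have sT := smooth_pT su
    have st : ContDiff ℝ ∞ (fun p : P3 => - Γ.τ p.1) := by fun_prop
    have st2 : ContDiff ℝ ∞ (fun p : P3 => Γ.τ p.1 ^ 2) := by fun_prop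
    have sc : ContDiff ℝ ∞ (mop ε (bt Γ ε) (fun p => (bt Γ ε p)⁻¹)
        (fun p => - Γ.τ p.1 * (bt Γ ε p)⁻¹)
        (fun p => Γ.τ p.1 ^ 2 * (bt Γ ε p)⁻¹) (pullT Γ ε F)) := by
      unfold mop
      exact ((smooth_pdi 1 (sb.mul s1)).add (smooth_pdi 2 (sb.mul s2))).add
        (contDiff_const.mul ((smooth_pdi 0 ((sbi.mul s0).add ((st.mul sbi).mul sT))).add
          (smooth_pT (((st.mul sbi).mul s0).add ((st2.mul sbi).mul sT)))))
    refine eqOn_domC_of_domO sc.continuous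
      (contDiff_const.mul (sb.mul sρ)).continuous ?_
    intro p hp
    have hc : p ∈ domC := show p.2.1 ^ 2 + p.2.2 ^ 2 ≤ 1 from le_of_lt hp
    rw [mop_pull sF hb hp, lap3_ev (hF _ (phiT_mem_closure Γ hε hc)),
      hL _ (phiT_mem_tube Γ hε hp), (eR p hc).eq_of_nhds]
    rfl

theorem main_est (Γ : FramedCurve) (j k : ℕ) :
    ∃ C > (0 : ℝ), ∃ ε₀ > (0 : ℝ), ∀ ε : ℝ, 0 < ε → ε < ε₀ →
      ∀ Ψ Ρ : E3 → ℝ, NeumannSol Γ ε Ψ Ρ →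
        Real.sqrt (mixedNormSq Γ.ℓ j k (barDisk (pullT Γ ε Ψ))) ≤
          C * ε ^ 2 * Real.sqrt (SobSq Γ.ℓ (j - 2 + k) (pullT Γ ε Ρ)) := by
  obtain ⟨C, hC, h⟩ := final_dat Γ j k
  obtain ⟨K, hK, hκ⟩ := kap_bdd Γ
  refine ⟨C + 1, by linarith, min 1 (1 / (2 * (K + 1))), by positivity, ?_⟩
  intro ε hε hlt Ψ Ρ hN
  have h1 : ε ≤ 1 := (hlt.trans_le (min_le_left _ _)).le
  have h2 : ε * (K + 1) ≤ 1 / 2 := by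
    have := (hlt.trans_le (min_le_right _ _)).le
    rw [le_div_iff₀ (by positivity)] at this
    linarith
  have hb : ∀ p ∈ domC, bt Γ ε p = 1 - ε * Γ.κ p.1 * p.2.1 := by
    intro p hp
    have hp' : p.2.1 ^ 2 + p.2.2 ^ 2 ≤ 1 := hp
    unfold bt
    rw [zetaB_eq]
    have hy : |p.2.1| ≤ 1 := by
      rw [← sq_le_one_iff_abs_le_one]; nlinarith [sq_nonneg p.2.2]
    rw [abs_mul, abs_mul, abs_of_pos hε]
    have hk := hκ p.1
    calc ε * |Γ.κ p.1| * |p.2.1| ≤ ε * (K + 1) * 1 := by gcongr; linarith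
      _ ≤ 1 / 2 := by linarith
  obtain ⟨d, e1, e2, e3⟩ := exists_dat Γ hε h1 hb hN
  have hd := h d
  unfold Rm RR at hd
  rw [mixedNormSq_congr (barDisk_ev e2), SobSq_congr e3, e1] at hd
  have : 0 ≤ ε ^ 2 * Real.sqrt (SobSq Γ.ℓ (j - 2 + k) (pullT Γ ε Ρ)) := by positivity
  linarith

end

/-- **Optimal estimates for the Neumann Laplacian in thin tubes** (Theorem 4.8).
If `ψ` is the zero-mean solution of the Neumann problem `Δψ = ρ` in `𝕊¹_ℓ × 𝔻²`,
then `‖D_y^j ∂_α^k ψ̄‖ ≤ C_{jk} ε² ‖ρ‖_{H^{J+k}}` with `J = max (j−2) 0` and `C_{jk}`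
independent of `ε`. -/
theorem neumann_laplacian_fast_variable_estimates
    (Γ : FramedCurve) (j k : ℕ) :
    ∃ C > (0 : ℝ), ∃ ε₀ > (0 : ℝ), ∀ ε : ℝ, 0 < ε → ε < ε₀ →
      ∀ Ψ Ρ : E3 → ℝ, NeumannSol Γ ε Ψ Ρ →
        -- compatibility: `∫ ρ dV = 0`, where `dV = B dα dy`
        (∫ p in domP Γ.ℓ, pullT Γ ε Ρ p * (1 - ε * Γ.κ p.1 * p.2.1) = 0) →
        Real.sqrt (mixedNormSq Γ.ℓ j k (barDisk (pullT Γ ε Ψ))) ≤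
          C * ε ^ 2 * Real.sqrt (SobSq Γ.ℓ (j - 2 + k) (pullT Γ ε Ρ)) := by
  obtain ⟨C, hC, ε₀, hε₀, h⟩ := main_est Γ j k
  exact ⟨C, hC, ε₀, hε₀, fun ε h1 h2 Ψ Ρ hN _ => h ε h1 h2 Ψ Ρ hN⟩
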